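/- Let α : ℝ → ℝ be continuous and positive, L > 0, and let ψ be concave and positive on (0,L/2). Then the minimal supersolution ψ₊ is regular on (0,L/2) × (0,∞) (it has continuous spatial derivatives up to second order and a continuous first time derivative there) and satisfies ∂_t ψ₊ = α(∂_x ψ₊) ∂²_x ψ₊ on (0,L/2) × (0,∞). -/

import Mathlib

open Set Real Filter

/-- Partial derivative in the spatial variable. -/
noncomputable def pderivX (u : ℝ → ℝ → ℝ) (x t : ℝ) : ℝ := deriv (fun y => u y t) x

/-- Second partial derivative in the spatial variable. -/
noncomputable def pderivXX (u : ℝ → ℝ → ℝ) (x t : ℝ) : ℝ := deriv (fun y => pderivX u y t) x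

/-- Partial derivative in the time variable. -/
noncomputable def pderivT (u : ℝ → ℝ → ℝ) (x t : ℝ) : ℝ := deriv (fun s => u x s) t

/-- `u` is regular on `S`: it is continuous, has spatial derivatives up to second order and a
first time derivative on `S`, and these are continuous on `S`. -/
def RegularOn (u : ℝ → ℝ → ℝ) (S : Set (ℝ × ℝ)) : Prop :=
  ContinuousOn (fun p : ℝ × ℝ => u p.1 p.2) S ∧
  (∀ p ∈ S, DifferentiableAt ℝ (fun y => u y p.2) p.1) ∧
  (∀ p ∈ S, DifferentiableAt ℝ (fun y => pderivX u y p.2) p.1) ∧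
  (∀ p ∈ S, DifferentiableAt ℝ (fun s => u p.1 s) p.2) ∧
  ContinuousOn (fun p : ℝ × ℝ => pderivX u p.1 p.2) S ∧
  ContinuousOn (fun p : ℝ × ℝ => pderivXX u p.1 p.2) S ∧
  ContinuousOn (fun p : ℝ × ℝ => pderivT u p.1 p.2) S

/-- `ψ` is a modulus of continuity for the `L`-periodic function `u`. -/
def IsModulus (L : ℝ) (ψ : ℝ → ℝ) (u : ℝ → ℝ) : Prop :=
  ∀ x y : ℝ, 0 < y - x → y - x < L →
    -(2 * ψ ((L + x - y) / 2)) ≤ u y - u x ∧ u y - u x ≤ 2 * ψ ((y - x) / 2)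

/-- Membership in the class `S_ψ` of supersolutions of `∂ₜφ = α(φ')φ''` on
`[0, L/2] × [0, ∞)` lying above `ψ` at time `0`. -/
def MemS (α : ℝ → ℝ) (L : ℝ) (ψ : ℝ → ℝ) (φ : ℝ → ℝ → ℝ) : Prop :=
  (∀ z t : ℝ, z ∈ Icc 0 (L/2) → 0 ≤ t → 0 ≤ φ z t) ∧
  ContinuousOn (fun p : ℝ × ℝ => φ p.1 p.2)
    ((Icc 0 (L/2) ×ˢ Ici 0) \ {((0:ℝ), (0:ℝ)), ((L/2 : ℝ), (0:ℝ))}) ∧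
  RegularOn φ (Ioo 0 (L/2) ×ˢ Ioi 0) ∧
  (∀ z t : ℝ, z ∈ Ioo 0 (L/2) → 0 < t →
    α (pderivX φ z t) * pderivXX φ z t ≤ pderivT φ z t) ∧
  (∀ z ∈ Ioo (0:ℝ) (L/2), ψ z ≤ φ z 0)

/-- The minimal supersolution `ψ₊`. -/
noncomputable def psiPlus (α : ℝ → ℝ) (L : ℝ) (ψ : ℝ → ℝ) (z t : ℝ) : ℝ :=
  sInf {y : ℝ | ∃ φ : ℝ → ℝ → ℝ, MemS α L ψ φ ∧ φ z t = y}

namespace PsiPlus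
open scoped Topology

theorem isLocalMax_second_deriv {g g1 : ℝ → ℝ} {g2 x : ℝ} (hmax : IsLocalMax g x)
    (h1 : ∀ᶠ y in 𝓝 x, HasDerivAt g (g1 y) y) (h2 : HasDerivAt g1 g2 x) :
    g1 x = 0 ∧ g2 ≤ 0 := by
  have h0 : g1 x = 0 := hmax.hasDerivAt_eq_zero h1.self_of_nhds
  refine ⟨h0, ?_⟩
  by_contra! hpos
  have e1 : deriv g =ᶠ[𝓝 x] g1 := h1.mono fun y hy => hy.deriv
  have hd : deriv (deriv g) x = g2 := by rw [e1.deriv_eq, h2.deriv]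
  have hmin : IsLocalMin g x := by
    apply isLocalMin_of_deriv_deriv_pos
    · rw [hd]; exact hpos
    · rw [e1.self_of_nhds, h0]
    · exact h1.self_of_nhds.continuousAt
  have hc : g =ᶠ[𝓝 x] fun _ => g x := by
    filter_upwards [hmax, hmin] with y a b using le_antisymm a b
  have e2 : deriv g =ᶠ[𝓝 x] fun _ => 0 := by
    have := hc.deriv
    simpa using this
  have : deriv (deriv g) x = 0 := by rw [e2.deriv_eq]; simp
  linarith

theorem deriv_nonneg_of_left_max {g : ℝ → ℝ} {g' s₀ t : ℝ} (hs : s₀ < t)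
    (hm : ∀ s ∈ Icc s₀ t, g s ≤ g t) (h : HasDerivAt g g' t) : 0 ≤ g' := by
  have h1 : HasDerivWithinAt g g' (Iio t) t := h.hasDerivWithinAt
  rw [hasDerivWithinAt_iff_tendsto_slope' (by simp)] at h1
  refine ge_of_tendsto h1 ?_
  filter_upwards [Ico_mem_nhdsLT hs] with s hs'
  rw [slope_def_field]
  apply div_nonneg_of_nonpos
  · linarith [hm s ⟨hs'.1, hs'.2.le⟩]
  · linarith [hs'.2]

/-- `W` solves `∂ₜW = a ∂²ₓW` at the point `(x, t)` for some coefficient `a ∈ [c₁, c₂]`. -/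
def PtSol (W : ℝ → ℝ → ℝ) (c₁ c₂ x t : ℝ) : Prop :=
  ∃ (wx : ℝ → ℝ) (wxx wt a : ℝ), (∀ᶠ y in 𝓝 x, HasDerivAt (fun y => W y t) (wx y) y) ∧
    HasDerivAt wx wxx x ∧ HasDerivAt (fun s => W x s) wt t ∧ a ∈ Icc c₁ c₂ ∧ wt = a * wxx

theorem PtSol.rescale {W : ℝ → ℝ → ℝ} {c₁ c₂ x t : ℝ} {x₀ t₀ r ρ m n k : ℝ}
    (hr : 0 < r) (hρ : 0 < ρ) (h : PtSol W c₁ c₂ (x₀ + r * x) (t₀ + ρ * t)) :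
    PtSol (fun x t => (W (x₀ + r * x) (t₀ + ρ * t) - (m + n * x)) / k)
      (c₁ * (ρ / r ^ 2)) (c₂ * (ρ / r ^ 2)) x t := by
  obtain ⟨wx, wxx, wt, a, h1, h2, h3, h4, h5⟩ := h
  have hlin : ∀ y : ℝ, HasDerivAt (fun y => x₀ + r * y) r y := fun y => by
    simpa using ((hasDerivAt_id y).const_mul r).const_add x₀
  refine ⟨fun y => (wx (x₀ + r * y) * r - n) / k, wxx * r * r / k, wt * ρ / k, a * (ρ / r ^ 2),
    ?_, ?_, ?_, ?_, ?_⟩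
  · have hc : Tendsto (fun y => x₀ + r * y) (𝓝 x) (𝓝 (x₀ + r * x)) :=
      (hlin x).continuousAt
    filter_upwards [hc.eventually h1] with y hy
    have := hy.comp y (hlin y)
    have h' : HasDerivAt (fun y => m + n * y) n y := by
      simpa using ((hasDerivAt_id y).const_mul n).const_add m
    exact (this.sub h').div_const k
  · have := (h2.comp x (hlin x)).mul_const r
    exact (this.sub_const n).div_const k
  · have hl : HasDerivAt (fun s => t₀ + ρ * s) ρ t := by
      simpa using ((hasDerivAt_id t).const_mul ρ).const_add t₀
    exact ((h3.comp t hl).sub_const _).div_const k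
  · have : 0 ≤ ρ / r ^ 2 := by positivity
    exact ⟨mul_le_mul_of_nonneg_right h4.1 this, mul_le_mul_of_nonneg_right h4.2 this⟩
  · rw [h5]; field_simp

theorem PtSol.neg {W : ℝ → ℝ → ℝ} {c₁ c₂ x t : ℝ} (h : PtSol W c₁ c₂ x t) :
    PtSol (fun x t => -W x t) c₁ c₂ x t := by
  obtain ⟨wx, wxx, wt, a, h1, h2, h3, h4, h5⟩ := h
  exact ⟨fun y => -wx y, -wxx, -wt, a, h1.mono fun y hy => hy.neg, h2.neg, h3.neg, h4,
    by rw [h5]; ring⟩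

theorem PtSol.mono {W : ℝ → ℝ → ℝ} {c₁ c₂ d₁ d₂ x t : ℝ} (h : PtSol W c₁ c₂ x t)
    (h1 : d₁ ≤ c₁) (h2 : c₂ ≤ d₂) : PtSol W d₁ d₂ x t := by
  obtain ⟨wx, wxx, wt, a, k1, k2, k3, k4, k5⟩ := h
  exact ⟨wx, wxx, wt, a, k1, k2, k3, ⟨h1.trans k4.1, k4.2.trans h2⟩, k5⟩

theorem nonpos_of_no_positive_max {E : Type*} [TopologicalSpace E] {S : Set E} (hS : IsCompact S)
    {f : E → ℝ} (hf : ContinuousOn f S)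
    (h : ∀ p ∈ S, 0 < f p → (∀ q ∈ S, f q ≤ f p) → False) : ∀ p ∈ S, f p ≤ 0 := by
  intro p hp
  obtain ⟨q, hq, hmax⟩ := hS.exists_isMaxOn ⟨p, hp⟩ hf
  by_contra! hpos
  exact h q hq (hpos.trans_le (hmax hp)) fun z hz => hmax hz

/-- Two-point maximum principle on the unit cylinder. -/
theorem two_point_bound {W : ℝ → ℝ → ℝ} {l c₂ : ℝ} (hl : 0 < l)
    (hW : ContinuousOn (fun p : ℝ × ℝ => W p.1 p.2) (Icc (-1) 1 ×ˢ Icc (-1) 0))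
    (hS : ∀ x ∈ Ioo (-1 : ℝ) 1, ∀ t ∈ Ioc (-1 : ℝ) 0, PtSol W l c₂ x t)
    (hb : ∀ x ∈ Icc (-1 : ℝ) 1, ∀ t ∈ Icc (-1 : ℝ) 0, |W x t| ≤ 1)
    {x y t : ℝ} (hx : x ∈ Icc (-1 : ℝ) 1) (hy : y ∈ Icc (-1 : ℝ) 1) (hyx : y ≤ x)
    (ht : t ∈ Icc (-1 : ℝ) 0) :
    W x t - W y t ≤ (3 + 1 / l) * (4 * (x - y) - (x - y) ^ 2) + 2 * x ^ 2 + 2 * y ^ 2 - 2 * t := by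
  set K := 3 + 1 / l with hK
  have hlinv : l * (1 / l) = 1 := by field_simp
  have hlp : 0 < 1 / l := by positivity
  set S : Set (ℝ × ℝ × ℝ) :=
    {p | p.1 ∈ Icc (-1 : ℝ) 1 ∧ p.2.1 ∈ Icc (-1 : ℝ) 1 ∧ p.2.2 ∈ Icc (-1 : ℝ) 0 ∧ p.2.1 ≤ p.1}
    with hSdef
  have hScomp : IsCompact S := by
    have h1 : IsCompact (Icc (-1 : ℝ) 1 ×ˢ Icc (-1 : ℝ) 1 ×ˢ Icc (-1 : ℝ) 0) :=
      isCompact_Icc.prod (isCompact_Icc.prod isCompact_Icc)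
    have h2 : IsClosed {p : ℝ × ℝ × ℝ | p.2.1 ≤ p.1} :=
      isClosed_le (by fun_prop) (by fun_prop)
    convert h1.inter_right h2 using 1
    ext p
    simp only [hSdef, mem_ofPred_eq, mem_inter_iff, mem_prod]
    tauto
  set f : ℝ × ℝ × ℝ → ℝ := fun p => W p.1 p.2.2 - W p.2.1 p.2.2 -
    (K * (4 * (p.1 - p.2.1) - (p.1 - p.2.1) ^ 2) + 2 * p.1 ^ 2 + 2 * p.2.1 ^ 2 - 2 * p.2.2) with hf
  have hfc : ContinuousOn f S := by
    have c1 : ContinuousOn (fun p : ℝ × ℝ × ℝ => W p.1 p.2.2) S :=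
      hW.comp (f := fun p : ℝ × ℝ × ℝ => (p.1, p.2.2)) (by fun_prop)
        (fun p hp => ⟨hp.1, hp.2.2.1⟩)
    have c2 : ContinuousOn (fun p : ℝ × ℝ × ℝ => W p.2.1 p.2.2) S :=
      hW.comp (f := fun p : ℝ × ℝ × ℝ => (p.2.1, p.2.2)) (by fun_prop)
        (fun p hp => ⟨hp.2.1, hp.2.2.1⟩)
    exact (c1.sub c2).sub (by fun_prop)
  have main := nonpos_of_no_positive_max hScomp hfc ?_ (x, y, t) ⟨hx, hy, ht, hyx⟩
  · simp only [hf] at main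
    linarith
  rintro ⟨x, y, t⟩ ⟨hx, hy, ht, hyx⟩ hpos hmax
  simp only at hx hy ht hyx
  simp only [hf] at hpos
  have bx := abs_le.1 (hb x hx t ht)
  have bY := abs_le.1 (hb y hy t ht)
  have hs : 0 ≤ K * (4 * (x - y) - (x - y) ^ 2) := by
    have : 0 ≤ 4 * (x - y) - (x - y) ^ 2 := by nlinarith [hx.2, hy.1]
    positivity
  have hyx' : y < x := by
    rcases hyx.lt_or_eq with h | h
    · exact h
    · subst h; nlinarith [ht.2, sq_nonneg y]
  have hx1 : x < 1 := by
    rcases hx.2.lt_or_eq with h | h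
    · exact h
    · subst h; nlinarith [ht.2, sq_nonneg y]
  have hy1 : -1 < y := by
    rcases hy.1.lt_or_eq with h | h
    · exact h
    · subst h; nlinarith [ht.2, sq_nonneg x]
  have ht1 : -1 < t := by
    rcases ht.1.lt_or_eq with h | h
    · exact h
    · subst h; nlinarith [sq_nonneg x, sq_nonneg y]
  obtain ⟨wx, wxx, wt, a, h1, h2, h3, h4, h5⟩ := hS x ⟨hy1.trans hyx', hx1⟩ t ⟨ht1, ht.2⟩
  obtain ⟨vx, vxx, vt, b, k1, k2, k3, k4, k5⟩ := hS y ⟨hy1, hyx'.trans hx1⟩ t ⟨ht1, ht.2⟩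
  have dquad : ∀ z : ℝ, HasDerivAt (fun z => K * (4 * (z - y) - (z - y) ^ 2) + 2 * z ^ 2 +
      2 * y ^ 2 - 2 * t) (K * (4 - 2 * (z - y)) + 4 * z) z := fun z => by
    have e1 : HasDerivAt (fun z => z - y) 1 z := (hasDerivAt_id z).sub_const y
    have := ((((e1.const_mul 4).sub (e1.pow 2)).const_mul K).add
      (((hasDerivAt_id z).pow 2).const_mul 2)).add_const (2 * y ^ 2) |>.sub_const (2 * t)
    refine this.congr_deriv ?_
    norm_num
    ring
  have dquad' : ∀ z : ℝ, HasDerivAt (fun z => K * (4 * (x - z) - (x - z) ^ 2) + 2 * x ^ 2 +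
      2 * z ^ 2 - 2 * t) (K * (-4 + 2 * (x - z)) + 4 * z) z := fun z => by
    have e1 : HasDerivAt (fun z => x - z) (-1) z := (hasDerivAt_id z).const_sub x
    have := ((((e1.const_mul 4).sub (e1.pow 2)).const_mul K).add_const (2 * x ^ 2)).add
      (((hasDerivAt_id z).pow 2).const_mul 2) |>.sub_const (2 * t)
    refine this.congr_deriv ?_
    norm_num
    ring
  have dlin : ∀ z c e : ℝ, HasDerivAt (fun z => c * z + e) c z := fun z c e => by
    simpa using ((hasDerivAt_id z).const_mul c).add_const e
  have tx := isLocalMax_second_deriv (g := fun z => f (z, y, t))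
    (g1 := fun z => wx z - 0 - (K * (4 - 2 * (z - y)) + 4 * z)) (g2 := wxx - (-2 * K + 4)) (x := x)
    (by
      filter_upwards [Ioo_mem_nhds hyx' hx1] with z hz
      exact hmax (z, y, t) ⟨⟨by linarith [hz.1], hz.2.le⟩, hy, ht, hz.1.le⟩)
    (by
      filter_upwards [h1] with z hz
      exact (hz.sub (hasDerivAt_const z (W y t))).sub (dquad z))
    (by
      have := (h2.sub_const 0).sub (dlin x (-2 * K + 4) (K * (4 + 2 * y)))
      refine this.congr_of_eventuallyEq (Eventually.of_forall fun z => ?_)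
      simp only [Pi.sub_apply]; ring)
  have ty := isLocalMax_second_deriv (g := fun z => f (x, z, t))
    (g1 := fun z => 0 - vx z - (K * (-4 + 2 * (x - z)) + 4 * z)) (g2 := -vxx - (-2 * K + 4)) (x := y)
    (by
      filter_upwards [Ioo_mem_nhds hy1 hyx'] with z hz
      exact hmax (x, z, t) ⟨hx, ⟨hz.1.le, by linarith [hz.2]⟩, ht, hz.2.le⟩)
    (by
      filter_upwards [k1] with z hz
      exact ((hasDerivAt_const z (W x t)).sub hz).sub (dquad' z))
    (by
      have := (k2.const_sub 0).sub (dlin y (-2 * K + 4) (K * (-4 + 2 * x)))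
      refine this.congr_of_eventuallyEq (Eventually.of_forall fun z => ?_)
      simp only [Pi.sub_apply]; ring)
  have tt := deriv_nonneg_of_left_max (g := fun s => f (x, y, s)) (g' := wt - vt - (-2)) ht1
    (fun s hs => hmax (x, y, s) ⟨hx, hy, ⟨hs.1, hs.2.trans ht.2⟩, hyx⟩)
    (by
      refine (((h3.sub k3).sub (dlin t (-2) (K * (4 * (x - y) - (x - y) ^ 2) + 2 * x ^ 2 +
        2 * y ^ 2)))).congr_of_eventuallyEq (Eventually.of_forall fun z => ?_)
      simp only [hf, Pi.sub_apply]; ring)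
  have hA : a * wxx ≤ l * (4 - 2 * K) := by
    have : wxx ≤ 4 - 2 * K := by linarith [tx.2]
    nlinarith [h4.1]
  have hB : -(b * vxx) ≤ l * (4 - 2 * K) := by
    have : -vxx ≤ 4 - 2 * K := by linarith [ty.2]
    nlinarith [k4.1]
  rw [h5, k5] at tt
  nlinarith

theorem kruzhkov_unit {W : ℝ → ℝ → ℝ} {l c₂ : ℝ} (hl : 0 < l)
    (hW : ContinuousOn (fun p : ℝ × ℝ => W p.1 p.2) (Icc (-1) 1 ×ˢ Icc (-1) 0))
    (hS : ∀ x ∈ Ioo (-1 : ℝ) 1, ∀ t ∈ Ioc (-1 : ℝ) 0, PtSol W l c₂ x t)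
    (hb : ∀ x ∈ Icc (-1 : ℝ) 1, ∀ t ∈ Icc (-1 : ℝ) 0, |W x t| ≤ 1)
    {x : ℝ} (hx : x ∈ Icc (-1 : ℝ) 1) :
    |W x 0 - W 0 0| ≤ (14 + 4 / l) * |x| := by
  have hlp : 0 < 1 / l := by positivity
  have hdiv : 4 / l = 4 * (1 / l) := by ring
  have z0 : (0 : ℝ) ∈ Icc (-1 : ℝ) 0 := by norm_num
  have z1 : (0 : ℝ) ∈ Icc (-1 : ℝ) 1 := by norm_num
  have hW' : ContinuousOn (fun p : ℝ × ℝ => -W p.1 p.2) (Icc (-1) 1 ×ˢ Icc (-1) 0) := hW.neg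
  have hS' : ∀ x ∈ Ioo (-1 : ℝ) 1, ∀ t ∈ Ioc (-1 : ℝ) 0, PtSol (fun x t => -W x t) l c₂ x t :=
    fun x hx t ht => (hS x hx t ht).neg
  have hb' : ∀ x ∈ Icc (-1 : ℝ) 1, ∀ t ∈ Icc (-1 : ℝ) 0, |-W x t| ≤ 1 := by
    simpa using hb
  rw [hdiv]
  rcases le_total 0 x with h | h
  · have a1 := two_point_bound hl hW hS hb hx z1 h z0
    have a2 := two_point_bound hl hW' hS' hb' hx z1 h z0
    rw [abs_of_nonneg h, abs_le]
    constructor <;> nlinarith [hx.2, mul_nonneg hlp.le h, mul_nonneg hlp.le (sq_nonneg x)]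
  · have a1 := two_point_bound hl hW hS hb z1 hx h z0
    have a2 := two_point_bound hl hW' hS' hb' z1 hx h z0
    rw [abs_of_nonpos h, abs_le]
    constructor <;> nlinarith [hx.1, mul_nonneg hlp.le (neg_nonneg.2 h),
      mul_nonneg hlp.le (sq_nonneg x)]

/-- Interior Lipschitz bound for solutions of linear equations with bounded coefficients. -/
theorem kruzhkov {W : ℝ → ℝ → ℝ} {l c₂ x₀ t₀ r M : ℝ} (hl : 0 < l) (hr : 0 < r) (hM : 0 < M)
    (hW : ContinuousOn (fun p : ℝ × ℝ => W p.1 p.2)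
      (Icc (x₀ - r) (x₀ + r) ×ˢ Icc (t₀ - r ^ 2) t₀))
    (hS : ∀ x ∈ Ioo (x₀ - r) (x₀ + r), ∀ t ∈ Ioc (t₀ - r ^ 2) t₀, PtSol W l c₂ x t)
    (hb : ∀ x ∈ Icc (x₀ - r) (x₀ + r), ∀ t ∈ Icc (t₀ - r ^ 2) t₀, |W x t| ≤ M)
    {x : ℝ} (hx : x ∈ Icc (x₀ - r) (x₀ + r)) :
    |W x t₀ - W x₀ t₀| ≤ (14 + 4 / l) * M / r * |x - x₀| := by
  have hr2 : 0 < r ^ 2 := by positivity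
  have mx : ∀ y ∈ Icc (-1 : ℝ) 1, x₀ + r * y ∈ Icc (x₀ - r) (x₀ + r) := fun y hy =>
    ⟨by nlinarith [hy.1], by nlinarith [hy.2]⟩
  have mt : ∀ y ∈ Icc (-1 : ℝ) 0, t₀ + r ^ 2 * y ∈ Icc (t₀ - r ^ 2) t₀ := fun y hy =>
    ⟨by nlinarith [hy.1], by nlinarith [hy.2]⟩
  have key := kruzhkov_unit (W := fun x t => (W (x₀ + r * x) (t₀ + r ^ 2 * t) - (0 + 0 * x)) / M)
    (l := l) (c₂ := c₂) hl ?_ ?_ ?_ (x := (x - x₀) / r) ?_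
  · have e : x₀ + r * ((x - x₀) / r) = x := by field_simp; ring
    simp only [e, mul_zero, add_zero, zero_mul, sub_zero] at key
    rw [← sub_div, abs_div, abs_of_pos hM, abs_div, abs_of_pos hr, div_le_iff₀ hM] at key
    calc _ ≤ _ := key
      _ = _ := by ring
  · have : ContinuousOn (fun p : ℝ × ℝ => W (x₀ + r * p.1) (t₀ + r ^ 2 * p.2))
        (Icc (-1) 1 ×ˢ Icc (-1) 0) :=
      hW.comp (f := fun p : ℝ × ℝ => (x₀ + r * p.1, t₀ + r ^ 2 * p.2)) (by fun_prop)
        (fun p hp => ⟨mx _ hp.1, mt _ hp.2⟩)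
    exact (this.sub (by fun_prop)).div_const M
  · intro y hy t ht
    have := (hS (x₀ + r * y) ⟨by nlinarith [hy.1], by nlinarith [hy.2]⟩ (t₀ + r ^ 2 * t)
      ⟨by nlinarith [ht.1], by nlinarith [ht.2]⟩).rescale (m := 0) (n := 0) (k := M) hr hr2
    rw [div_self hr2.ne'] at this
    simpa only [mul_one] using this
  · intro y hy t ht
    simp only [zero_mul, add_zero, sub_zero]
    rw [abs_div, abs_of_pos hM, div_le_one hM]
    exact hb _ (mx y hy) _ (mt t ht)
  · constructor
    · rw [le_div_iff₀ hr]; linarith [hx.1]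
    · rw [div_le_iff₀ hr]; linarith [hx.2]

open MeasureTheory in
theorem hasDerivAt_integral_mul_of_gaussian_bound {f : ℝ → ℝ} (hf : Continuous f)
    (hf1 : ∀ y, |f y| ≤ 1) {F F' : ℝ → ℝ → ℝ} {x₀ ε b C c : ℝ} (hε : 0 < ε) (hb : 0 < b)
    (hC : Continuous (F' x₀)) (hF : ∀ x ∈ Metric.ball x₀ ε, Continuous (F x))
    (hd : ∀ x ∈ Metric.ball x₀ ε, ∀ y, HasDerivAt (fun x => F x y) (F' x y) x)
    (h0 : ∀ y, |F x₀ y| ≤ C * exp (-b * (y - c) ^ 2))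
    (h1 : ∀ x ∈ Metric.ball x₀ ε, ∀ y, |F' x y| ≤ C * exp (-b * (y - c) ^ 2)) :
    HasDerivAt (fun x => ∫ y, f y * F x y) (∫ y, f y * F' x₀ y) x₀ := by
  have hg : Integrable (fun y => C * exp (-b * (y - c) ^ 2)) :=
    ((integrable_exp_neg_mul_sq hb).comp_sub_right c).const_mul C
  have key : ∀ {y k : ℝ}, |k| ≤ C * exp (-b * (y - c) ^ 2) →
      ‖f y * k‖ ≤ C * exp (-b * (y - c) ^ 2) := fun {y k} hk => by
    rw [norm_mul, Real.norm_eq_abs, Real.norm_eq_abs]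
    calc |f y| * |k| ≤ 1 * |k| := by gcongr; exact hf1 y
      _ ≤ _ := by linarith
  refine (hasDerivAt_integral_of_dominated_loc_of_deriv_le (F := fun x y => f y * F x y)
    (F' := fun x y => f y * F' x y) (μ := volume)
    (bound := fun y => C * exp (-b * (y - c) ^ 2)) (Metric.ball_mem_nhds x₀ hε) ?_ ?_ ?_ ?_ hg ?_).2
  · filter_upwards [Metric.ball_mem_nhds x₀ hε] with x hx
    exact (hf.mul (hF x hx)).aestronglyMeasurable
  · exact hg.mono' (hf.mul (hF x₀ (Metric.mem_ball_self hε))).aestronglyMeasurable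
      (Eventually.of_forall fun y => key (h0 y))
  · exact (hf.mul hC).aestronglyMeasurable
  · exact Eventually.of_forall fun y x hx => key (h1 x hx y)
  · exact Eventually.of_forall fun y x hx => (hd x hx y).const_mul (f y)

/-- The unnormalised heat kernel. -/
noncomputable def kern (z s : ℝ) : ℝ := exp (-(z ^ 2 / (4 * s))) / √s

/-- The first spatial derivative of `kern`. -/
noncomputable def kernX (z s : ℝ) : ℝ := -(z / (2 * s)) * kern z s

/-- The second spatial derivative, equal to the time derivative, of `kern`. -/
noncomputable def kernXX (z s : ℝ) : ℝ := (z ^ 2 / (4 * s ^ 2) - 1 / (2 * s)) * kern z s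

theorem hasDerivAt_kern {s : ℝ} (hs : 0 < s) (z : ℝ) :
    HasDerivAt (fun z => kern z s) (kernX z s) z := by
  have := (((((hasDerivAt_id z).pow 2).div_const (4 * s)).neg).exp).div_const (√s)
  refine this.congr_deriv ?_
  simp only [kernX, kern, id]
  field_simp
  norm_num
  try ring

theorem hasDerivAt_kernX {s : ℝ} (hs : 0 < s) (z : ℝ) :
    HasDerivAt (fun z => kernX z s) (kernXX z s) z := by
  have := (((hasDerivAt_id z).div_const (2 * s)).neg).mul (hasDerivAt_kern hs z)
  refine this.congr_deriv ?_
  simp only [kernXX, kernX, id, Pi.neg_apply]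
  field_simp
  ring

theorem hasDerivAt_kern_time {s : ℝ} (hs : 0 < s) (z : ℝ) :
    HasDerivAt (fun s => kern z s) (kernXX z s) s := by
  have hq : √s ^ 2 = s := Real.sq_sqrt hs.le
  have hp : 0 < √s := Real.sqrt_pos.2 hs
  have h1 : HasDerivAt (fun s : ℝ => z ^ 2 / (4 * s)) (-(z ^ 2 / (4 * s ^ 2))) s := by
    have := (((hasDerivAt_id s).const_mul 4).inv (by simp; exact hs.ne')).const_mul (z ^ 2)
    simp only [div_eq_mul_inv]
    refine this.congr_deriv ?_
    simp only [id]
    field_simp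
    try ring
  have := (h1.neg.exp).div (Real.hasDerivAt_sqrt hs.ne') hp.ne'
  refine this.congr_deriv ?_
  simp only [kernXX, kern]
  generalize exp (-(z ^ 2 / (4 * s))) = e
  rw [hq]
  obtain ⟨q, hq'⟩ : ∃ q, q = √s := ⟨_, rfl⟩
  rw [← hq'] at hq hp ⊢
  subst hq
  field_simp
  try ring

theorem continuous_kern (s : ℝ) : Continuous fun z => kern z s := by
  unfold kern; fun_prop

theorem continuous_kernX (s : ℝ) : Continuous fun z => kernX z s := by
  unfold kernX kern; fun_prop

theorem continuous_kernXX (s : ℝ) : Continuous fun z => kernXX z s := by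
  unfold kernXX kern; fun_prop

theorem kern_nonneg (z s : ℝ) : 0 ≤ kern z s := by unfold kern; positivity

theorem exp_sq_split {s : ℝ} (hs : 0 < s) (z : ℝ) :
    exp (-(z ^ 2 / (4 * s))) = exp (-(z ^ 2 / (8 * s))) * exp (-(z ^ 2 / (8 * s))) := by
  rw [← exp_add]; congr 1; field_simp; ring

theorem mul_exp_neg_le (u : ℝ) : u * exp (-u) ≤ 1 := by
  rw [exp_neg, ← div_eq_mul_inv, div_le_one (exp_pos u)]
  linarith [add_one_le_exp u]

theorem abs_kern_le {s : ℝ} (hs : 0 < s) (z : ℝ) :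
    |kern z s| ≤ 1 / √s * exp (-(z ^ 2 / (8 * s))) := by
  have hp : 0 < √s := Real.sqrt_pos.2 hs
  rw [abs_of_nonneg (kern_nonneg z s), kern, exp_sq_split hs, div_mul_eq_mul_div]
  gcongr
  have : exp (-(z ^ 2 / (8 * s))) ≤ 1 := exp_le_one_iff.2 (by simp; positivity)
  nlinarith [exp_pos (-(z ^ 2 / (8 * s)))]

theorem abs_mul_kern_le {s : ℝ} (hs : 0 < s) (z : ℝ) :
    |z| * kern z s ≤ 3 * exp (-(z ^ 2 / (8 * s))) := by
  have hp : 0 < √s := Real.sqrt_pos.2 hs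
  have hq : √s ^ 2 = s := Real.sq_sqrt hs.le
  have h1 : |z| / √s * exp (-(z ^ 2 / (8 * s))) ≤ 3 := by
    have := mul_exp_neg_le (z ^ 2 / (8 * s))
    have e1 : exp (-(z ^ 2 / (8 * s))) ≤ 1 := exp_le_one_iff.2 (by simp; positivity)
    have e0 := exp_pos (-(z ^ 2 / (8 * s)))
    have e2 : |z| / √s ≤ (z ^ 2 / (8 * s)) * 2 + 1 := by
      have : z ^ 2 / (8 * s) = (|z| / √s) ^ 2 / 8 := by
        rw [div_pow, sq_abs, hq]; field_simp
      rw [this]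
      nlinarith [sq_nonneg (|z| / √s - 2)]
    calc _ ≤ ((z ^ 2 / (8 * s)) * 2 + 1) * exp (-(z ^ 2 / (8 * s))) := by gcongr
      _ ≤ 3 := by nlinarith
  rw [kern, exp_sq_split hs]
  calc _ = (|z| / √s * exp (-(z ^ 2 / (8 * s)))) * exp (-(z ^ 2 / (8 * s))) := by ring
    _ ≤ _ := by gcongr

theorem abs_kernX_le {s : ℝ} (hs : 0 < s) (z : ℝ) :
    |kernX z s| ≤ 2 / s * exp (-(z ^ 2 / (8 * s))) := by
  have h := abs_mul_kern_le hs z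
  rw [kernX, abs_mul, abs_neg, abs_div, abs_of_pos (by positivity : 0 < 2 * s),
    abs_of_nonneg (kern_nonneg z s)]
  calc _ = (|z| * kern z s) / (2 * s) := by ring
    _ ≤ (3 * exp (-(z ^ 2 / (8 * s)))) / (2 * s) := by gcongr
    _ ≤ _ := by
      rw [div_mul_eq_mul_div, div_le_div_iff₀ (by positivity) hs]
      nlinarith [mul_pos hs (exp_pos (-(z ^ 2 / (8 * s))))]

theorem abs_kernXX_le {s : ℝ} (hs : 0 < s) (z : ℝ) :
    |kernXX z s| ≤ 3 / (s * √s) * exp (-(z ^ 2 / (8 * s))) := by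
  have hp : 0 < √s := Real.sqrt_pos.2 hs
  have e0 := exp_pos (-(z ^ 2 / (8 * s)))
  have h1 : |z ^ 2 / (4 * s ^ 2) - 1 / (2 * s)| ≤ (2 * (z ^ 2 / (8 * s)) + 1 / 2) / s := by
    rw [abs_le]
    have a1 : (2 * (z ^ 2 / (8 * s)) + 1 / 2) / s = z ^ 2 / (4 * s ^ 2) + 1 / (2 * s) := by
      field_simp; ring
    have a2 : 0 ≤ z ^ 2 / (4 * s ^ 2) := by positivity
    have a3 : 0 ≤ 1 / (2 * s) := by positivity
    constructor <;> linarith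
  have h2 : (2 * (z ^ 2 / (8 * s)) + 1 / 2) * exp (-(z ^ 2 / (8 * s))) ≤ 3 := by
    have := mul_exp_neg_le (z ^ 2 / (8 * s))
    have e1 : exp (-(z ^ 2 / (8 * s))) ≤ 1 := exp_le_one_iff.2 (by simp; positivity)
    nlinarith
  rw [kernXX, abs_mul, abs_of_nonneg (kern_nonneg z s), kern, exp_sq_split hs]
  calc _ ≤ (2 * (z ^ 2 / (8 * s)) + 1 / 2) / s *
        (exp (-(z ^ 2 / (8 * s))) * exp (-(z ^ 2 / (8 * s))) / √s) := by gcongr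
    _ = ((2 * (z ^ 2 / (8 * s)) + 1 / 2) * exp (-(z ^ 2 / (8 * s)))) *
        exp (-(z ^ 2 / (8 * s))) / (s * √s) := by field_simp
    _ ≤ 3 * exp (-(z ^ 2 / (8 * s))) / (s * √s) := by gcongr
    _ = _ := by ring

theorem integral_exp_sub_sq {s : ℝ} (_hs : 0 < s) (x : ℝ) :
    ∫ y, exp (-((x - y) ^ 2 / (8 * s))) = √(8 * π) * √s := by
  have h : (fun y => exp (-((x - y) ^ 2 / (8 * s)))) =
      fun y => (fun z => exp (-(1 / (8 * s)) * z ^ 2)) (x - y) := by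
    funext y; simp only; congr 1; ring
  rw [h, MeasureTheory.integral_sub_left_eq_self (fun z => exp (-(1 / (8 * s)) * z ^ 2)),
    integral_gaussian, ← Real.sqrt_mul (by positivity)]
  congr 1; field_simp

theorem integral_kern {s : ℝ} (hs : 0 < s) (x : ℝ) : ∫ y, kern (x - y) s = √(4 * π) := by
  have hp : 0 < √s := Real.sqrt_pos.2 hs
  have h : (fun y => kern (x - y) s) =
      fun y => (fun z => exp (-(1 / (4 * s)) * z ^ 2) / √s) (x - y) := by
    funext y; simp only [kern]; congr 2; ring
  rw [h, MeasureTheory.integral_sub_left_eq_self (fun z => exp (-(1 / (4 * s)) * z ^ 2) / √s),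
    MeasureTheory.integral_div, integral_gaussian]
  rw [div_eq_iff hp.ne', ← Real.sqrt_mul (by positivity)]
  congr 1; field_simp

theorem integrable_exp_sub_sq {s : ℝ} (hs : 0 < s) (x : ℝ) :
    MeasureTheory.Integrable fun y => exp (-((x - y) ^ 2 / (8 * s))) := by
  have := (integrable_exp_neg_mul_sq (b := 1 / (8 * s)) (by positivity)).comp_sub_left x
  refine this.congr (Eventually.of_forall fun y => ?_)
  simp only; congr 1; ring

theorem abs_integral_kernel_le {s C x : ℝ} (hs : 0 < s) {F : ℝ → ℝ}
    (h : ∀ y, |F y| ≤ C * exp (-((x - y) ^ 2 / (8 * s)))) :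
    |∫ y, F y| ≤ C * (√(8 * π) * √s) := by
  have := MeasureTheory.norm_integral_le_of_norm_le
    ((integrable_exp_sub_sq hs x).const_mul C) (f := F) (Eventually.of_forall h)
  rwa [MeasureTheory.integral_const_mul, integral_exp_sub_sq hs] at this

theorem sqrt_eight_pi : √(8 * π) = √2 * √(4 * π) := by
  rw [← Real.sqrt_mul (by norm_num)]; congr 1; ring

theorem sqrt_two_lt : √2 < 3 / 2 := by
  rw [Real.sqrt_lt' (by norm_num)]; norm_num

theorem abs_mul_div_sqrt_le {C s I : ℝ} (hC : 0 ≤ C)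
    (h : |I| ≤ C * (√(8 * π) * √s)) : |I / √(4 * π)| ≤ 3 / 2 * C * √s := by
  have hp : 0 < √(4 * π) := Real.sqrt_pos.2 (by positivity)
  rw [abs_div, abs_of_pos hp, div_le_iff₀ hp]
  refine h.trans ?_
  rw [sqrt_eight_pi]
  have := sqrt_two_lt.le
  have h0 : 0 ≤ √(4 * π) * (C * √s) := by positivity
  nlinarith

theorem exp_shift_le {s x x₀ y : ℝ} (hs : 0 < s) (hx : (x - x₀) ^ 2 ≤ s) :
    exp (-((x - y) ^ 2 / (8 * s))) ≤ 3 * exp (-(1 / (16 * s)) * (y - x₀) ^ 2) := by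
  have h3 : exp 1 ≤ 3 := by linarith [exp_one_lt_d9]
  have h : -((x - y) ^ 2 / (8 * s)) ≤ 1 + -(1 / (16 * s)) * (y - x₀) ^ 2 := by
    have : 0 ≤ (x - y) ^ 2 / (8 * s) + (1 + -(1 / (16 * s)) * (y - x₀) ^ 2) := by
      have e : (x - y) ^ 2 / (8 * s) + (1 + -(1 / (16 * s)) * (y - x₀) ^ 2) =
          (2 * (x - y) ^ 2 + 16 * s - (y - x₀) ^ 2) / (16 * s) := by field_simp; ring
      rw [e]
      apply div_nonneg _ (by positivity)
      nlinarith [sq_nonneg ((x - y) + (x - x₀)), sq_nonneg ((x - y) - (x - x₀))]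
    linarith
  calc _ ≤ _ := exp_le_exp.2 h
    _ ≤ _ := by rw [exp_add]; gcongr

theorem ball_sqrt_sq {s x x₀ : ℝ} (hs : 0 < s) (hx : x ∈ Metric.ball x₀ (√s)) :
    (x - x₀) ^ 2 ≤ s := by
  rw [Metric.mem_ball, Real.dist_eq] at hx
  calc (x - x₀) ^ 2 = |x - x₀| ^ 2 := (sq_abs _).symm
    _ ≤ √s ^ 2 := by gcongr
    _ = s := Real.sq_sqrt hs.le

/-- Solution of the heat equation with bounded Lipschitz initial datum. -/
theorem exists_heat {f : ℝ → ℝ} {L : ℝ} (hf1 : ∀ y, |f y| ≤ 1)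
    (hfL : ∀ x y, |f x - f y| ≤ L * |x - y|) :
    ∃ h hx hxx : ℝ → ℝ → ℝ, ∀ s : ℝ, 0 < s → ∀ x : ℝ,
      HasDerivAt (fun x => h x s) (hx x s) x ∧ HasDerivAt (fun x => hx x s) (hxx x s) x ∧
      HasDerivAt (fun s => h x s) (hxx x s) s ∧ |h x s| ≤ 1 ∧ |hx x s| ≤ 5 / √s ∧
      |hxx x s| ≤ 5 / s ∧ |h x s - f x| ≤ 5 * L * √s := by
  have hL : 0 ≤ L := by
    have := (abs_nonneg _).trans (hfL 1 0)
    simpa using this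
  have hf : Continuous f := by
    have : LipschitzWith L.toNNReal f := LipschitzWith.of_dist_le_mul fun x y => by
      rw [Real.dist_eq, Real.dist_eq, Real.coe_toNNReal _ hL]; exact hfL x y
    exact this.continuous
  have hπ : 0 < √(4 * π) := Real.sqrt_pos.2 (by positivity)
  have prod : ∀ {y k B : ℝ}, |k| ≤ B → |f y * k| ≤ B := fun {y k B} hk => by
    rw [abs_mul]
    calc |f y| * |k| ≤ 1 * |k| := by gcongr; exact hf1 y
      _ ≤ B := by linarith
  have cont : ∀ (g : ℝ → ℝ → ℝ), (∀ s, Continuous fun z => g z s) → ∀ x s : ℝ,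
      Continuous fun y => g (x - y) s := fun g hg x s => (hg s).comp (by fun_prop)
  refine ⟨fun x s => (∫ y, f y * kern (x - y) s) / √(4 * π),
    fun x s => (∫ y, f y * kernX (x - y) s) / √(4 * π),
    fun x s => (∫ y, f y * kernXX (x - y) s) / √(4 * π), fun s hs x => ?_⟩
  have hp : 0 < √s := Real.sqrt_pos.2 hs
  have hq : √s * √s = s := Real.mul_self_sqrt hs.le
  have gb : ∀ {k C x' y}, 0 ≤ C → x' ∈ Metric.ball x (√s) →
      |k| ≤ C * exp (-((x' - y) ^ 2 / (8 * s))) →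
      ∀ C', C * 3 ≤ C' → |k| ≤ C' * exp (-(1 / (16 * s)) * (y - x) ^ 2) :=
    fun {k C x' y} hC hx' hk C' hC' => by
      calc |k| ≤ _ := hk
        _ ≤ C * (3 * exp (-(1 / (16 * s)) * (y - x) ^ 2)) := by
          gcongr; exact exp_shift_le hs (ball_sqrt_sq hs hx')
        _ = (C * 3) * exp (-(1 / (16 * s)) * (y - x) ^ 2) := by ring
        _ ≤ _ := by gcongr
  have self := Metric.mem_ball_self (x := x) hp
  refine ⟨?_, ?_, ?_, ?_, ?_, ?_, ?_⟩
  · refine HasDerivAt.div_const ?_ _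
    exact hasDerivAt_integral_mul_of_gaussian_bound hf hf1 (F := fun x y => kern (x - y) s)
      (F' := fun x y => kernX (x - y) s) (ε := √s) (b := 1 / (16 * s)) (c := x)
      (C := max (1 / √s * 3) (2 / s * 3)) hp (by positivity) (cont _ continuous_kernX _ _)
      (fun x' _ => cont _ continuous_kern _ _)
      (fun x' _ y => (hasDerivAt_kern hs (x' - y)).comp_sub_const x' y)
      (fun y => gb (by positivity) self (abs_kern_le hs _) _ (le_max_left _ _))
      (fun x' hx' y => gb (by positivity) hx' (abs_kernX_le hs _) _ (le_max_right _ _))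
  · refine HasDerivAt.div_const ?_ _
    exact hasDerivAt_integral_mul_of_gaussian_bound hf hf1 (F := fun x y => kernX (x - y) s)
      (F' := fun x y => kernXX (x - y) s) (ε := √s) (b := 1 / (16 * s)) (c := x)
      (C := max (2 / s * 3) (3 / (s * √s) * 3)) hp (by positivity)
      (cont _ continuous_kernXX _ _) (fun x' _ => cont _ continuous_kernX _ _)
      (fun x' _ y => (hasDerivAt_kernX hs (x' - y)).comp_sub_const x' y)
      (fun y => gb (by positivity) self (abs_kernX_le hs _) _ (le_max_left _ _))
      (fun x' hx' y => gb (by positivity) hx' (abs_kernXX_le hs _) _ (le_max_right _ _))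
  · refine HasDerivAt.div_const ?_ _
    refine hasDerivAt_integral_mul_of_gaussian_bound hf hf1 (F := fun s y => kern (x - y) s)
      (F' := fun s y => kernXX (x - y) s) (ε := s / 2) (b := 1 / (16 * s)) (c := x)
      (C := max (1 / √s * 3) (3 / (s / 2 * √(s / 2)))) (by positivity) (by positivity)
      (cont _ continuous_kernXX _ _) (fun x' _ => cont _ continuous_kern _ _)
      (fun s' hs' y => ?_)
      (fun y => gb (by positivity) self (abs_kern_le hs _) _ (le_max_left _ _))
      (fun s' hs' y => ?_)
    · rw [Metric.mem_ball, Real.dist_eq, abs_lt] at hs'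
      exact hasDerivAt_kern_time (by linarith) _
    · rw [Metric.mem_ball, Real.dist_eq, abs_lt] at hs'
      have hs0 : 0 < s' := by linarith
      refine (abs_kernXX_le hs0 _).trans ?_
      have e1 : 3 / (s' * √s') ≤ 3 / (s / 2 * √(s / 2)) := by
        have : s / 2 ≤ s' := by linarith
        gcongr
      have e2 : -((x - y) ^ 2 / (8 * s')) ≤ -(1 / (16 * s)) * (y - x) ^ 2 := by
        have : (x - y) ^ 2 / (16 * s) ≤ (x - y) ^ 2 / (8 * s') := by
          exact div_le_div_of_nonneg_left (sq_nonneg _) (by positivity) (by linarith)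
        have e : -(1 / (16 * s)) * (y - x) ^ 2 = -((x - y) ^ 2 / (16 * s)) := by ring
        linarith
      calc _ ≤ 3 / (s / 2 * √(s / 2)) * exp (-(1 / (16 * s)) * (y - x) ^ 2) := by gcongr
        _ ≤ _ := by gcongr; exact le_max_right _ _
  · have hi : MeasureTheory.Integrable fun y => kern (x - y) s :=
      ((integrable_exp_sub_sq hs x).const_mul (1 / √s)).mono'
        (cont _ continuous_kern _ _).aestronglyMeasurable
        (Eventually.of_forall fun y => abs_kern_le hs _)
    have := MeasureTheory.norm_integral_le_of_norm_le hi (f := fun y => f y * kern (x - y) s)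
      (Eventually.of_forall fun y => prod (abs_of_nonneg (kern_nonneg _ _)).le)
    rw [integral_kern hs] at this
    rw [abs_div, abs_of_pos hπ, div_le_one hπ]
    exact this
  · refine (abs_mul_div_sqrt_le (C := 2 / s) (by positivity)
      (abs_integral_kernel_le hs fun y => prod (abs_kernX_le hs _))).trans ?_
    rw [le_div_iff₀ hp]
    have : 3 / 2 * (2 / s) * √s * √s = 3 := by rw [mul_assoc, hq]; field_simp
    linarith
  · refine (abs_mul_div_sqrt_le (C := 3 / (s * √s)) (by positivity)
      (abs_integral_kernel_le hs fun y => prod (abs_kernXX_le hs _))).trans ?_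
    have : 3 / 2 * (3 / (s * √s)) * √s = 9 / 2 / s := by field_simp; norm_num
    rw [this]
    gcongr; norm_num
  · have hi : MeasureTheory.Integrable fun y => f y * kern (x - y) s :=
      ((integrable_exp_sub_sq hs x).const_mul (1 / √s)).mono'
        (hf.mul (cont _ continuous_kern _ _)).aestronglyMeasurable
        (Eventually.of_forall fun y => prod (abs_kern_le hs _))
    have hi2 : MeasureTheory.Integrable fun y => f x * kern (x - y) s :=
      (((integrable_exp_sub_sq hs x).const_mul (1 / √s)).mono'
        (cont _ continuous_kern _ _).aestronglyMeasurable
        (Eventually.of_forall fun y => abs_kern_le hs _)).const_mul _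
    have e : (∫ y, f y * kern (x - y) s) / √(4 * π) - f x =
        (∫ y, (f y - f x) * kern (x - y) s) / √(4 * π) := by
      simp only [sub_mul]
      rw [MeasureTheory.integral_sub hi hi2, MeasureTheory.integral_const_mul, integral_kern hs]
      field_simp
    rw [e]
    refine (abs_mul_div_sqrt_le (C := L * 3) (by positivity)
      (abs_integral_kernel_le hs (x := x) fun y => ?_)).trans ?_
    · rw [abs_mul, abs_of_nonneg (kern_nonneg _ _)]
      have := abs_mul_kern_le hs (x - y)
      calc _ ≤ (L * |x - y|) * kern (x - y) s := by
            gcongr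
            · exact kern_nonneg _ _
            · rw [abs_sub_comm]; exact hfL x y
        _ = L * (|x - y| * kern (x - y) s) := by ring
        _ ≤ L * (3 * exp (-((x - y) ^ 2 / (8 * s)))) := by gcongr
        _ = _ := by ring
    · nlinarith [mul_nonneg hL hp.le]

/-- `W` is a continuous solution on the closed unit cylinder, bounded by `1`. -/
structure UnitSol (W : ℝ → ℝ → ℝ) (c₁ c₂ : ℝ) : Prop where
  cont : ContinuousOn (fun p : ℝ × ℝ => W p.1 p.2) (Icc (-1) 1 ×ˢ Icc (-1) 0)
  sol : ∀ x ∈ Ioo (-1 : ℝ) 1, ∀ t ∈ Ioc (-1 : ℝ) 0, PtSol W c₁ c₂ x t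
  bound : ∀ x ∈ Icc (-1 : ℝ) 1, ∀ t ∈ Icc (-1 : ℝ) 0, |W x t| ≤ 1

theorem UnitSol.neg {W : ℝ → ℝ → ℝ} {c₁ c₂ : ℝ} (h : UnitSol W c₁ c₂) :
    UnitSol (fun x t => -W x t) c₁ c₂ :=
  ⟨h.cont.neg, fun x hx t ht => (h.sol x hx t ht).neg, by simpa using h.bound⟩

/-- Rescaling to a smaller parabolic cylinder. -/
theorem UnitSol.rescale {W : ℝ → ℝ → ℝ} {c₁ c₂ r k m n : ℝ} (h : UnitSol W c₁ c₂) (hr : 0 < r)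
    (hr1 : r ≤ 1) (hk : 0 < k)
    (hb : ∀ x t : ℝ, |x| ≤ r → -r ^ 2 ≤ t → t ≤ 0 → |W x t - (m + n * x)| ≤ k) :
    UnitSol (fun x t => (W (r * x) (r ^ 2 * t) - (m + (n * r) * x)) / k) c₁ c₂ := by
  have hr2 : 0 < r ^ 2 := by positivity
  have hr21 : r ^ 2 ≤ 1 := by nlinarith
  have mx : ∀ y ∈ Icc (-1 : ℝ) 1, r * y ∈ Icc (-1 : ℝ) 1 := fun y hy =>
    ⟨by nlinarith [hy.1], by nlinarith [hy.2]⟩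
  have mt : ∀ y ∈ Icc (-1 : ℝ) 0, r ^ 2 * y ∈ Icc (-1 : ℝ) 0 := fun y hy =>
    ⟨by nlinarith [hy.1], by nlinarith [hy.2]⟩
  refine ⟨?_, ?_, ?_⟩
  · have : ContinuousOn (fun p : ℝ × ℝ => W (r * p.1) (r ^ 2 * p.2))
        (Icc (-1) 1 ×ˢ Icc (-1) 0) :=
      h.cont.comp (f := fun p : ℝ × ℝ => (r * p.1, r ^ 2 * p.2)) (by fun_prop)
        (fun p hp => ⟨mx _ hp.1, mt _ hp.2⟩)
    exact (this.sub (by fun_prop)).div_const k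
  · intro x hx t ht
    have := PtSol.rescale (W := W) (x₀ := 0) (t₀ := 0) (c₁ := c₁) (c₂ := c₂) (x := x) (t := t)
      (m := m) (n := n * r) (k := k) hr hr2
      (by
        rw [zero_add, zero_add]
        exact h.sol _ ⟨by nlinarith [hx.1], by nlinarith [hx.2]⟩ _
          ⟨by nlinarith [ht.1], by nlinarith [ht.2]⟩)
    rw [div_self hr2.ne'] at this
    simpa only [mul_one, zero_add] using this
  · intro x hx t ht
    rw [abs_div, abs_of_pos hk, div_le_one hk]
    have := hb (r * x) (r ^ 2 * t)
      (by rw [abs_mul, abs_of_pos hr]; nlinarith [abs_le.2 hx, abs_nonneg x])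
      (by nlinarith [ht.1]) (by nlinarith [ht.2])
    rwa [mul_assoc]

theorem UnitSol.lipschitz {W : ℝ → ℝ → ℝ} {c₂ τ : ℝ} (h : UnitSol W (1 / 2) c₂)
    (hτ0 : 0 ≤ τ) (hτ : τ ≤ 1 / 2) {x y : ℝ} (hx : x ∈ Icc (-(1 / 2) : ℝ) (1 / 2))
    (hy : y ∈ Icc (-(1 / 2) : ℝ) (1 / 2)) : |W x (-τ) - W y (-τ)| ≤ 44 * |x - y| := by
  have mt : -τ ∈ Icc (-1 : ℝ) 0 := ⟨by linarith, by linarith⟩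
  rcases le_total (|x - y|) (1 / 2) with hd | hd
  · have hd' := abs_le.1 hd
    have := kruzhkov (W := W) (l := 1 / 2) (c₂ := c₂) (x₀ := y) (t₀ := -τ) (r := 1 / 2) (M := 1)
      (by norm_num) (by norm_num) one_pos
      (h.cont.mono (prod_mono
        (Icc_subset_Icc (by linarith [hy.1]) (by linarith [hy.2]))
        (Icc_subset_Icc (by linarith) (by linarith))))
      (fun z hz t ht => h.sol z ⟨by linarith [hy.1, hz.1], by linarith [hy.2, hz.2]⟩ t
        ⟨by linarith [ht.1], by linarith [ht.2]⟩)
      (fun z hz t ht => h.bound z ⟨by linarith [hy.1, hz.1], by linarith [hy.2, hz.2]⟩ t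
        ⟨by linarith [ht.1], by linarith [ht.2]⟩)
      (x := x) ⟨by linarith [hd'.1], by linarith [hd'.2]⟩
    norm_num at this
    exact this
  · have a1 := abs_le.1 (h.bound x ⟨by linarith [hx.1], by linarith [hx.2]⟩ _ mt)
    have a2 := abs_le.1 (h.bound y ⟨by linarith [hy.1], by linarith [hy.2]⟩ _ mt)
    rw [abs_le]
    constructor <;> linarith

/-- Comparison of a solution with nearly constant coefficients with a solution of the heat
equation. -/
theorem heat_comparison {W h hx hxx : ℝ → ℝ → ℝ} {η τ e B : ℝ} (hη : 0 < η) (hη2 : η ≤ 1 / 2)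
    (hτ : τ ≤ 1 / 2) (hB : 0 < B) (he : 0 ≤ e)
    (hW : UnitSol W (1 - η) (1 + η))
    (hc : ContinuousOn (fun p : ℝ × ℝ => h p.1 p.2)
      (Icc (-(1 / 2) : ℝ) (1 / 2) ×ˢ Icc (-τ) 0))
    (h1 : ∀ x, ∀ t ∈ Icc (-τ) 0, HasDerivAt (fun x => h x t) (hx x t) x)
    (h2 : ∀ x, ∀ t ∈ Icc (-τ) 0, HasDerivAt (fun x => hx x t) (hxx x t) x)
    (h3 : ∀ x, ∀ t ∈ Icc (-τ) 0, HasDerivAt (fun s => h x s) (hxx x t) t)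
    (hb1 : ∀ x, ∀ t ∈ Icc (-τ) 0, |h x t| ≤ 1)
    (hb2 : ∀ x, ∀ t ∈ Icc (-τ) 0, |hxx x t| ≤ B)
    (h0 : ∀ x ∈ Icc (-(1 / 2) : ℝ) (1 / 2), W x (-τ) - h x (-τ) ≤ e)
    {x t : ℝ} (mx : x ∈ Icc (-(1 / 2) : ℝ) (1 / 2)) (mt : t ∈ Icc (-τ) 0) :
    W x t - h x t ≤ e + 2 * (4 * x ^ 2 + 100 * (t + τ)) ^ 4 + 2 * η * B * (t + τ) := by
  have hScomp : IsCompact (Icc (-(1 / 2) : ℝ) (1 / 2) ×ˢ Icc (-τ) 0) :=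
    isCompact_Icc.prod isCompact_Icc
  set f : ℝ × ℝ → ℝ := fun p => W p.1 p.2 - h p.1 p.2 -
    (e + 2 * (4 * p.1 ^ 2 + 100 * (p.2 + τ)) ^ 4 + 2 * η * B * (p.2 + τ)) with hf
  have hfc : ContinuousOn f (Icc (-(1 / 2) : ℝ) (1 / 2) ×ˢ Icc (-τ) 0) := by
    have c1 := hW.cont.mono (prod_mono
      (Icc_subset_Icc (by norm_num : (-1 : ℝ) ≤ -(1 / 2)) (by norm_num : (1 / 2 : ℝ) ≤ 1))
      (Icc_subset_Icc (by linarith : -1 ≤ -τ) le_rfl))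
    exact (c1.sub hc).sub (by fun_prop)
  have main := nonpos_of_no_positive_max hScomp hfc ?_ (x, t) ⟨mx, mt⟩
  · simp only [hf] at main
    linarith
  rintro ⟨x, t⟩ ⟨mx, mt⟩ hpos hmax
  simp only at mx mt
  simp only [hf] at hpos
  have hηB : 0 < η * B := by positivity
  have bW := abs_le.1 (hW.bound x ⟨by linarith [mx.1], by linarith [mx.2]⟩ t
    ⟨by linarith [mt.1], mt.2⟩)
  have bh := abs_le.1 (hb1 x t mt)
  have hs : 0 ≤ t + τ := by linarith [mt.1]
  have hlat : x ^ 2 < 1 / 4 := by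
    by_contra! hge
    have : 1 ≤ (4 * x ^ 2 + 100 * (t + τ)) ^ 4 := one_le_pow₀ (by nlinarith)
    nlinarith [mul_nonneg hηB.le hs]
  have ht1 : -τ < t := by
    rcases mt.1.lt_or_eq with h | h
    · exact h
    · have := h0 x mx
      rw [h] at this
      have : (0 : ℝ) ≤ (4 * x ^ 2 + 100 * (t + τ)) ^ 4 := by positivity
      nlinarith [mul_nonneg hηB.le hs]
  have hx1 : -(1 / 2) < x := by nlinarith [mx.1, mx.2]
  have hx2 : x < 1 / 2 := by nlinarith [mx.1, mx.2]
  obtain ⟨wx, wxx, wt, a, k1, k2, k3, k4, k5⟩ := hW.sol x ⟨by linarith, by linarith⟩ t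
    ⟨by linarith, mt.2⟩
  set P : ℝ → ℝ := fun z => 4 * z ^ 2 + 100 * (t + τ) with hP
  have dP : ∀ z, HasDerivAt P (8 * z) z := fun z => by
    have := (((hasDerivAt_id z).pow 2).const_mul 4).add_const (100 * (t + τ))
    refine this.congr_deriv ?_
    norm_num; ring
  have dx : ∀ z, HasDerivAt (fun z => e + 2 * (4 * z ^ 2 + 100 * (t + τ)) ^ 4 +
      2 * η * B * (t + τ)) (64 * z * P z ^ 3) z := fun z => by
    have := ((((dP z).pow 4).const_mul 2).const_add e).add_const (2 * η * B * (t + τ))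
    refine this.congr_deriv ?_
    norm_num; ring
  have dxx : HasDerivAt (fun z => 64 * z * P z ^ 3) (64 * P x ^ 3 + 1536 * x ^ 2 * P x ^ 2) x := by
    have := ((hasDerivAt_id x).const_mul 64).mul ((dP x).pow 3)
    refine this.congr_deriv ?_
    simp only [id, Pi.pow_apply]
    norm_num; ring
  have dt : HasDerivAt (fun s => e + 2 * (4 * x ^ 2 + 100 * (s + τ)) ^ 4 + 2 * η * B * (s + τ))
      (800 * P x ^ 3 + 2 * η * B) t := by
    have l : HasDerivAt (fun s => s + τ) 1 t := (hasDerivAt_id t).add_const τ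
    have := ((((l.const_mul 100).const_add (4 * x ^ 2)).pow 4).const_mul 2).const_add e |>.add
      (l.const_mul (2 * η * B))
    refine this.congr_deriv ?_
    norm_num; ring
  have tx := isLocalMax_second_deriv (g := fun z => f (z, t))
    (g1 := fun z => wx z - hx z t - 64 * z * P z ^ 3)
    (g2 := wxx - hxx x t - (64 * P x ^ 3 + 1536 * x ^ 2 * P x ^ 2)) (x := x)
    (by
      filter_upwards [Ioo_mem_nhds hx1 hx2] with z hz
      exact hmax (z, t) ⟨⟨hz.1.le, hz.2.le⟩, mt⟩)
    (by
      filter_upwards [k1] with z hz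
      exact (hz.sub (h1 z t mt)).sub (dx z))
    ((k2.sub (h2 x t mt)).sub dxx)
  have tt := deriv_nonneg_of_left_max (g := fun s => f (x, s))
    (g' := wt - hxx x t - (800 * P x ^ 3 + 2 * η * B)) ht1
    (fun s hs => hmax (x, s) ⟨mx, ⟨hs.1, hs.2.trans mt.2⟩⟩)
    ((k3.sub (h3 x t mt)).sub dt)
  have hPx : 4 * x ^ 2 ≤ P x := by simp only [hP]; linarith
  have hP0 : 0 ≤ P x := by nlinarith [sq_nonneg x]
  have hP2 : 1536 * x ^ 2 * P x ^ 2 ≤ 384 * P x ^ 3 := by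
    have : 0 ≤ P x ^ 2 := by positivity
    nlinarith
  have hP3 : 0 ≤ P x ^ 3 := by positivity
  have hxxle : wxx ≤ hxx x t + 448 * P x ^ 3 := by linarith [tx.2]
  have ha0 : 0 ≤ a := by linarith [k4.1]
  have hah : (a - 1) * hxx x t ≤ η * B := by
    calc _ ≤ |(a - 1) * hxx x t| := le_abs_self _
      _ = |a - 1| * |hxx x t| := abs_mul _ _
      _ ≤ η * B := by
        gcongr
        · rw [abs_le]; exact ⟨by linarith [k4.1], by linarith [k4.2]⟩
        · exact hb2 x t mt
  have h6 : a * wxx ≤ a * (hxx x t + 448 * P x ^ 3) := mul_le_mul_of_nonneg_left hxxle ha0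
  have h7 : a * P x ^ 3 ≤ 3 / 2 * P x ^ 3 := mul_le_mul_of_nonneg_right (by linarith [k4.2]) hP3
  nlinarith

theorem abs_sub_le_of_hasDerivAt {g g' : ℝ → ℝ} {B a b : ℝ}
    (hd : ∀ z ∈ uIcc a b, HasDerivAt g (g' z) z) (hB : ∀ z ∈ uIcc a b, |g' z| ≤ B) :
    |g b - g a| ≤ B * |b - a| := by
  have := (convex_uIcc a b).norm_image_sub_le_of_norm_hasDerivWithin_le
    (fun z hz => (hd z hz).hasDerivWithinAt) hB left_mem_uIcc right_mem_uIcc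
  simpa only [Real.norm_eq_abs] using this

/-- One step of the improvement of flatness. -/
theorem flatness_step : ∃ q η C : ℝ, 0 < q ∧ q < 1 / 2 ∧ 0 < η ∧ η ≤ 1 / 2 ∧ 0 < C ∧
    ∀ W : ℝ → ℝ → ℝ, UnitSol W (1 - η) (1 + η) → ∃ m n : ℝ, |m| ≤ 1 ∧ |n| ≤ C ∧
      ∀ x t : ℝ, |x| ≤ q ^ 2 → -q ^ 4 ≤ t → t ≤ 0 → |W x t - (m + n * x)| ≤ q ^ 3 := by
  obtain ⟨q, hq⟩ : ∃ q : ℝ, q = 1 / 10 ^ 17 := ⟨_, rfl⟩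
  have hq0 : 0 < q := by rw [hq]; positivity
  have hqs : q ≤ 1 / 10 ^ 17 := hq.le
  obtain ⟨δ, hδ⟩ : ∃ δ : ℝ, δ = (q ^ 3 / 880) ^ 2 := ⟨_, rfl⟩
  have hδ0 : 0 < δ := by rw [hδ]; positivity
  have hδs : √δ = q ^ 3 / 880 := by rw [hδ]; exact Real.sqrt_sq (by positivity)
  obtain ⟨τ, hτ⟩ : ∃ τ : ℝ, τ = 80 * q := ⟨_, rfl⟩
  have hτ0 : 0 < τ := by rw [hτ]; positivity
  have hτ1 : τ ≤ 1 / 2 := by rw [hτ]; linarith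
  have hδ1 : δ ≤ 1 := by
    rw [hδ]
    have : q ^ 3 ≤ 1 := pow_le_one₀ hq0.le (by linarith)
    have h0 : 0 < q ^ 3 := by positivity
    nlinarith
  obtain ⟨η, hη⟩ : ∃ η : ℝ, η = δ * q ^ 3 / 40 := ⟨_, rfl⟩
  have hη0 : 0 < η := by rw [hη]; positivity
  have hη1 : η ≤ 1 / 2 := by
    have : q ^ 3 ≤ 1 := pow_le_one₀ hq0.le (by linarith)
    have h0 : 0 < q ^ 3 := by positivity
    rw [hη]; nlinarith
  refine ⟨q, η, 5 / √τ, hq0, by linarith, hη0, hη1, by positivity, fun W hW => ?_⟩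
  have hW2 : UnitSol W (1 / 2) (1 + η) :=
    ⟨hW.cont, fun x hx t ht => (hW.sol x hx t ht).mono (by linarith) le_rfl, hW.bound⟩
  set f : ℝ → ℝ := fun x => W (max (-(1 / 2)) (min x (1 / 2))) (-τ) with hf
  have mproj : ∀ x : ℝ, max (-(1 / 2)) (min x (1 / 2)) ∈ Icc (-(1 / 2) : ℝ) (1 / 2) := fun x =>
    ⟨le_max_left _ _, max_le (by norm_num) (min_le_right _ _)⟩
  have hf1 : ∀ y, |f y| ≤ 1 := fun y =>
    hW.bound _ ⟨by linarith [(mproj y).1], by linarith [(mproj y).2]⟩ _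
      ⟨by linarith, by linarith⟩
  have hfL : ∀ x y, |f x - f y| ≤ 44 * |x - y| := fun x y => by
    refine (hW2.lipschitz hτ0.le hτ1 (mproj x) (mproj y)).trans ?_
    refine mul_le_mul_of_nonneg_left ?_ (by norm_num)
    refine (abs_max_sub_max_le_max (-(1 / 2) : ℝ) (min x (1 / 2)) (-(1 / 2)) (min y (1 / 2))).trans ?_
    rw [sub_self, abs_zero]
    refine max_le (abs_nonneg _) ((abs_min_sub_min_le_max x (1 / 2) y (1 / 2)).trans ?_)
    rw [sub_self, abs_zero]
    exact max_le le_rfl (abs_nonneg _)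
  have hfW : ∀ x ∈ Icc (-(1 / 2) : ℝ) (1 / 2), f x = W x (-τ) := fun x hx => by
    simp only [hf]
    rw [min_eq_left hx.2, max_eq_right hx.1]
  obtain ⟨h, hx, hxx, H⟩ := exists_heat hf1 hfL
  have pos : ∀ t ∈ Icc (-τ) 0, 0 < t + τ + δ := fun t ht => by linarith [ht.1]
  have tlin : ∀ t, HasDerivAt (fun t => t + τ + δ) 1 t := fun t =>
    ((hasDerivAt_id t).add_const τ).add_const δ
  have k3 : ∀ x, ∀ t ∈ Icc (-τ) 0, HasDerivAt (fun s => h x (s + τ + δ)) (hxx x (t + τ + δ)) t :=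
    fun x t ht => by
      have := (H _ (pos t ht) x).2.2.1.comp t (tlin t)
      rw [mul_one] at this
      exact this
  have kb : ∀ x, ∀ t ∈ Icc (-τ) 0, |hxx x (t + τ + δ)| ≤ 5 / δ := fun x t ht =>
    (H _ (pos t ht) x).2.2.2.2.2.1.trans (by gcongr; linarith [ht.1])
  have kbx : ∀ x, ∀ t ∈ Icc (-τ) 0, |hx x (t + τ + δ)| ≤ 5 / √δ := fun x t ht =>
    (H _ (pos t ht) x).2.2.2.2.1.trans (by gcongr; linarith [ht.1])
  have kc : ContinuousOn (fun p : ℝ × ℝ => h p.1 (p.2 + τ + δ))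
      (Icc (-(1 / 2) : ℝ) (1 / 2) ×ˢ Icc (-τ) 0) := by
    refine continuousOn_prod_of_continuousOn_lipschitzOnWith
      (f := fun p : ℝ × ℝ => h p.1 (p.2 + τ + δ)) (K := (5 / √δ).toNNReal) ?_ ?_
    · intro x hx t ht
      exact (k3 x t ht).continuousAt.continuousWithinAt
    · intro t ht
      refine LipschitzOnWith.of_dist_le_mul fun x _ y _ => ?_
      rw [Real.coe_toNNReal _ (by positivity), Real.dist_eq, Real.dist_eq]
      exact abs_sub_le_of_hasDerivAt (fun z _ => (H _ (pos t ht) z).1) (fun z _ => kbx z t ht)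
  have e0 : ∀ x ∈ Icc (-(1 / 2) : ℝ) (1 / 2), |h x (-τ + τ + δ) - W x (-τ)| ≤ q ^ 3 / 4 :=
    fun x hx => by
      have := (H δ hδ0 x).2.2.2.2.2.2
      rw [hfW x hx, hδs] at this
      rw [neg_add_cancel, zero_add]
      linarith
  have E1 : ∀ x ∈ Icc (-(1 / 2) : ℝ) (1 / 2), ∀ t ∈ Icc (-τ) 0,
      W x t - h x (t + τ + δ) ≤ q ^ 3 / 4 + 2 * (4 * x ^ 2 + 100 * (t + τ)) ^ 4 +
        2 * η * (5 / δ) * (t + τ) := fun x mx t mt =>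
    heat_comparison (h := fun x t => h x (t + τ + δ)) (hx := fun x t => hx x (t + τ + δ))
      (hxx := fun x t => hxx x (t + τ + δ)) hη0 hη1 hτ1 (by positivity) (by positivity) hW kc
      (fun x t ht => (H _ (pos t ht) x).1) (fun x t ht => (H _ (pos t ht) x).2.1) k3
      (fun x t ht => (H _ (pos t ht) x).2.2.2.1) kb
      (fun x hx => by linarith [(abs_le.1 (e0 x hx)).1]) mx mt
  have E2 : ∀ x ∈ Icc (-(1 / 2) : ℝ) (1 / 2), ∀ t ∈ Icc (-τ) 0,
      -W x t - -h x (t + τ + δ) ≤ q ^ 3 / 4 + 2 * (4 * x ^ 2 + 100 * (t + τ)) ^ 4 +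
        2 * η * (5 / δ) * (t + τ) := fun x mx t mt =>
    heat_comparison (W := fun x t => -W x t) (h := fun x t => -h x (t + τ + δ))
      (hx := fun x t => -hx x (t + τ + δ))
      (hxx := fun x t => -hxx x (t + τ + δ)) hη0 hη1 hτ1 (by positivity) (by positivity)
      hW.neg kc.neg
      (fun x t ht => (H _ (pos t ht) x).1.neg) (fun x t ht => (H _ (pos t ht) x).2.1.neg)
      (fun x t ht => (k3 x t ht).neg)
      (fun x t ht => by simpa using (H _ (pos t ht) x).2.2.2.1)
      (fun x t ht => by simpa using kb x t ht)
      (fun x hx => by linarith [(abs_le.1 (e0 x hx)).2]) mx mt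
  have hτδ : 0 < τ + δ := by linarith
  refine ⟨h 0 (τ + δ), hx 0 (τ + δ), (H _ hτδ 0).2.2.2.1,
    (H _ hτδ 0).2.2.2.2.1.trans (by gcongr; linarith), fun x t hx1 ht1 ht2 => ?_⟩
  have hq2 : q ^ 2 ≤ q := by nlinarith
  have hq4 : q ^ 4 ≤ q := by nlinarith [mul_self_nonneg (q ^ 2), sq_nonneg q]
  have mx : x ∈ Icc (-(1 / 2) : ℝ) (1 / 2) :=
    abs_le.1 (hx1.trans (by linarith))
  have mt : t ∈ Icc (-τ) 0 := ⟨by rw [hτ]; linarith, ht2⟩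
  have b1 : 2 * (4 * x ^ 2 + 100 * (t + τ)) ^ 4 ≤ q ^ 3 / 4 := by
    have hx2 : x ^ 2 ≤ q := by
      rw [← sq_abs]
      nlinarith [abs_nonneg x]
    have p0 : 0 ≤ t + τ := by linarith [mt.1]
    have : (4 * x ^ 2 + 100 * (t + τ)) ^ 4 ≤ (8004 * q) ^ 4 := by
      gcongr
      rw [hτ]; linarith
    have h3 : 0 < q ^ 3 := by positivity
    have : (8004 * q) ^ 4 = 8004 ^ 4 * q * q ^ 3 := by ring
    have : 8004 ^ 4 * q ≤ 1 / 8 := by rw [hq]; norm_num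
    nlinarith
  have b2 : 2 * η * (5 / δ) * (t + τ) ≤ q ^ 3 / 4 := by
    have h3 : 0 < q ^ 3 := by positivity
    have : 2 * η * (5 / δ) = q ^ 3 / 4 := by rw [hη]; field_simp; norm_num
    rw [this]
    nlinarith
  have T1 : |h x (t + τ + δ) - h x (0 + τ + δ)| ≤ 10 / τ * |t - 0| := by
    refine abs_sub_le_of_hasDerivAt (g := fun t => h x (t + τ + δ))
      (g' := fun t => hxx x (t + τ + δ)) (fun z hz => ?_) (fun z hz => ?_)
    all_goals
      rw [uIcc_of_ge ht2] at hz
      have mz : z ∈ Icc (-τ) 0 := ⟨mt.1.trans hz.1, hz.2⟩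
    · exact k3 x z mz
    · refine (H _ (pos z mz) x).2.2.2.2.2.1.trans ?_
      rw [div_le_div_iff₀ (pos z mz) hτ0]
      nlinarith [hz.1]
  have hxxb : ∀ z, |hxx z (τ + δ)| ≤ 10 / τ := fun z => by
    refine (H _ hτδ z).2.2.2.2.2.1.trans ?_
    gcongr <;> linarith
  have T2 : |(h x (τ + δ) - hx 0 (τ + δ) * x) - (h 0 (τ + δ) - hx 0 (τ + δ) * 0)| ≤
      10 / τ * |x| * |x - 0| := by
    refine abs_sub_le_of_hasDerivAt (g := fun z => h z (τ + δ) - hx 0 (τ + δ) * z)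
      (g' := fun z => hx z (τ + δ) - hx 0 (τ + δ)) (fun z hz => ?_) (fun z hz => ?_)
    · have := (H _ hτδ z).1.sub ((hasDerivAt_id z).const_mul (hx 0 (τ + δ)))
      rw [mul_one] at this
      exact this
    · refine (abs_sub_le_of_hasDerivAt (fun z _ => (H _ hτδ z).2.1)
        (fun z _ => hxxb z)).trans ?_
      rw [sub_zero]
      have := abs_sub_left_of_mem_uIcc hz
      rw [sub_zero, sub_zero] at this
      gcongr
  rw [sub_zero] at T1 T2
  rw [zero_add] at T1
  rw [mul_zero, sub_zero] at T2
  have ht4 : |t| ≤ q ^ 4 := by rw [abs_of_nonpos ht2]; linarith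
  have hxx4 : |x| * |x| ≤ q ^ 4 := by
    calc _ ≤ q ^ 2 * q ^ 2 := by gcongr
      _ = _ := by ring
  have key : 10 / τ * q ^ 4 = q ^ 3 / 8 := by rw [hτ]; field_simp; norm_num
  have T1' : 10 / τ * |t| ≤ q ^ 3 / 8 := by
    rw [← key]; gcongr
  have T2' : 10 / τ * |x| * |x| ≤ q ^ 3 / 8 := by
    rw [← key, mul_assoc]; gcongr
  have a1 := abs_le.1 (T1.trans T1')
  have a2 := abs_le.1 (T2.trans T2')
  have a3 := E1 x mx t mt
  have a4 := E2 x mx t mt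
  rw [abs_le]
  constructor <;> linarith [a1.1, a1.2, a2.1, a2.2]

theorem exists_scale {q ρ : ℝ} (hq : 0 < q) (hq1 : q < 1) (hρ : 0 < ρ) (hρ1 : ρ ≤ 1) :
    ∃ k : ℕ, ρ ≤ (q ^ k) ^ 2 ∧ (q ^ (k + 1)) ^ 3 ≤ ρ * √ρ := by
  have hs : 0 < √ρ := Real.sqrt_pos.2 hρ
  have hs1 : √ρ ≤ 1 := Real.sqrt_le_one.2 hρ1
  have hss : √ρ * √ρ = ρ := Real.mul_self_sqrt hρ.le
  obtain ⟨k, h1, h2⟩ := exists_nat_pow_near_of_lt_one hs hs1 hq hq1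
  refine ⟨k, ?_, ?_⟩
  · nlinarith
  · have : (q ^ (k + 1)) ^ 3 ≤ (√ρ) ^ 3 := by gcongr
    nlinarith

/-- Pointwise `C^{1,1/2}` regularity of solutions with nearly constant coefficients. -/
theorem flatness : ∃ η C : ℝ, 0 < η ∧ η ≤ 1 / 2 ∧ 0 < C ∧
    ∀ W : ℝ → ℝ → ℝ, UnitSol W (1 - η) (1 + η) → ∃ n : ℝ, |n| ≤ C ∧
      ∀ ρ x t : ℝ, 0 < ρ → ρ ≤ 1 → |x| ≤ ρ → -ρ ^ 2 ≤ t → t ≤ 0 →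
        |W x t - W 0 0 - n * x| ≤ C * (ρ * √ρ) := by
  obtain ⟨q, η, C, hq0, hq2, hη0, hη1, hC, step⟩ := flatness_step
  refine ⟨η, 2 * C + (2 + 2 * C) / q ^ 3, hη0, hη1, by positivity, fun W hW => ?_⟩
  have hq1 : q < 1 := by linarith
  have key : ∃ a : ℕ → ℝ × ℝ, a 0 = (0, 0) ∧ ∀ k,
      (∀ x t : ℝ, |x| ≤ (q ^ k) ^ 2 → -((q ^ k) ^ 2) ^ 2 ≤ t → t ≤ 0 →
        |W x t - ((a k).1 + (a k).2 * x)| ≤ (q ^ k) ^ 3) ∧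
      |(a (k + 1)).2 - (a k).2| ≤ C * q ^ k := by
    set P : ℕ → ℝ × ℝ → Prop := fun k a => ∀ x t : ℝ, |x| ≤ (q ^ k) ^ 2 →
      -((q ^ k) ^ 2) ^ 2 ≤ t → t ≤ 0 → |W x t - (a.1 + a.2 * x)| ≤ (q ^ k) ^ 3 with hP
    have P0 : P 0 (0, 0) := fun x t hx ht ht' => by
      have hx' := abs_le.1 hx
      norm_num at hx' ht ⊢
      exact hW.bound x hx' t ⟨ht, ht'⟩
    have Ps : ∀ k a, P k a → ∃ b, P (k + 1) b ∧ |b.2 - a.2| ≤ C * q ^ k := by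
      intro k a ha
      have hk : 0 < q ^ k := by positivity
      have hk1 : q ^ k ≤ 1 := pow_le_one₀ hq0.le hq1.le
      obtain ⟨m, n, hm, hn, hmn⟩ := step _ (hW.rescale (r := (q ^ k) ^ 2) (k := (q ^ k) ^ 3)
        (m := a.1) (n := a.2) (by positivity) (pow_le_one₀ hk.le hk1) (by positivity) ha)
      refine ⟨(a.1 + (q ^ k) ^ 3 * m, a.2 + q ^ k * n), fun x t hx ht ht' => ?_, ?_⟩
      · have hx' : |x / (q ^ k) ^ 2| ≤ q ^ 2 := by
          rw [abs_div, abs_of_pos (by positivity : 0 < (q ^ k) ^ 2), div_le_iff₀ (by positivity)]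
          calc _ ≤ _ := hx
            _ = _ := by ring
        have ht1 : -q ^ 4 ≤ t / ((q ^ k) ^ 2) ^ 2 := by
          rw [le_div_iff₀ (by positivity)]
          calc _ = -((q ^ (k + 1)) ^ 2) ^ 2 := by ring
            _ ≤ _ := ht
        have := hmn _ _ hx' ht1 (div_nonpos_of_nonpos_of_nonneg ht' (by positivity))
        have e1 : (q ^ k) ^ 2 * (x / (q ^ k) ^ 2) = x := by field_simp
        have e2 : ((q ^ k) ^ 2) ^ 2 * (t / ((q ^ k) ^ 2) ^ 2) = t := by field_simp
        rw [e1, e2] at this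
        have e3 : W x t - (a.1 + (q ^ k) ^ 3 * m + (a.2 + q ^ k * n) * x) =
            (q ^ k) ^ 3 * ((W x t - (a.1 + a.2 * (q ^ k) ^ 2 * (x / (q ^ k) ^ 2))) / (q ^ k) ^ 3 -
              (m + n * (x / (q ^ k) ^ 2))) := by
          field_simp
          ring
        simp only
        rw [e3, abs_mul, abs_of_pos (by positivity : 0 < (q ^ k) ^ 3)]
        calc _ ≤ (q ^ k) ^ 3 * q ^ 3 := by gcongr
          _ = _ := by ring
      · simp only [add_sub_cancel_left]
        rw [abs_mul, abs_of_pos hk, mul_comm]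
        gcongr
    choose! F hF1 hF2 using Ps
    refine ⟨fun k => Nat.rec (0, 0) (fun k a => F k a) k, rfl, fun k => ?_⟩
    have : P k (Nat.rec (0, 0) (fun k a => F k a) k) := by
      induction k with
      | zero => exact P0
      | succ k ih => exact hF1 k _ ih
    exact ⟨this, hF2 k _ this⟩
  obtain ⟨a, ha0, ha⟩ := key
  have hdist : ∀ k, dist ((a k).2) ((a (k + 1)).2) ≤ C * q ^ k := fun k => by
    rw [dist_comm, Real.dist_eq]; exact (ha k).2
  obtain ⟨n, hn⟩ := cauchySeq_tendsto_of_complete (cauchySeq_of_le_geometric q C hq1 hdist)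
  have hnk : ∀ k, |n - (a k).2| ≤ 2 * C * q ^ k := fun k => by
    have := dist_le_of_le_geometric_of_tendsto q C hq1 hdist hn k
    rw [dist_comm, Real.dist_eq] at this
    refine this.trans ?_
    rw [div_le_iff₀ (by linarith)]
    have : 0 < C * q ^ k := by positivity
    nlinarith
  have hCq : 0 < (2 + 2 * C) / q ^ 3 := by positivity
  refine ⟨n, ?_, fun ρ x t hρ hρ1 hx ht ht' => ?_⟩
  · have := hnk 0
    rw [ha0] at this
    simp only [sub_zero, pow_zero, mul_one] at this
    linarith
  · obtain ⟨k, hk1, hk2⟩ := exists_scale hq0 hq1 hρ hρ1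
    have hk : 0 < q ^ k := by positivity
    have b1 := (ha k).1 x t (hx.trans hk1) (by nlinarith) ht'
    have b2 := (ha k).1 0 0 (by simp; positivity) (by simp; positivity) le_rfl
    have b3 : |(n - (a k).2) * x| ≤ 2 * C * (q ^ k) ^ 3 := by
      rw [abs_mul]
      calc _ ≤ 2 * C * q ^ k * (q ^ k) ^ 2 := by
            gcongr
            · exact hnk k
            · exact hx.trans hk1
        _ = _ := by ring
    have b4 : |W x t - W 0 0 - n * x| ≤ (2 + 2 * C) * (q ^ k) ^ 3 := by
      have c1 := abs_le.1 b1
      have c2 := abs_le.1 b2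
      have c3 := abs_le.1 b3
      rw [abs_le]
      constructor <;> linarith [c1.1, c1.2, c2.1, c2.2, c3.1, c3.2]
    have h0 : 0 ≤ ρ * √ρ := by positivity
    calc _ ≤ (2 + 2 * C) * (q ^ k) ^ 3 := b4
      _ = (2 + 2 * C) / q ^ 3 * (q ^ (k + 1)) ^ 3 := by
        rw [pow_succ q k]; field_simp
      _ ≤ (2 + 2 * C) / q ^ 3 * (ρ * √ρ) := by gcongr
      _ ≤ _ := by
        gcongr
        linarith

/-- `flatness` on a cylinder of general size and for coefficients close to a constant `a₀`. -/
theorem flatness_scaled : ∃ η C : ℝ, 0 < η ∧ η ≤ 1 / 2 ∧ 0 < C ∧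
    ∀ (W : ℝ → ℝ → ℝ) (a₀ x₀ t₀ r M : ℝ), 0 < a₀ → 0 < r → 0 < M →
      ContinuousOn (fun p : ℝ × ℝ => W p.1 p.2)
        (Icc (x₀ - r) (x₀ + r) ×ˢ Icc (t₀ - r ^ 2 / a₀) t₀) →
      (∀ x ∈ Ioo (x₀ - r) (x₀ + r), ∀ t ∈ Ioc (t₀ - r ^ 2 / a₀) t₀,
        PtSol W (a₀ * (1 - η)) (a₀ * (1 + η)) x t) →
      (∀ x ∈ Icc (x₀ - r) (x₀ + r), ∀ t ∈ Icc (t₀ - r ^ 2 / a₀) t₀, |W x t| ≤ M) →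
      ∃ n : ℝ, |n| ≤ C * (M / r) ∧ ∀ ρ x t : ℝ, 0 < ρ → ρ ≤ r → |x - x₀| ≤ ρ →
        t₀ - ρ ^ 2 / a₀ ≤ t → t ≤ t₀ →
        |W x t - W x₀ t₀ - n * (x - x₀)| ≤ C * (M / (r * √r)) * (ρ * √ρ) := by
  obtain ⟨η, C, hη0, hη1, hC, key⟩ := flatness
  refine ⟨η, C, hη0, hη1, hC, fun W a₀ x₀ t₀ r M ha hr hM hW hS hb => ?_⟩
  have hk : 0 < r ^ 2 / a₀ := by positivity
  have mx : ∀ y ∈ Icc (-1 : ℝ) 1, x₀ + r * y ∈ Icc (x₀ - r) (x₀ + r) := fun y hy =>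
    ⟨by nlinarith [hy.1], by nlinarith [hy.2]⟩
  have mt : ∀ y ∈ Icc (-1 : ℝ) 0, t₀ + r ^ 2 / a₀ * y ∈ Icc (t₀ - r ^ 2 / a₀) t₀ := fun y hy =>
    ⟨by nlinarith [hy.1], by nlinarith [hy.2]⟩
  have hUS : UnitSol (fun x t => (W (x₀ + r * x) (t₀ + r ^ 2 / a₀ * t) - (0 + 0 * x)) / M)
      (1 - η) (1 + η) := by
    refine ⟨?_, ?_, ?_⟩
    · have : ContinuousOn (fun p : ℝ × ℝ => W (x₀ + r * p.1) (t₀ + r ^ 2 / a₀ * p.2))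
          (Icc (-1) 1 ×ˢ Icc (-1) 0) :=
        hW.comp (f := fun p : ℝ × ℝ => (x₀ + r * p.1, t₀ + r ^ 2 / a₀ * p.2)) (by fun_prop)
          (fun p hp => ⟨mx _ hp.1, mt _ hp.2⟩)
      exact (this.sub (by fun_prop)).div_const M
    · intro y hy t ht
      have := (hS (x₀ + r * y) ⟨by nlinarith [hy.1], by nlinarith [hy.2]⟩ (t₀ + r ^ 2 / a₀ * t)
        ⟨by nlinarith [ht.1], by nlinarith [ht.2]⟩).rescale (m := 0) (n := 0) (k := M) hr hk
      refine this.mono (le_of_eq ?_) (le_of_eq ?_) <;> field_simp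
    · intro y hy t ht
      simp only [zero_mul, add_zero, sub_zero]
      rw [abs_div, abs_of_pos hM, div_le_one hM]
      exact hb _ (mx y hy) _ (mt t ht)
  obtain ⟨n, hn, hn2⟩ := key _ hUS
  refine ⟨n * (M / r), ?_, fun ρ x t hρ hρr hx ht ht' => ?_⟩
  · rw [abs_mul, abs_of_pos (by positivity : 0 < M / r)]
    gcongr
  · have := hn2 (ρ / r) ((x - x₀) / r) ((t - t₀) / (r ^ 2 / a₀)) (by positivity)
      (by rw [div_le_one hr]; exact hρr) (by rw [abs_div, abs_of_pos hr]; gcongr)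
      (by
        rw [le_div_iff₀ hk]
        have : -(ρ / r) ^ 2 * (r ^ 2 / a₀) = -(ρ ^ 2 / a₀) := by field_simp
        linarith)
      (div_nonpos_of_nonpos_of_nonneg (by linarith) hk.le)
    have e : x₀ + r * ((x - x₀) / r) = x := by field_simp; ring
    have e' : t₀ + r ^ 2 / a₀ * ((t - t₀) / (r ^ 2 / a₀)) = t := by field_simp; ring
    simp only [e, e', mul_zero, add_zero, zero_mul, sub_zero] at this
    have e2 : W x t - W x₀ t₀ - n * (M / r) * (x - x₀) =
        M * (W x t / M - W x₀ t₀ / M - n * ((x - x₀) / r)) := by field_simp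
    rw [e2, abs_mul, abs_of_pos hM]
    calc _ ≤ M * (C * (ρ / r * √(ρ / r))) := by gcongr
      _ = _ := by
        rw [Real.sqrt_div' _ hr.le]
        have : 0 < √r := Real.sqrt_pos.2 hr
        field_simp

/-- `U` is a stream function on the cylinder of radius `r` below `(x₀, t₀)`: `∂ₓU = u`,
`∂ₓu = v` and `∂ₜU = A v`, where `A' = α` and `|v| ≤ K`. -/
structure CylSol (α A : ℝ → ℝ) (U u v : ℝ → ℝ → ℝ) (K l c x₀ t₀ r : ℝ) : Prop where
  pos : 0 < r
  lpos : 0 < l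
  derivA : ∀ p, HasDerivAt A (α p) p
  zeroA : A 0 = 0
  bdα : ∀ p, |p| ≤ K → α p ∈ Icc l c
  derivU : ∀ x ∈ Icc (x₀ - r) (x₀ + r), ∀ t ∈ Icc (t₀ - r ^ 2) t₀,
    HasDerivAt (fun y => U y t) (u x t) x
  derivu : ∀ x ∈ Icc (x₀ - r) (x₀ + r), ∀ t ∈ Icc (t₀ - r ^ 2) t₀,
    HasDerivAt (fun y => u y t) (v x t) x
  derivt : ∀ x ∈ Icc (x₀ - r) (x₀ + r), ∀ t ∈ Icc (t₀ - r ^ 2) t₀,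
    HasDerivAt (fun s => U x s) (A (v x t)) t
  bound : ∀ x ∈ Icc (x₀ - r) (x₀ + r), ∀ t ∈ Icc (t₀ - r ^ 2) t₀, |v x t| ≤ K

/-- Difference quotient in time. -/
noncomputable def quot (U : ℝ → ℝ → ℝ) (s x t : ℝ) : ℝ := (U x t - U x (t - s)) / s

theorem exists_slope {α A : ℝ → ℝ} (hA : ∀ p, HasDerivAt A (α p) p) (a b : ℝ) :
    ∃ p ∈ uIcc a b, A b - A a = α p * (b - a) := by
  have aux : ∀ a b : ℝ, a < b → ∃ p ∈ Icc a b, A b - A a = α p * (b - a) := fun a b h => by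
    obtain ⟨p, hp, e⟩ := exists_hasDerivAt_eq_slope A α h
      (fun x _ => (hA x).continuousAt.continuousWithinAt) (fun x _ => hA x)
    refine ⟨p, Ioo_subset_Icc_self hp, ?_⟩
    rw [e, div_mul_cancel₀ _ (by linarith)]
  rcases lt_trichotomy a b with h | h | h
  · rw [uIcc_of_le h.le]; exact aux a b h
  · subst h; exact ⟨a, left_mem_uIcc, by ring⟩
  · rw [uIcc_of_ge h.le]
    obtain ⟨p, hp, e⟩ := aux b a h
    exact ⟨p, hp, by linarith⟩

section
variable {α A : ℝ → ℝ} {U u v : ℝ → ℝ → ℝ} {K l c x₀ t₀ r : ℝ}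

theorem CylSol.quot_sol (h : CylSol α A U u v K l c x₀ t₀ r) {c₁ c₂ s x t : ℝ} (hs : 0 < s)
    (hx : x ∈ Ioo (x₀ - r) (x₀ + r)) (ht : t₀ - r ^ 2 ≤ t - s) (ht' : t ≤ t₀)
    (hc : ∀ p ∈ uIcc (v x (t - s)) (v x t), α p ∈ Icc c₁ c₂) : PtSol (quot U s) c₁ c₂ x t := by
  have m1 : t ∈ Icc (t₀ - r ^ 2) t₀ := ⟨by linarith, ht'⟩
  have m2 : t - s ∈ Icc (t₀ - r ^ 2) t₀ := ⟨ht, by linarith⟩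
  have hx' := Ioo_subset_Icc_self hx
  obtain ⟨p, hp, e⟩ := exists_slope h.derivA (v x (t - s)) (v x t)
  refine ⟨fun y => (u y t - u y (t - s)) / s, (v x t - v x (t - s)) / s,
    (A (v x t) - A (v x (t - s))) / s, α p, ?_, ?_, ?_, hc p hp, by rw [e]; ring⟩
  · filter_upwards [Ioo_mem_nhds hx.1 hx.2] with y hy
    have hy' := Ioo_subset_Icc_self hy
    exact ((h.derivU y hy' t m1).sub (h.derivU y hy' _ m2)).div_const s
  · exact ((h.derivu x hx' t m1).sub (h.derivu x hx' _ m2)).div_const s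
  · exact ((h.derivt x hx' t m1).sub ((h.derivt x hx' _ m2).comp_sub_const t s)).div_const s

theorem CylSol.K_nonneg (h : CylSol α A U u v K l c x₀ t₀ r) : 0 ≤ K :=
  (abs_nonneg _).trans (h.bound x₀ ⟨by linarith [h.pos], by linarith [h.pos]⟩ t₀
    ⟨by nlinarith [h.pos], le_rfl⟩)

theorem CylSol.c_pos (h : CylSol α A U u v K l c x₀ t₀ r) : 0 < c := by
  have := h.bdα 0 (by simpa using h.K_nonneg)
  linarith [this.1, this.2, h.lpos]

theorem CylSol.abs_A_le (h : CylSol α A U u v K l c x₀ t₀ r) {p : ℝ} (hp : |p| ≤ K) :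
    |A p| ≤ c * K := by
  obtain ⟨q, hq, e⟩ := exists_slope h.derivA 0 p
  have hq' := abs_sub_left_of_mem_uIcc hq
  rw [sub_zero, sub_zero] at hq'
  have := h.bdα q (hq'.trans hp)
  rw [h.zeroA, sub_zero, sub_zero] at e
  rw [e, abs_mul, abs_of_nonneg (h.lpos.le.trans this.1)]
  gcongr
  · exact h.c_pos.le
  · exact this.2

theorem CylSol.abs_A_sub_ge (h : CylSol α A U u v K l c x₀ t₀ r) {p q : ℝ} (hp : |p| ≤ K)
    (hq : |q| ≤ K) : l * |p - q| ≤ |A p - A q| := by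
  obtain ⟨z, hz, e⟩ := exists_slope h.derivA q p
  have hz' : |z| ≤ K := by
    have hp' := abs_le.1 hp
    have hq' := abs_le.1 hq
    exact abs_le.2 ((uIcc_subset_Icc hq' hp') hz)
  have := h.bdα z hz'
  rw [e, abs_mul, abs_of_nonneg (h.lpos.le.trans this.1)]
  gcongr
  exact this.1

theorem CylSol.continuousOn_U (h : CylSol α A U u v K l c x₀ t₀ r) :
    ContinuousOn (fun p : ℝ × ℝ => U p.1 p.2)
      (Icc (x₀ - r) (x₀ + r) ×ˢ Icc (t₀ - r ^ 2) t₀) := by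
  have h0 : 0 ≤ c * K := mul_nonneg h.c_pos.le h.K_nonneg
  refine continuousOn_prod_of_continuousOn_lipschitzOnWith'
    (f := fun p : ℝ × ℝ => U p.1 p.2) (K := (c * K).toNNReal) ?_ ?_
  · intro x hx
    refine LipschitzOnWith.of_dist_le_mul fun t ht s hs => ?_
    rw [Real.coe_toNNReal _ h0, Real.dist_eq, Real.dist_eq]
    exact abs_sub_le_of_hasDerivAt
      (fun z hz => h.derivt x hx z (uIcc_subset_Icc hs ht hz))
      (fun z hz => h.abs_A_le (h.bound x hx z (uIcc_subset_Icc hs ht hz)))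
  · exact fun t ht x hx => (h.derivU x hx t ht).continuousAt.continuousWithinAt

theorem CylSol.quot_continuousOn (h : CylSol α A U u v K l c x₀ t₀ r) {s : ℝ}
    {T : Set ℝ} (hT : ∀ t ∈ T, t₀ - r ^ 2 ≤ t - s ∧ t ≤ t₀) (hs : 0 < s) :
    ContinuousOn (fun p : ℝ × ℝ => quot U s p.1 p.2) (Icc (x₀ - r) (x₀ + r) ×ˢ T) := by
  have c1 : ContinuousOn (fun p : ℝ × ℝ => U p.1 p.2) (Icc (x₀ - r) (x₀ + r) ×ˢ T) :=
    h.continuousOn_U.mono (prod_mono le_rfl fun t ht =>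
      ⟨by linarith [(hT t ht).1], (hT t ht).2⟩)
  have c2 : ContinuousOn (fun p : ℝ × ℝ => U p.1 (p.2 - s)) (Icc (x₀ - r) (x₀ + r) ×ˢ T) :=
    h.continuousOn_U.comp (f := fun p : ℝ × ℝ => (p.1, p.2 - s)) (by fun_prop)
      fun p hp => ⟨hp.1, (hT _ hp.2).1, by linarith [(hT _ hp.2).2]⟩
  exact (c1.sub c2).div_const s

theorem CylSol.quot_bound (h : CylSol α A U u v K l c x₀ t₀ r) {s x t : ℝ} (hs : 0 < s)
    (hx : x ∈ Icc (x₀ - r) (x₀ + r)) (ht : t₀ - r ^ 2 ≤ t - s) (ht' : t ≤ t₀) :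
    |quot U s x t| ≤ c * K := by
  have m1 : t ∈ Icc (t₀ - r ^ 2) t₀ := ⟨by linarith, ht'⟩
  have m2 : t - s ∈ Icc (t₀ - r ^ 2) t₀ := ⟨ht, by linarith⟩
  have := abs_sub_le_of_hasDerivAt (g := fun t => U x t) (B := c * K)
    (fun z hz => h.derivt x hx z (uIcc_subset_Icc m2 m1 hz))
    (fun z hz => h.abs_A_le (h.bound x hx z (uIcc_subset_Icc m2 m1 hz)))
  rw [sub_sub_cancel, abs_of_pos hs] at this
  rw [quot, abs_div, abs_of_pos hs, div_le_iff₀ hs]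
  exact this

theorem CylSol.quot_tendsto (h : CylSol α A U u v K l c x₀ t₀ r) {x t : ℝ}
    (hx : x ∈ Icc (x₀ - r) (x₀ + r)) (ht : t ∈ Icc (t₀ - r ^ 2) t₀) :
    Tendsto (fun s => quot U s x t) (𝓝[>] 0) (𝓝 (A (v x t))) := by
  have h1 := (hasDerivAt_iff_tendsto_slope.1 (h.derivt x hx t ht))
  have h2 : Tendsto (fun s => t - s) (𝓝[>] 0) (𝓝[≠] t) := by
    rw [tendsto_nhdsWithin_iff]
    constructor
    · have : Tendsto (fun s => t - s) (𝓝 0) (𝓝 (t - 0)) := by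
        exact (continuous_const.sub continuous_id).tendsto 0
      rw [sub_zero] at this
      exact this.mono_left nhdsWithin_le_nhds
    · filter_upwards [self_mem_nhdsWithin] with s hs
      simp only [mem_compl_iff, mem_singleton_iff]
      intro h'
      have : (0 : ℝ) < s := hs
      linarith
  refine (h1.comp h2).congr' ?_
  filter_upwards [self_mem_nhdsWithin] with s hs
  have : (0 : ℝ) < s := hs
  simp only [Function.comp, slope_def_field, quot]
  rw [show t - s - t = -s by ring, div_neg, ← neg_div]
  ring

/-- `A v` is Lipschitz in space. -/
theorem CylSol.lipschitz_A (h : CylSol α A U u v K l c x₀ t₀ r) {x y t : ℝ}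
    (hy : |y - x₀| ≤ r / 2) (ht : t₀ - r ^ 2 / 4 ≤ t) (ht' : t ≤ t₀) (hxy : |x - y| ≤ r / 4) :
    |A (v x t) - A (v y t)| ≤ (14 + 4 / l) * (c * K + 1) / (r / 4) * |x - y| := by
  have hr := h.pos
  have hr2 : 0 < r ^ 2 := by positivity
  have hy' := abs_le.1 hy
  have hxy' := abs_le.1 hxy
  have mt : t ∈ Icc (t₀ - r ^ 2) t₀ := ⟨by nlinarith, ht'⟩
  have l1 := h.quot_tendsto (x := x) (t := t) ⟨by linarith, by linarith⟩ mt
  have l2 := h.quot_tendsto (x := y) (t := t) ⟨by linarith, by linarith⟩ mt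
  refine le_of_tendsto (l1.sub l2).abs ?_
  filter_upwards [Ioo_mem_nhdsGT (by positivity : 0 < r ^ 2 / 2)] with s hs
  have hT : ∀ t' ∈ Icc (t - (r / 4) ^ 2) t, t₀ - r ^ 2 ≤ t' - s ∧ t' ≤ t₀ := fun t' ht'' =>
    ⟨by nlinarith [ht''.1, hs.2], ht''.2.trans ht'⟩
  have hsub : Icc (y - r / 4) (y + r / 4) ⊆ Icc (x₀ - r) (x₀ + r) :=
    Icc_subset_Icc (by linarith) (by linarith)
  refine kruzhkov (c₂ := c) h.lpos (by positivity)
    (by linarith [mul_nonneg h.c_pos.le h.K_nonneg])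
    ((h.quot_continuousOn hT hs.1).mono (prod_mono hsub le_rfl))
    (fun z hz t' ht'' => ?_)
    (fun z hz t' ht'' => (h.quot_bound hs.1 (hsub hz) (hT t' ht'').1 (hT t' ht'').2).trans
      (by linarith))
    ⟨by linarith, by linarith⟩
  have mt' := Ioc_subset_Icc_self ht''
  have hz' : z ∈ Ioo (x₀ - r) (x₀ + r) := ⟨by linarith [hz.1], by linarith [hz.2]⟩
  refine h.quot_sol hs.1 hz' (hT t' mt').1 (hT t' mt').2 fun p hp => h.bdα p ?_
  have b1 := abs_le.1 (h.bound z (Ioo_subset_Icc_self hz') t'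
    ⟨by linarith [(hT t' mt').1, hs.1], (hT t' mt').2⟩)
  have b2 := abs_le.1 (h.bound z (Ioo_subset_Icc_self hz') (t' - s)
    ⟨(hT t' mt').1, by linarith [(hT t' mt').2, hs.1]⟩)
  exact abs_le.2 (uIcc_subset_Icc b2 b1 hp)

theorem CylSol.lipschitz_v (h : CylSol α A U u v K l c x₀ t₀ r) {x y t : ℝ}
    (hy : |y - x₀| ≤ r / 2) (ht : t₀ - r ^ 2 / 4 ≤ t) (ht' : t ≤ t₀) (hxy : |x - y| ≤ r / 4) :
    |v x t - v y t| ≤ (14 + 4 / l) * (c * K + 1) / (r / 4) / l * |x - y| := by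
  have hr := h.pos
  have hy' := abs_le.1 hy
  have hxy' := abs_le.1 hxy
  have mt : t ∈ Icc (t₀ - r ^ 2) t₀ := ⟨by nlinarith, ht'⟩
  have h1 := h.lipschitz_A hy ht ht' hxy
  have h2 := h.abs_A_sub_ge (h.bound x ⟨by linarith, by linarith⟩ t mt)
    (h.bound y ⟨by linarith, by linarith⟩ t mt)
  have hl := h.lpos
  rw [div_mul_eq_mul_div, le_div_iff₀ hl]
  linarith

end

theorem exists_ultrafilter_lim {ι : Type*} (F : Ultrafilter ι) {f : ι → ℝ} {C : ℝ}
    (h : ∀ᶠ i in (F : Filter ι), |f i| ≤ C) :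
    ∃ a, |a| ≤ C ∧ Tendsto f (F : Filter ι) (𝓝 a) := by
  obtain ⟨a, ha, ha'⟩ := (isCompact_Icc (a := -C) (b := C)).ultrafilter_le_nhds (F.map f)
    (by
      rw [le_principal_iff]
      exact h.mono fun i hi => abs_le.1 hi)
  exact ⟨a, abs_le.2 ha, ha'⟩

section
variable {α A : ℝ → ℝ} {U u v : ℝ → ℝ → ℝ} {K l c x₀ t₀ r : ℝ}

/-- Spatial Lipschitz constant of `A v` near the centre of a cylinder. -/
noncomputable def lipA (K l c r : ℝ) : ℝ := (14 + 4 / l) * (c * K + 1) / (r / 4)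

/-- Spatial Lipschitz constant of `v` near the centre of a cylinder. -/
noncomputable def lipV (K l c r : ℝ) : ℝ := lipA K l c r / l

theorem CylSol.lipA_pos (h : CylSol α A U u v K l c x₀ t₀ r) : 0 < lipA K l c r := by
  have h1 := h.lpos
  have h2 := h.pos
  have h3 := h.c_pos
  have h4 := h.K_nonneg
  unfold lipA
  positivity

theorem CylSol.lipV_pos (h : CylSol α A U u v K l c x₀ t₀ r) : 0 < lipV K l c r :=
  div_pos h.lipA_pos h.lpos

theorem CylSol.second_diff (h : CylSol α A U u v K l c x₀ t₀ r) {x t σ : ℝ}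
    (hx : |x - x₀| ≤ r / 4) (ht : t ∈ Icc (t₀ - r ^ 2 / 4) t₀) (hσ : 0 ≤ σ) (hσr : σ ≤ r / 4) :
    |U (x + σ) t + U (x - σ) t - 2 * U x t - σ ^ 2 * v x t| ≤ 2 * lipV K l c r * σ * σ * σ := by
  have hr := h.pos
  have hx' := abs_le.1 hx
  have mt : t ∈ Icc (t₀ - r ^ 2) t₀ := ⟨by nlinarith [ht.1], ht.2⟩
  have mx : ∀ z ∈ uIcc 0 σ, x + z ∈ Icc (x₀ - r) (x₀ + r) ∧ x - z ∈ Icc (x₀ - r) (x₀ + r) := by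
    intro z hz
    rw [uIcc_of_le hσ] at hz
    exact ⟨⟨by linarith [hz.1, hz.2], by linarith [hz.1, hz.2]⟩,
      ⟨by linarith [hz.1, hz.2], by linarith [hz.1, hz.2]⟩⟩
  have sub : ∀ {z y}, y ∈ uIcc 0 σ → z ∈ uIcc 0 y → z ∈ uIcc 0 σ := fun hy hz =>
    uIcc_subset_uIcc left_mem_uIcc hy hz
  have hz0 : ∀ {z}, z ∈ uIcc 0 σ → |z| ≤ σ := fun hz => by
    have := abs_sub_left_of_mem_uIcc hz
    rwa [sub_zero, sub_zero, abs_of_nonneg hσ] at this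
  have d2 : ∀ z ∈ uIcc 0 σ, |u (x + z) t - u (x - z) t - 2 * z * v x t| ≤
      2 * lipV K l c r * σ * σ := fun z hz => by
    have := abs_sub_le_of_hasDerivAt (a := 0) (b := z) (B := 2 * lipV K l c r * σ)
      (g := fun z => u (x + z) t - u (x - z) t - 2 * z * v x t)
      (g' := fun z => v (x + z) t - (-v (x - z) t) - 2 * v x t)
      (fun y hy => by
        have my := mx y (sub hz hy)
        have e1 := (h.derivu _ my.1 t mt).comp_const_add x y
        have e2 := (h.derivu _ my.2 t mt).comp_const_sub x y
        have e3 : HasDerivAt (fun z => 2 * z * v x t) (2 * v x t) y := by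
          simpa using ((hasDerivAt_id y).const_mul 2).mul_const (v x t)
        exact (e1.sub e2).sub e3)
      (fun y hy => by
        have hy' := hz0 (sub hz hy)
        have b1 := h.lipschitz_v (x := x + y) (y := x) (t := t) (by linarith) ht.1 ht.2
          (by rw [add_sub_cancel_left]; linarith)
        have b2 := h.lipschitz_v (x := x - y) (y := x) (t := t) (by linarith) ht.1 ht.2
          (by rw [sub_sub_cancel_left, abs_neg]; linarith)
        rw [add_sub_cancel_left] at b1
        rw [sub_sub_cancel_left, abs_neg] at b2
        have b3 : lipV K l c r * |y| ≤ lipV K l c r * σ :=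
          mul_le_mul_of_nonneg_left hy' h.lipV_pos.le
        have b1' := abs_le.1 (b1.trans b3)
        have b2' := abs_le.1 (b2.trans b3)
        rw [abs_le]
        constructor <;> linarith [b1'.1, b1'.2, b2'.1, b2'.2])
    simp only [add_zero, sub_zero, sub_self, mul_zero, zero_mul] at this
    refine this.trans ?_
    have := h.lipV_pos
    gcongr
    exact hz0 hz
  have := abs_sub_le_of_hasDerivAt (a := 0) (b := σ) (B := 2 * lipV K l c r * σ * σ)
    (g := fun z => U (x + z) t + U (x - z) t - 2 * U x t - z ^ 2 * v x t)
    (g' := fun z => u (x + z) t + (-u (x - z) t) - 2 * z * v x t)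
    (fun y hy => by
      have my := mx y hy
      have e1 := (h.derivU _ my.1 t mt).comp_const_add x y
      have e2 := (h.derivU _ my.2 t mt).comp_const_sub x y
      have e3 : HasDerivAt (fun z => z ^ 2 * v x t) (2 * y * v x t) y := by
        simpa using ((hasDerivAt_id y).pow 2).mul_const (v x t)
      exact ((e1.add e2).sub_const _).sub e3)
    (fun y hy => by simpa only [sub_eq_add_neg] using d2 y hy)
  simp only [add_zero, sub_zero] at this
  rw [abs_of_nonneg hσ] at this
  ring_nf at this ⊢
  exact this

theorem CylSol.time_v (h : CylSol α A U u v K l c x₀ t₀ r) {x s t : ℝ}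
    (hx : |x - x₀| ≤ r / 4) (ht : t ∈ Icc (t₀ - r ^ 2 / 4) t₀) (hs : s ∈ Icc (t₀ - r ^ 2 / 4) t₀)
    {σ : ℝ} (hσ : 0 ≤ σ) (hst : |t - s| ≤ σ ^ 2) (hσr : σ ≤ r / 4) :
    |v x t - v x s| ≤ (2 * lipA K l c r + 4 * lipV K l c r) * σ := by
  have hr := h.pos
  have hx' := abs_le.1 hx
  rcases hσ.eq_or_lt with h0 | h0
  · rw [← h0] at hst
    have : t = s := by
      have := abs_nonpos_iff.1 (hst.trans (by norm_num))
      linarith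
    rw [this, ← h0]; simp
  have mono : Icc (t₀ - r ^ 2 / 4) t₀ ⊆ Icc (t₀ - r ^ 2) t₀ :=
    Icc_subset_Icc (by nlinarith) le_rfl
  have mx : x ∈ Icc (x₀ - r) (x₀ + r) := ⟨by linarith, by linarith⟩
  have mx1 : x + σ ∈ Icc (x₀ - r) (x₀ + r) := ⟨by linarith, by linarith⟩
  have mx2 : x - σ ∈ Icc (x₀ - r) (x₀ + r) := ⟨by linarith, by linarith⟩
  have a1 := abs_le.1 (h.second_diff hx ht hσ hσr)
  have a2 := abs_le.1 (h.second_diff hx hs hσ hσr)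
  have a3 := abs_sub_le_of_hasDerivAt (a := s) (b := t) (B := 2 * lipA K l c r * σ)
    (g := fun t => U (x + σ) t + U (x - σ) t - 2 * U x t)
    (g' := fun t => A (v (x + σ) t) + A (v (x - σ) t) - 2 * A (v x t))
    (fun y hy => by
      have my := mono (uIcc_subset_Icc hs ht hy)
      exact ((h.derivt _ mx1 y my).add (h.derivt _ mx2 y my)).sub
        ((h.derivt _ mx y my).const_mul 2))
    (fun y hy => by
      have my := uIcc_subset_Icc hs ht hy
      have b1 := h.lipschitz_A (x := x + σ) (y := x) (t := y) (by linarith) my.1 my.2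
        (by rw [add_sub_cancel_left, abs_of_pos h0]; linarith)
      have b2 := h.lipschitz_A (x := x - σ) (y := x) (t := y) (by linarith) my.1 my.2
        (by rw [sub_sub_cancel_left, abs_neg, abs_of_pos h0]; linarith)
      rw [add_sub_cancel_left, abs_of_pos h0] at b1
      rw [sub_sub_cancel_left, abs_neg, abs_of_pos h0] at b2
      have b1' := abs_le.1 b1
      have b2' := abs_le.1 b2
      unfold lipA
      rw [abs_le]
      constructor <;> linarith [b1'.1, b1'.2, b2'.1, b2'.2])
  have a4 : 2 * lipA K l c r * σ * |t - s| ≤ 2 * lipA K l c r * σ * σ ^ 2 := by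
    have := h.lipA_pos
    gcongr
  have a5 := abs_le.1 (a3.trans a4)
  have hσ2 : 0 < σ ^ 2 := by positivity
  rw [abs_le]
  constructor
  · refine le_of_mul_le_mul_left ?_ hσ2
    linarith [a1.1, a1.2, a2.1, a2.2, a5.1, a5.2]
  · refine le_of_mul_le_mul_left ?_ hσ2
    linarith [a1.1, a1.2, a2.1, a2.2, a5.1, a5.2]

/-- Parabolic Lipschitz constant of `v` at the vertex of a cylinder. -/
noncomputable def lipP (K l c r : ℝ) : ℝ := 2 * lipA K l c r + 5 * lipV K l c r

theorem CylSol.parabolic_v (h : CylSol α A U u v K l c x₀ t₀ r) {x t ρ : ℝ}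
    (hρ : 0 ≤ ρ) (hρr : ρ ≤ r / 4) (hx : |x - x₀| ≤ ρ) (ht : t₀ - ρ ^ 2 ≤ t) (ht' : t ≤ t₀) :
    |v x t - v x₀ t₀| ≤ lipP K l c r * ρ := by
  have hr := h.pos
  have h1 := h.time_v (x := x) (t := t) (s := t₀) (hx.trans hρr) ⟨by nlinarith, ht'⟩
    ⟨by nlinarith, le_rfl⟩ hρ (by rw [abs_of_nonpos (by linarith)]; linarith) hρr
  have h2 := h.lipschitz_v (x := x) (y := x₀) (t := t₀) (by rw [sub_self, abs_zero]; positivity)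
    (by nlinarith) le_rfl (hx.trans hρr)
  change _ ≤ lipV K l c r * |x - x₀| at h2
  have h3 : lipV K l c r * |x - x₀| ≤ lipV K l c r * ρ :=
    mul_le_mul_of_nonneg_left hx h.lipV_pos.le
  have h4 : v x t - v x₀ t₀ = (v x t - v x t₀) + (v x t₀ - v x₀ t₀) := by ring
  rw [h4]
  refine (abs_add_le _ _).trans ?_
  unfold lipP
  linarith

end

theorem exists_uniform_delta {α : ℝ → ℝ} (hα : Continuous α) (K : ℝ) {ε : ℝ} (hε : 0 < ε) :
    ∃ δ > 0, ∀ p q : ℝ, |p| ≤ K → |q| ≤ K → |p - q| ≤ δ → |α p - α q| ≤ ε := by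
  have h := (isCompact_Icc (a := -K) (b := K)).uniformContinuousOn_of_continuous
    hα.continuousOn
  rw [Metric.uniformContinuousOn_iff] at h
  obtain ⟨δ, hδ, h⟩ := h ε hε
  refine ⟨δ / 2, by positivity, fun p q hp hq hpq => ?_⟩
  have := h p (abs_le.1 hp) q (abs_le.1 hq) (by rw [Real.dist_eq]; linarith)
  rw [Real.dist_eq] at this
  exact this.le

set_option maxHeartbeats 1000000 in
/-- First-order spatial expansion of `A v` on parabolic cylinders. -/
theorem exists_expansion {α : ℝ → ℝ} (hα : Continuous α) {K l c r : ℝ} (hK : 0 ≤ K)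
    (hl : 0 < l) (hc : 0 < c) (hr : 0 < r) : ∃ C r₁ : ℝ, 0 < C ∧ 0 < r₁ ∧ r₁ ≤ r / 4 ∧
    ∀ (A : ℝ → ℝ) (U u v : ℝ → ℝ → ℝ) (x₀ t₀ : ℝ), CylSol α A U u v K l c x₀ t₀ r →
      ∃ n : ℝ, |n| ≤ C ∧ ∀ ρ x t : ℝ, 0 < ρ → ρ ≤ r₁ → |x - x₀| ≤ ρ → t₀ - ρ ^ 2 ≤ t → t ≤ t₀ →
        |A (v x t) - A (v x₀ t₀) - n * (x - x₀)| ≤ C * (ρ * √ρ) := by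
  obtain ⟨η, C₀, hη0, hη1, hC₀, key⟩ := flatness_scaled
  obtain ⟨δ, hδ, hδα⟩ := exists_uniform_delta hα K (mul_pos hl hη0)
  set D := |lipP K l c r| + 1 with hD
  have hD0 : 0 < D := by positivity
  set ρ₀ := min (r / 4) (δ / D) with hρ₀
  have hρ₀0 : 0 < ρ₀ := by positivity
  set m := min 1 (l / 2) with hm
  have hm0 : 0 < m := by positivity
  have hm1 : m ≤ 1 := min_le_left _ _
  have hml : m ≤ l / 2 := min_le_right _ _
  set r₂ := ρ₀ * m with hr₂
  have hr₂0 : 0 < r₂ := by positivity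
  have hr₂1 : r₂ ≤ ρ₀ := by nlinarith
  set c' := max 1 c with hc'
  have hc'1 : 1 ≤ c' := le_max_left _ _
  have hc'c : c ≤ c' := le_max_right _ _
  set M := c * K + 1 with hM
  have hM0 : 0 < M := by positivity
  have hsr : 0 < √r₂ := Real.sqrt_pos.2 hr₂0
  have hsc : 0 < √c' := Real.sqrt_pos.2 (by linarith)
  have hA1 : 0 < C₀ * (M / r₂) := by positivity
  have hA2 : 0 < C₀ * (M / (r₂ * √r₂)) * (c' * √c') := by positivity
  refine ⟨C₀ * (M / r₂) + C₀ * (M / (r₂ * √r₂)) * (c' * √c'), r₂ / c', by positivity,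
    by positivity, ?_, fun A U u v x₀ t₀ h => ?_⟩
  · rw [div_le_iff₀ (by positivity)]
    have : ρ₀ ≤ r / 4 := min_le_left _ _
    nlinarith
  have hself : |v x₀ t₀| ≤ K := h.bound x₀ ⟨by linarith, by linarith⟩ t₀ ⟨by nlinarith, le_rfl⟩
  set a₀ := α (v x₀ t₀) with ha₀
  have ha := h.bdα _ hself
  have ha0 : 0 < a₀ := hl.trans_le ha.1
  have hρ₀r : ρ₀ ≤ r / 4 := min_le_left _ _
  have hρ₀δ : D * ρ₀ ≤ δ := by
    have : ρ₀ ≤ δ / D := min_le_right _ _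
    rw [le_div_iff₀ hD0] at this
    linarith
  have hra : r₂ ^ 2 / a₀ ≤ ρ₀ ^ 2 / 2 := by
    rw [div_le_iff₀ ha0]
    have h1 : m ^ 2 ≤ l / 2 := by nlinarith
    have h2 : l ≤ a₀ := ha.1
    have h3 : 0 < ρ₀ ^ 2 := by positivity
    calc r₂ ^ 2 = ρ₀ ^ 2 * m ^ 2 := by rw [hr₂]; ring
      _ ≤ ρ₀ ^ 2 * (l / 2) := by gcongr
      _ ≤ ρ₀ ^ 2 * (a₀ / 2) := by gcongr
      _ = _ := by ring
  have hsub : Icc (x₀ - r₂) (x₀ + r₂) ⊆ Icc (x₀ - r) (x₀ + r) :=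
    Icc_subset_Icc (by linarith) (by linarith)
  have near : ∀ x t, |x - x₀| ≤ ρ₀ → t₀ - ρ₀ ^ 2 ≤ t → t ≤ t₀ →
      |v x t - v x₀ t₀| ≤ δ ∧ |v x t| ≤ K := fun x t hx ht ht' => by
    have hx' := abs_le.1 hx
    refine ⟨(h.parabolic_v hρ₀0.le hρ₀r hx ht ht').trans (le_trans ?_ hρ₀δ),
      h.bound x ⟨by linarith, by linarith⟩ t ⟨by nlinarith, ht'⟩⟩
    gcongr
    linarith [le_abs_self (lipP K l c r)]
  have hquot : ∀ s ∈ Ioo 0 (ρ₀ ^ 2 / 2), ∃ n : ℝ, |n| ≤ C₀ * (M / r₂) ∧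
      ∀ ρ x t : ℝ, 0 < ρ → ρ ≤ r₂ → |x - x₀| ≤ ρ → t₀ - ρ ^ 2 / a₀ ≤ t → t ≤ t₀ →
        |quot U s x t - quot U s x₀ t₀ - n * (x - x₀)| ≤
          C₀ * (M / (r₂ * √r₂)) * (ρ * √ρ) := by
    intro s hs
    have hT : ∀ t ∈ Icc (t₀ - r₂ ^ 2 / a₀) t₀, t₀ - ρ₀ ^ 2 ≤ t - s ∧ t ≤ t₀ := fun t ht =>
      ⟨by linarith [ht.1, hs.2], ht.2⟩
    have hρr2 : ρ₀ ^ 2 ≤ r ^ 2 := by gcongr; linarith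
    refine key (quot U s) a₀ x₀ t₀ r₂ M ha0 hr₂0 hM0
      ((h.quot_continuousOn (fun t ht => ⟨by linarith [(hT t ht).1], (hT t ht).2⟩) hs.1).mono
        (prod_mono hsub le_rfl))
      (fun x hx t ht => ?_)
      (fun x hx t ht => (h.quot_bound hs.1 (hsub hx) (by linarith [(hT t ht).1])
        (hT t ht).2).trans (by linarith))
    have hT' := hT t (Ioc_subset_Icc_self ht)
    have hxρ : |x - x₀| ≤ ρ₀ := abs_le.2 ⟨by linarith [hx.1], by linarith [hx.2]⟩
    refine h.quot_sol hs.1 ⟨by linarith [hx.1], by linarith [hx.2]⟩ (by linarith [hT'.1]) ht.2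
      fun p hp => ?_
    have n1 := near x t hxρ (by linarith [hs.1, hT'.1]) ht.2
    have n2 := near x (t - s) hxρ hT'.1 (by linarith [hs.1, ht.2])
    have hpK : |p| ≤ K := abs_le.2 (uIcc_subset_Icc (abs_le.1 n2.2) (abs_le.1 n1.2) hp)
    have hpδ : |p - v x₀ t₀| ≤ δ := by
      have e1 := abs_le.1 n1.1
      have e2 := abs_le.1 n2.1
      have : p ∈ Icc (v x₀ t₀ - δ) (v x₀ t₀ + δ) :=
        uIcc_subset_Icc ⟨by linarith, by linarith⟩ ⟨by linarith, by linarith⟩ hp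
      exact abs_le.2 ⟨by linarith [this.1], by linarith [this.2]⟩
    have := abs_le.1 (hδα p _ hpK hself hpδ)
    have hla : l * η ≤ a₀ * η := mul_le_mul_of_nonneg_right ha.1 hη0.le
    constructor <;> linarith [this.1, this.2]
  choose! n hn hn2 using hquot
  set F : Ultrafilter ℝ := Ultrafilter.of (𝓝[>] (0 : ℝ)) with hF
  have hFle : (F : Filter ℝ) ≤ 𝓝[>] 0 := Ultrafilter.of_le _
  have hev : ∀ᶠ s in (F : Filter ℝ), s ∈ Ioo 0 (ρ₀ ^ 2 / 2) :=
    hFle (Ioo_mem_nhdsGT (by positivity))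
  obtain ⟨N, hN, hNt⟩ := exists_ultrafilter_lim F (hev.mono fun s hs => hn s hs)
  refine ⟨N, by linarith, fun ρ x t hρ hρr hx ht ht' => ?_⟩
  have hρ' : ρ * c' ≤ r₂ := (le_div_iff₀ (by positivity)).1 hρr
  have hρρ : ρ ≤ ρ * c' := by nlinarith
  have hρa : ρ ^ 2 ≤ (ρ * c') ^ 2 / a₀ := by
    rw [le_div_iff₀ ha0]
    have : a₀ ≤ c' ^ 2 := by nlinarith [ha.2]
    have h2 : 0 < ρ ^ 2 := by positivity
    nlinarith
  have hx' := abs_le.1 hx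
  have l1 := (h.quot_tendsto (x := x) (t := t) ⟨by linarith, by linarith⟩
    ⟨by nlinarith, ht'⟩).mono_left hFle
  have l2 := (h.quot_tendsto (x := x₀) (t := t₀) ⟨by linarith, by linarith⟩
    ⟨by nlinarith, le_rfl⟩).mono_left hFle
  have l3 := ((l1.sub l2).sub (hNt.mul_const (x - x₀))).abs
  have : |A (v x t) - A (v x₀ t₀) - N * (x - x₀)| ≤
      C₀ * (M / (r₂ * √r₂)) * (ρ * c' * √(ρ * c')) := by
    refine le_of_tendsto l3 (hev.mono fun s hs => ?_)
    exact hn2 s hs (ρ * c') x t (by positivity) hρ' (hx.trans hρρ) (by linarith) ht'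
  refine this.trans ?_
  rw [Real.sqrt_mul hρ.le]
  have h0 : 0 ≤ ρ * √ρ := by positivity
  have : C₀ * (M / (r₂ * √r₂)) * (ρ * c' * (√ρ * √c')) =
      C₀ * (M / (r₂ * √r₂)) * (c' * √c') * (ρ * √ρ) := by ring
  rw [this]
  gcongr
  linarith

/-- Quantitative differentiability on `(a, b) × (d, ∞)` of a solution `u` with slope `v`, where
`n` plays the role of the spatial derivative of `A v`. All fields pass to pointwise limits. -/
structure Expansion (A : ℝ → ℝ) (u v n : ℝ → ℝ → ℝ) (C r a b d : ℝ) : Prop where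
  rpos : 0 < r
  bound_v : ∀ x ∈ Ioo a b, ∀ t, d < t → |v x t| ≤ C
  bound_n : ∀ x ∈ Ioo a b, ∀ t, d < t → |n x t| ≤ C
  space : ∀ x ∈ Ioo a b, ∀ t, d < t → ∀ y, |y - x| ≤ r →
    |u y t - u x t - v x t * (y - x)| ≤ C * (y - x) ^ 2
  flux : ∀ x ∈ Ioo a b, ∀ t, d < t → ∀ ρ y s, 0 ≤ ρ → ρ ≤ r → |y - x| ≤ ρ → t - ρ ^ 2 ≤ s → s ≤ t →
    |A (v y s) - A (v x t) - n x t * (y - x)| ≤ C * (ρ * √ρ)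
  time : ∀ x ∈ Ioo a b, ∀ t ρ, 0 ≤ ρ → ρ ≤ r → d < t - ρ ^ 2 →
    |u x t - u x (t - ρ ^ 2) - n x t * ρ ^ 2| ≤ C * (ρ ^ 2 * √ρ)

theorem sub_slope_le_of_expansions {w : ℝ → ℝ → ℝ} {n n' C r x t x' t' ρ : ℝ} (hC : 0 ≤ C)
    (h : ∀ ρ y s, 0 ≤ ρ → ρ ≤ r → |y - x| ≤ ρ → t - ρ ^ 2 ≤ s → s ≤ t →
      |w y s - w x t - n * (y - x)| ≤ C * (ρ * √ρ))
    (h' : ∀ ρ y s, 0 ≤ ρ → ρ ≤ r → |y - x'| ≤ ρ → t' - ρ ^ 2 ≤ s → s ≤ t' →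
      |w y s - w x' t' - n' * (y - x')| ≤ C * (ρ * √ρ))
    (hρ : 0 < ρ) (hρr : 2 * ρ ≤ r) (hx : |x' - x| ≤ ρ) (ht : t - ρ ^ 2 ≤ t') (ht' : t' ≤ t) :
    |n - n'| ≤ 7 * C * √ρ := by
  have hx' := abs_le.1 hx
  have e1 := h (2 * ρ) (x' + ρ) t' (by positivity) hρr (abs_le.2 ⟨by linarith, by linarith⟩)
    (by nlinarith) ht'
  have e2 := h (2 * ρ) x' t' (by positivity) hρr (abs_le.2 ⟨by linarith, by linarith⟩)
    (by nlinarith) ht'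
  have e3 := h' ρ (x' + ρ) t' hρ.le (by linarith) (by rw [add_sub_cancel_left, abs_of_pos hρ])
    (by nlinarith) le_rfl
  have hs : √(2 * ρ) ≤ 3 / 2 * √ρ := by
    rw [Real.sqrt_mul (by norm_num)]
    gcongr
    exact sqrt_two_lt.le
  have hs' : C * (2 * ρ * √(2 * ρ)) ≤ C * (2 * ρ * (3 / 2 * √ρ)) := by gcongr
  have key : ρ * |n - n'| ≤ ρ * (7 * C * √ρ) := by
    rw [← abs_of_pos hρ, ← abs_mul, abs_of_pos hρ]
    have a1 := abs_le.1 (e1.trans hs')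
    have a2 := abs_le.1 (e2.trans hs')
    have a3 := abs_le.1 e3
    exact abs_le.2 ⟨by linarith [a1.1, a1.2, a2.1, a2.2, a3.1, a3.2],
      by linarith [a1.1, a1.2, a2.1, a2.2, a3.1, a3.2]⟩
  exact le_of_mul_le_mul_left key hρ

theorem CylSol.lipschitz_v' {α A : ℝ → ℝ} {U u v : ℝ → ℝ → ℝ} {K l c x₀ t₀ r x : ℝ}
    (h : CylSol α A U u v K l c x₀ t₀ r) (hx : |x - x₀| ≤ r / 4) :
    |v x t₀ - v x₀ t₀| ≤ lipV K l c r * |x - x₀| := by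
  have hr := h.pos
  exact h.lipschitz_v (by rw [sub_self, abs_zero]; positivity) (by nlinarith) le_rfl hx

theorem CylSol.space_expansion {α A : ℝ → ℝ} {U u v : ℝ → ℝ → ℝ} {K l c x₀ t₀ r x : ℝ}
    (h : CylSol α A U u v K l c x₀ t₀ r) (hx : |x - x₀| ≤ r / 4) :
    |u x t₀ - u x₀ t₀ - v x₀ t₀ * (x - x₀)| ≤ lipV K l c r * (x - x₀) ^ 2 := by
  have hr := h.pos
  have hm : ∀ z ∈ uIcc x₀ x, |z - x₀| ≤ |x - x₀| := fun z hz => abs_sub_left_of_mem_uIcc hz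
  have := abs_sub_le_of_hasDerivAt (g := fun y => u y t₀ - v x₀ t₀ * y)
    (g' := fun y => v y t₀ - v x₀ t₀) (a := x₀) (b := x) (B := lipV K l c r * |x - x₀|)
    (fun z hz => by
      have h1 := abs_le.1 ((hm z hz).trans hx)
      refine ((h.derivu z ⟨by linarith, by linarith⟩ t₀ ⟨by nlinarith, le_rfl⟩).sub
        ((hasDerivAt_id z).const_mul (v x₀ t₀))).congr_deriv ?_
      ring)
    (fun z hz => (h.lipschitz_v' ((hm z hz).trans hx)).trans
      (mul_le_mul_of_nonneg_left (hm z hz) h.lipV_pos.le))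
  rw [mul_assoc, abs_mul_abs_self, ← sq] at this
  convert this using 2
  ring

theorem exists_pkg {α : ℝ → ℝ} (hα : Continuous α) {K l c r : ℝ} (hK : 0 ≤ K)
    (hl : 0 < l) (hc : 0 < c) (hr : 0 < r) : ∃ C r₁ : ℝ, 0 < C ∧ 0 < r₁ ∧
    ∀ (A : ℝ → ℝ) (U u v : ℝ → ℝ → ℝ) (a b d : ℝ),
      (∀ x ∈ Ioo a b, ∀ t, d < t → CylSol α A U u v K l c x t r) →
      ∃ n : ℝ → ℝ → ℝ, Expansion A u v n C r₁ a b d := by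
  obtain ⟨C, r₁, hC, hr₁, hr₁r, key⟩ := exists_expansion hα hK hl hc hr
  refine ⟨7 * C + K + |lipV K l c r|, r₁ / 2, by positivity, by positivity,
    fun A U u v a b d h => ?_⟩
  have hC' : C ≤ 7 * C + K + |lipV K l c r| := by
    linarith [abs_nonneg (lipV K l c r)]
  have hn : ∀ x t, ∃ n, x ∈ Ioo a b → d < t → |n| ≤ C ∧ ∀ ρ y s, 0 ≤ ρ → ρ ≤ r₁ →
      |y - x| ≤ ρ → t - ρ ^ 2 ≤ s → s ≤ t →
      |A (v y s) - A (v x t) - n * (y - x)| ≤ C * (ρ * √ρ) := by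
    intro x t
    by_cases hx : x ∈ Ioo a b ∧ d < t
    · obtain ⟨n, hn, hn'⟩ := key A U u v x t (h x hx.1 t hx.2)
      refine ⟨n, fun _ _ => ⟨hn, fun ρ y s hρ hρr hy hs hs' => ?_⟩⟩
      rcases hρ.eq_or_lt with rfl | hρ
      · have e1 : y = x := by linarith [abs_nonpos_iff.1 hy]
        have e2 : s = t := by linarith
        simp [e1, e2]
      · exact hn' ρ y s hρ hρr hy hs hs'
    · exact ⟨0, fun h1 h2 => (hx ⟨h1, h2⟩).elim⟩
  choose n hn using hn
  have hr₁' : r₁ / 2 ≤ r₁ := by linarith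
  refine ⟨n, by positivity, fun x hx t ht => ?_, fun x hx t ht => (hn x t hx ht).1.trans hC',
    fun x hx t ht y hy => ?_, fun x hx t ht ρ y s hρ hρr hy hs hs' => ?_,
    fun x hx t ρ hρ hρr ht => ?_⟩
  · have hh := h x hx t ht
    exact (hh.bound x ⟨by linarith, by linarith⟩ t ⟨by nlinarith, le_rfl⟩).trans
      (by linarith [abs_nonneg (lipV K l c r)])
  · refine ((h x hx t ht).space_expansion (hy.trans (by linarith))).trans ?_
    gcongr
    linarith [le_abs_self (lipV K l c r)]
  · refine ((hn x t hx ht).2 ρ y s hρ (by linarith) hy hs hs').trans ?_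
    gcongr
  · rcases hρ.eq_or_lt with rfl | hρ
    · simp
    have ht' : d < t := by nlinarith
    have hh := h x hx t ht'
    have hρ2 : t - ρ ^ 2 ∈ Icc (t - r ^ 2) t := ⟨by nlinarith, by nlinarith⟩
    have hnτ : ∀ τ ∈ Icc (t - ρ ^ 2) t, |n x t - n x τ| ≤ 7 * C * √ρ := fun τ hτ =>
      sub_slope_le_of_expansions (w := fun y s => A (v y s)) hC.le (hn x t hx ht').2
        (hn x τ hx (by linarith [hτ.1])).2 hρ (by linarith) (by simpa using hρ.le) hτ.1 hτ.2
    have hF : ∀ y, 0 < y → y ≤ r₁ → |(U (x + y) t - U x t) / y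
        - (U (x + y) (t - ρ ^ 2) - U x (t - ρ ^ 2)) / y - n x t * ρ ^ 2| ≤
        (7 * C * √ρ + C * √y) * ρ ^ 2 := fun y hy hyr => by
      have hm : ∀ τ ∈ uIcc (t - ρ ^ 2) t, τ ∈ Icc (t - ρ ^ 2) t := fun τ hτ => by
        rwa [uIcc_of_le hρ2.2] at hτ
      have := abs_sub_le_of_hasDerivAt (a := t - ρ ^ 2) (b := t)
        (g := fun τ => (U (x + y) τ - U x τ) / y - n x t * τ)
        (g' := fun τ => (A (v (x + y) τ) - A (v x τ)) / y - n x t)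
        (B := 7 * C * √ρ + C * √y)
        (fun τ hτ => by
          have mτ : τ ∈ Icc (t - r ^ 2) t := Icc_subset_Icc hρ2.1 le_rfl (hm τ hτ)
          have d1 := hh.derivt (x + y) ⟨by linarith, by linarith⟩ τ mτ
          have d2 := hh.derivt x ⟨by linarith, by linarith⟩ τ mτ
          refine (((d1.sub d2).div_const y).sub
            ((hasDerivAt_id τ).const_mul (n x t))).congr_deriv ?_
          ring)
        (fun τ hτ => by
          have e := (hn x τ hx (by linarith [(hm τ hτ).1])).2 y (x + y) τ hy.le hyr
            (by rw [add_sub_cancel_left, abs_of_pos hy]) (by nlinarith) le_rfl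
          rw [add_sub_cancel_left] at e
          have e1 : (A (v (x + y) τ) - A (v x τ)) / y - n x t =
              (A (v (x + y) τ) - A (v x τ) - n x τ * y) / y - (n x t - n x τ) := by
            field_simp; ring
          rw [e1]
          refine (abs_sub _ _).trans ?_
          rw [add_comm]
          refine add_le_add (hnτ τ (hm τ hτ)) ?_
          rw [abs_div, abs_of_pos hy, div_le_iff₀ hy]
          linarith)
      rw [sub_sub_cancel, abs_of_nonneg (sq_nonneg ρ)] at this
      convert this using 2
      ring
    have hq : ∀ τ ∈ Icc (t - r ^ 2) t,
        Tendsto (fun y => (U (x + y) τ - U x τ) / y) (𝓝[>] 0) (𝓝 (u x τ)) := fun τ hτ => by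
      have := (hh.derivU x ⟨by linarith, by linarith⟩ τ hτ).tendsto_slope_zero_right
      refine this.congr fun y => ?_
      rw [smul_eq_mul]
      ring
    have hr2 : t ∈ Icc (t - r ^ 2) t := ⟨by nlinarith, le_rfl⟩
    have hlim := (((hq t hr2).sub (hq _ hρ2)).sub_const (n x t * ρ ^ 2)).abs
    have hlim2 : Tendsto (fun y => (7 * C * √ρ + C * √y) * ρ ^ 2) (𝓝[>] 0)
        (𝓝 ((7 * C * √ρ + C * √0) * ρ ^ 2)) :=
      ((continuous_const.add (continuous_const.mul Real.continuous_sqrt)).mul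
        continuous_const).continuousAt.tendsto.mono_left nhdsWithin_le_nhds
    have := le_of_tendsto_of_tendsto hlim hlim2 (by
      filter_upwards [Ioc_mem_nhdsGT hr₁] with y hy using hF y hy.1 hy.2)
    rw [Real.sqrt_zero, mul_zero, add_zero] at this
    refine this.trans ?_
    rw [mul_right_comm, mul_assoc]
    gcongr
    linarith [abs_nonneg (lipV K l c r)]

theorem strictMono_of_deriv_pos' {α A : ℝ → ℝ} (hA : ∀ p, HasDerivAt A (α p) p)
    (hα : ∀ p, 0 < α p) : StrictMono A :=
  strictMono_of_deriv_pos fun p => by rw [(hA p).deriv]; exact hα p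

theorem tendsto_of_tendsto_comp {ι : Type*} {F : Filter ι} {α A : ℝ → ℝ}
    (hA : ∀ p, HasDerivAt A (α p) p) (hα : ∀ p, 0 < α p) {f : ι → ℝ} {p : ℝ}
    (h : Tendsto (fun i => A (f i)) F (𝓝 (A p))) : Tendsto f F (𝓝 p) := by
  have hc : Continuous A := continuous_iff_continuousAt.2 fun p => (hA p).continuousAt
  have he := (strictMono_of_deriv_pos' hA hα).isEmbedding_of_ordConnected
    (isPreconnected_range hc).ordConnected
  exact he.tendsto_nhds_iff.2 h

theorem hasDerivAt_of_comp {α A : ℝ → ℝ} (hα' : Continuous α)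
    (hA : ∀ p, HasDerivAt A (α p) p) (hα : ∀ p, 0 < α p) {f : ℝ → ℝ} {m x : ℝ}
    (hf : HasDerivAt (fun y => A (f y)) m x) : HasDerivAt f (m / α (f x)) x := by
  have hc : Tendsto f (𝓝 x) (𝓝 (f x)) := tendsto_of_tendsto_comp hA hα hf.continuousAt
  choose p hp hp' using fun y => exists_slope hA (f x) (f y)
  have hpt : Tendsto p (𝓝 x) (𝓝 (f x)) := by
    rw [tendsto_iff_norm_sub_tendsto_zero] at hc ⊢
    exact squeeze_zero (fun _ => norm_nonneg _) (fun y => abs_sub_left_of_mem_uIcc (hp y)) hc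
  rw [hasDerivAt_iff_tendsto_slope] at hf ⊢
  have hlim := hf.div (((hα'.tendsto _).comp hpt).mono_left nhdsWithin_le_nhds) (hα (f x)).ne'
  refine hlim.congr fun y => ?_
  have := (hα (p y)).ne'
  simp only [slope_def_field, Pi.div_apply, Function.comp, hp']
  field_simp

theorem hasDerivAt_of_abs_sub_le {f g : ℝ → ℝ} {f' x r : ℝ} (hr : 0 < r)
    (h : ∀ y, |y - x| ≤ r → |f y - f x - f' * (y - x)| ≤ g (y - x) * |y - x|)
    (hg : Tendsto g (𝓝 0) (𝓝 0)) : HasDerivAt f f' x := by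
  rw [hasDerivAt_iff_isLittleO, Asymptotics.isLittleO_iff]
  intro c hc
  have h1 : Tendsto (fun y => g (y - x)) (𝓝 x) (𝓝 0) := by
    refine hg.comp ?_
    have : ContinuousAt (fun y : ℝ => y - x) x := by fun_prop
    simpa [ContinuousAt] using this
  filter_upwards [Metric.closedBall_mem_nhds x hr, h1.eventually_le_const hc] with y hy hy'
  have := h y (by simpa [Real.dist_eq] using hy)
  rw [Real.norm_eq_abs, Real.norm_eq_abs, smul_eq_mul, mul_comm (y - x)]
  exact this.trans (mul_le_mul_of_nonneg_right hy' (abs_nonneg _))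

section
variable {α A : ℝ → ℝ} {u v n : ℝ → ℝ → ℝ} {C r a b d : ℝ}

theorem Expansion.hasDerivAt_u (h : Expansion A u v n C r a b d) {x t : ℝ} (hx : x ∈ Ioo a b)
    (ht : d < t) : HasDerivAt (fun y => u y t) (v x t) x := by
  refine hasDerivAt_of_abs_sub_le (g := fun z => C * |z|) h.rpos (fun y hy => ?_) ?_
  · refine (h.space x hx t ht y hy).trans (le_of_eq ?_)
    rw [mul_assoc, abs_mul_abs_self, sq]
  · have : Continuous fun z : ℝ => C * |z| := by fun_prop
    simpa using this.tendsto 0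

theorem Expansion.hasDerivAt_flux (h : Expansion A u v n C r a b d) {x t : ℝ} (hx : x ∈ Ioo a b)
    (ht : d < t) : HasDerivAt (fun y => A (v y t)) (n x t) x := by
  refine hasDerivAt_of_abs_sub_le (g := fun z => C * √|z|) h.rpos (fun y hy => ?_) ?_
  · refine (h.flux x hx t ht _ y t (abs_nonneg _) hy le_rfl (by nlinarith [sq_nonneg |y - x|])
      le_rfl).trans (le_of_eq (by ring))
  · have : Continuous fun z : ℝ => C * √|z| := by fun_prop
    simpa using this.tendsto 0

theorem Expansion.C_nonneg (h : Expansion A u v n C r a b d) {x t : ℝ} (hx : x ∈ Ioo a b)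
    (ht : d < t) : 0 ≤ C := (abs_nonneg _).trans (h.bound_v x hx t ht)

theorem Expansion.sub_n (h : Expansion A u v n C r a b d) {x t x' t' ρ : ℝ} (hx : x ∈ Ioo a b)
    (ht : d < t) (hx' : x' ∈ Ioo a b) (ht' : d < t') (hρ : 0 < ρ) (hρr : 2 * ρ ≤ r)
    (hxx : |x' - x| ≤ ρ) (htt : |t' - t| ≤ ρ ^ 2) : |n x' t' - n x t| ≤ 7 * C * √ρ := by
  have htt' := abs_le.1 htt
  rcases le_total t' t with hl | hl
  · rw [abs_sub_comm]
    exact sub_slope_le_of_expansions (w := fun y s => A (v y s)) (h.C_nonneg hx ht)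
      (h.flux x hx t ht) (h.flux x' hx' t' ht') hρ hρr hxx (by linarith) hl
  · exact sub_slope_le_of_expansions (w := fun y s => A (v y s)) (h.C_nonneg hx ht)
      (h.flux x' hx' t' ht') (h.flux x hx t ht) hρ hρr (by rwa [abs_sub_comm]) (by linarith) hl

theorem Expansion.sub_flux (h : Expansion A u v n C r a b d) {x t x' t' ρ : ℝ} (hx : x ∈ Ioo a b)
    (ht : d < t) (hx' : x' ∈ Ioo a b) (ht' : d < t') (hρ : 0 ≤ ρ) (hρr : ρ ≤ r)
    (hxx : |x' - x| ≤ ρ) (htt : |t' - t| ≤ ρ ^ 2) :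
    |A (v x' t') - A (v x t)| ≤ C * ρ + C * (ρ * √ρ) := by
  have aux : ∀ x t x' t', x ∈ Ioo a b → d < t → |x' - x| ≤ ρ → t - ρ ^ 2 ≤ t' → t' ≤ t →
      |A (v x' t') - A (v x t)| ≤ C * ρ + C * (ρ * √ρ) := fun x t x' t' hx ht hxx h1 h2 => by
    have e := h.flux x hx t ht ρ x' t' hρ hρr hxx h1 h2
    have e2 : |n x t * (x' - x)| ≤ C * ρ := by
      rw [abs_mul]
      exact mul_le_mul (h.bound_n x hx t ht) hxx (abs_nonneg _) (h.C_nonneg hx ht)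
    have := abs_add_le (A (v x' t') - A (v x t) - n x t * (x' - x)) (n x t * (x' - x))
    rw [sub_add_cancel] at this
    linarith
  have htt' := abs_le.1 htt
  rcases le_total t' t with hl | hl
  · exact aux x t x' t' hx ht hxx (by linarith) hl
  · rw [abs_sub_comm]
    exact aux x' t' x t hx' ht' (by rwa [abs_sub_comm]) (by linarith) hl

theorem Expansion.sub_time (h : Expansion A u v n C r a b d) {x t t' ρ : ℝ} (hx : x ∈ Ioo a b)
    (ht : d < t) (ht' : d < t') (hρ : 0 ≤ ρ) (hρr : ρ ≤ r) (htt : |t' - t| = ρ ^ 2) :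
    |u x t' - u x t| ≤ C * ρ ^ 2 + C * (ρ ^ 2 * √ρ) := by
  have aux : ∀ t, d < t - ρ ^ 2 → |u x t - u x (t - ρ ^ 2)| ≤ C * ρ ^ 2 + C * (ρ ^ 2 * √ρ) := by
    intro t ht
    have e := h.time x hx t ρ hρ hρr ht
    have e2 : |n x t * ρ ^ 2| ≤ C * ρ ^ 2 := by
      rw [abs_mul, abs_of_nonneg (sq_nonneg ρ)]
      exact mul_le_mul_of_nonneg_right (h.bound_n x hx t (by nlinarith)) (sq_nonneg ρ)
    have := abs_add_le (u x t - u x (t - ρ ^ 2) - n x t * ρ ^ 2) (n x t * ρ ^ 2)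
    rw [sub_add_cancel] at this
    linarith
  rcases le_total t' t with hl | hl
  · rw [abs_of_nonpos (by linarith)] at htt
    rw [abs_sub_comm, show t' = t - ρ ^ 2 by linarith]
    exact aux t (by linarith)
  · rw [abs_of_nonneg (by linarith)] at htt
    rw [show t = t' - ρ ^ 2 by linarith]
    exact aux t' (by linarith)

theorem Expansion.sub_space (h : Expansion A u v n C r a b d) {x t y : ℝ} (hx : x ∈ Ioo a b)
    (ht : d < t) (hy : |y - x| ≤ r) : |u y t - u x t| ≤ C * |y - x| + C * |y - x| ^ 2 := by
  have e := h.space x hx t ht y hy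
  have e2 : |v x t * (y - x)| ≤ C * |y - x| := by
    rw [abs_mul]
    exact mul_le_mul_of_nonneg_right (h.bound_v x hx t ht) (abs_nonneg _)
  have := abs_add_le (u y t - u x t - v x t * (y - x)) (v x t * (y - x))
  rw [sub_add_cancel] at this
  rw [sq_abs]
  linarith

theorem continuousAt_of_modulus {f : ℝ × ℝ → ℝ} {p : ℝ × ℝ} {g : ℝ → ℝ} (hg : Continuous g)
    (hg0 : g 0 = 0) (h : ∀ᶠ q in 𝓝 p, |f q - f p| ≤ g (|q.1 - p.1| + √|q.2 - p.2|)) :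
    ContinuousAt f p := by
  rw [ContinuousAt, tendsto_iff_norm_sub_tendsto_zero]
  have hc : Continuous fun q : ℝ × ℝ => g (|q.1 - p.1| + √|q.2 - p.2|) := by fun_prop
  have := hc.tendsto p
  simp only [sub_self, abs_zero, Real.sqrt_zero, add_zero, hg0] at this
  exact squeeze_zero' (Eventually.of_forall fun _ => norm_nonneg _) h this

theorem Expansion.eventually_near (h : Expansion A u v n C r a b d) {x t : ℝ}
    (hx : x ∈ Ioo a b) (ht : d < t) : ∀ᶠ q : ℝ × ℝ in 𝓝 (x, t), q.1 ∈ Ioo a b ∧ d < q.2 ∧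
      2 * (|q.1 - x| + √|q.2 - t|) ≤ r ∧ |q.2 - t| ≤ (|q.1 - x| + √|q.2 - t|) ^ 2 := by
  have h1 : ∀ᶠ q : ℝ × ℝ in 𝓝 (x, t), q.1 ∈ Ioo a b :=
    continuous_fst.continuousAt.eventually_mem (Ioo_mem_nhds hx.1 hx.2)
  have h2 : ∀ᶠ q : ℝ × ℝ in 𝓝 (x, t), q.2 ∈ Ioi d :=
    continuous_snd.continuousAt.eventually_mem (Ioi_mem_nhds ht)
  have hc : Continuous fun q : ℝ × ℝ => 2 * (|q.1 - x| + √|q.2 - t|) := by fun_prop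
  have h3 := (hc.tendsto (x, t)).eventually_le_const (u := r) (by simpa using h.rpos)
  filter_upwards [h1, h2, h3] with q h1 h2 h3
  refine ⟨h1, h2, h3, ?_⟩
  have e := Real.sq_sqrt (abs_nonneg (q.2 - t))
  nlinarith [abs_nonneg (q.1 - x), Real.sqrt_nonneg |q.2 - t|,
    mul_nonneg (abs_nonneg (q.1 - x)) (Real.sqrt_nonneg |q.2 - t|)]

theorem Expansion.continuousAt_n (h : Expansion A u v n C r a b d) {x t : ℝ} (hx : x ∈ Ioo a b)
    (ht : d < t) : ContinuousAt (fun p : ℝ × ℝ => n p.1 p.2) (x, t) := by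
  refine continuousAt_of_modulus (g := fun ρ => 7 * C * √ρ) (by fun_prop) (by simp) ?_
  filter_upwards [h.eventually_near hx ht] with q hq
  obtain ⟨h1, h2, h3, h4⟩ := hq
  rcases (add_nonneg (abs_nonneg (q.1 - x)) (Real.sqrt_nonneg |q.2 - t|)).eq_or_lt with h0 | h0
  · rw [← h0] at h4
    have e1 : |q.1 - x| ≤ 0 := by linarith [Real.sqrt_nonneg |q.2 - t|]
    have e1 := abs_nonpos_iff.1 e1
    have e2 : q.2 - t = 0 := abs_nonpos_iff.1 (by linarith)
    rw [show q.1 = x by linarith, show q.2 = t by linarith]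
    simp
  · exact h.sub_n hx ht h1 h2 h0 h3 (by linarith [Real.sqrt_nonneg |q.2 - t|]) h4

theorem Expansion.continuousAt_v (h : Expansion A u v n C r a b d)
    (hA : ∀ p, HasDerivAt A (α p) p) (hα : ∀ p, 0 < α p) {x t : ℝ} (hx : x ∈ Ioo a b)
    (ht : d < t) : ContinuousAt (fun p : ℝ × ℝ => v p.1 p.2) (x, t) := by
  refine tendsto_of_tendsto_comp hA hα ?_
  refine continuousAt_of_modulus (f := fun p : ℝ × ℝ => A (v p.1 p.2)) (p := (x, t))
    (g := fun ρ => C * ρ + C * (ρ * √ρ)) (by fun_prop) (by simp) ?_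
  filter_upwards [h.eventually_near hx ht] with q hq
  obtain ⟨h1, h2, h3, h4⟩ := hq
  have h0 := add_nonneg (abs_nonneg (q.1 - x)) (Real.sqrt_nonneg |q.2 - t|)
  exact h.sub_flux hx ht h1 h2 h0 (by linarith) (by linarith [Real.sqrt_nonneg |q.2 - t|]) h4

theorem Expansion.continuousAt_u (h : Expansion A u v n C r a b d) {x t : ℝ} (hx : x ∈ Ioo a b)
    (ht : d < t) : ContinuousAt (fun p : ℝ × ℝ => u p.1 p.2) (x, t) := by
  refine continuousAt_of_modulus
    (g := fun ρ => (C * ρ + C * ρ ^ 2) + (C * ρ ^ 2 + C * (ρ ^ 2 * √ρ))) (by fun_prop) (by simp) ?_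
  filter_upwards [h.eventually_near hx ht] with q hq
  obtain ⟨h1, h2, h3, h4⟩ := hq
  have hC := h.C_nonneg hx ht
  have k1 := abs_nonneg (q.1 - x)
  have k2 := Real.sqrt_nonneg |q.2 - t|
  have e1 := h.sub_space hx h2 (y := q.1) (by linarith)
  have e2 := h.sub_time hx ht h2 k2 (by linarith) (Real.sq_sqrt (abs_nonneg _)).symm
  have := abs_add_le (u q.1 q.2 - u x q.2) (u x q.2 - u x t)
  rw [sub_add_sub_cancel] at this
  refine this.trans (add_le_add (e1.trans ?_) (e2.trans ?_)) <;> gcongr <;> linarith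

theorem Expansion.hasDerivAt_time (h : Expansion A u v n C r a b d) {x t : ℝ} (hx : x ∈ Ioo a b)
    (ht : d < t) : HasDerivAt (fun s => u x s) (n x t) t := by
  have hr := h.rpos
  have hC := h.C_nonneg hx ht
  refine hasDerivAt_of_abs_sub_le (g := fun z => 8 * C * √√|z|)
    (r := min (r ^ 2 / 4) ((t - d) / 2))
    (lt_min (by positivity) (by linarith)) (fun s hs => ?_) ?_
  · set ρ := √|s - t| with hρ
    have hρ0 : 0 ≤ ρ := Real.sqrt_nonneg _
    have hρ2 : ρ ^ 2 = |s - t| := Real.sq_sqrt (abs_nonneg _)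
    have hs1 := hs.trans (min_le_left _ _)
    have hs2 := hs.trans (min_le_right _ _)
    have hs3 := abs_le.1 hs2
    have hρr : 2 * ρ ≤ r := by
      rw [← hρ2] at hs1
      nlinarith
    have hds : d < s := by linarith
    rcases le_total s t with hl | hl
    · have e : s - t = -ρ ^ 2 := by rw [hρ2, abs_of_nonpos (by linarith)]; ring
      have := h.time x hx t ρ hρ0 (by linarith) (by linarith)
      rw [show t - ρ ^ 2 = s by linarith] at this
      rw [abs_sub_comm, e, ← e, ← hρ2]
      rw [e, show n x t * -ρ ^ 2 - (u x s - u x t) = u x t - u x s - n x t * ρ ^ 2 by ring]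
      refine this.trans ?_
      have : 0 ≤ C * (ρ ^ 2 * √ρ) := by positivity
      linarith
    · have e : s - t = ρ ^ 2 := by rw [hρ2, abs_of_nonneg (by linarith)]
      have h1 := h.time x hx s ρ hρ0 (by linarith) (by linarith)
      rw [show s - ρ ^ 2 = t by linarith] at h1
      rcases hρ0.eq_or_lt with h0 | h0
      · rw [← h0] at e
        have : s = t := by linarith
        simp [this]
      have h2 := h.sub_n hx ht hx hds h0 hρr (by simpa using hρ0) (by rw [hρ2])
      rw [← hρ2, e]
      have h3 : |(n x s - n x t) * ρ ^ 2| ≤ 7 * C * √ρ * ρ ^ 2 := by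
        rw [abs_mul, abs_of_nonneg (sq_nonneg ρ)]
        gcongr
      have := abs_add_le (u x s - u x t - n x s * ρ ^ 2) ((n x s - n x t) * ρ ^ 2)
      rw [show u x s - u x t - n x s * ρ ^ 2 + (n x s - n x t) * ρ ^ 2 =
        u x s - u x t - n x t * ρ ^ 2 by ring] at this
      linarith
  · have : Continuous fun z : ℝ => 8 * C * √√|z| := by fun_prop
    simpa using this.tendsto 0

end

/-- Expansions with uniform constants survive pointwise limits. -/
theorem Expansion.of_tendsto {ι : Type*} {F : Filter ι} [F.NeBot] {A : ℝ → ℝ} (hA : Continuous A)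
    {C r a b d : ℝ} {ui vi ni : ι → ℝ → ℝ → ℝ} {u v n : ℝ → ℝ → ℝ} {S : Set ℝ}
    (hE : ∀ᶠ i in F, Expansion A (ui i) (vi i) (ni i) C r a b d)
    (hS : ∀ x ∈ Ioo a b, ∀ y, |y - x| ≤ r → y ∈ S) (hd : 0 ≤ d) (hdr : r ^ 2 ≤ d)
    (hu : ∀ x ∈ S, ∀ t, 0 < t → Tendsto (fun i => ui i x t) F (𝓝 (u x t)))
    (hv : ∀ x ∈ S, ∀ t, 0 < t → Tendsto (fun i => vi i x t) F (𝓝 (v x t)))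
    (hn : ∀ x ∈ Ioo a b, ∀ t, d < t → Tendsto (fun i => ni i x t) F (𝓝 (n x t))) :
    Expansion A u v n C r a b d := by
  obtain ⟨i, hi⟩ := hE.exists
  have hr := hi.rpos
  have hS' : ∀ x ∈ Ioo a b, x ∈ S := fun x hx => hS x hx x (by simpa using hr.le)
  refine ⟨hr, fun x hx t ht => ?_, fun x hx t ht => ?_, fun x hx t ht y hy => ?_,
    fun x hx t ht ρ y s hρ hρr hy hs hs' => ?_, fun x hx t ρ hρ hρr ht => ?_⟩
  · exact le_of_tendsto (hv x (hS' x hx) t (by linarith)).abs (hE.mono fun i h => h.bound_v x hx t ht)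
  · exact le_of_tendsto (hn x hx t ht).abs (hE.mono fun i h => h.bound_n x hx t ht)
  · exact le_of_tendsto (((hu y (hS x hx y hy) t (by linarith)).sub
      (hu x (hS' x hx) t (by linarith))).sub
      ((hv x (hS' x hx) t (by linarith)).mul_const _)).abs (hE.mono fun i h => h.space x hx t ht y hy)
  · have hs0 : 0 < s := by nlinarith
    exact le_of_tendsto ((((hA.tendsto _).comp (hv y (hS x hx y (hy.trans hρr)) s hs0)).sub
      ((hA.tendsto _).comp (hv x (hS' x hx) t (by linarith)))).sub ((hn x hx t ht).mul_const _)).abs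
      (hE.mono fun i h => h.flux x hx t ht ρ y s hρ hρr hy hs hs')
  · have ht' : d < t := by nlinarith
    exact le_of_tendsto (((hu x (hS' x hx) t (by linarith)).sub
      (hu x (hS' x hx) _ (by linarith))).sub ((hn x hx t ht').mul_const _)).abs
      (hE.mono fun i h => h.time x hx t ρ hρ hρr ht)

/-- Forward difference quotient of a grid function. -/
noncomputable def gridSlope (h : ℝ) (u : ℕ → ℝ) (i : ℕ) : ℝ := (u (i + 1) - u i) / h

/-- Discrete version of `∂ₓ (A (∂ₓ u))` at the interior nodes of a grid with `N` cells, extended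
by zero. -/
noncomputable def gridVel (A : ℝ → ℝ) (h : ℝ) (N : ℕ) (u : ℕ → ℝ) : ℕ → ℝ
  | 0 => 0
  | i + 1 => if i + 1 < N then (A (gridSlope h u (i + 1)) - A (gridSlope h u i)) / h else 0

/-- Explicit Euler scheme. -/
noncomputable def scheme (A : ℝ → ℝ) (h τ : ℝ) (N : ℕ) (f : ℕ → ℝ) : ℕ → ℕ → ℝ
  | 0 => f
  | n + 1 => fun i => scheme A h τ N f n i + τ * gridVel A h N (scheme A h τ N f n) i

/-- The bounds that the scheme propagates. -/
structure GridBound (A : ℝ → ℝ) (h : ℝ) (N : ℕ) (K B : ℝ) (u : ℕ → ℝ) : Prop where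
  slope : ∀ i < N, |gridSlope h u i| ≤ K
  vel : ∀ i, gridVel A h N u i ∈ Icc (-B) 0

theorem gridVel_of_le {A : ℝ → ℝ} {h : ℝ} {N : ℕ} {u : ℕ → ℝ} {i : ℕ} (hi : N ≤ i) :
    gridVel A h N u i = 0 := by
  cases i with
  | zero => rfl
  | succ i => exact if_neg (by omega)

theorem gridVel_succ {A : ℝ → ℝ} {h : ℝ} {N : ℕ} {u : ℕ → ℝ} {i : ℕ} (hi : i + 1 < N) :
    gridVel A h N u (i + 1) = (A (gridSlope h u (i + 1)) - A (gridSlope h u i)) / h := if_pos hi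

/-- Ellipticity on the range `[-K, K]` of slopes, and the stability condition. -/
structure GridParam (α A : ℝ → ℝ) (K l c h τ : ℝ) : Prop where
  derivA : ∀ p, HasDerivAt A (α p) p
  lpos : 0 < l
  bdα : ∀ p, |p| ≤ K → α p ∈ Icc l c
  hpos : 0 < h
  τpos : 0 < τ
  stable : 2 * c * τ ≤ h ^ 2

section
variable {α A : ℝ → ℝ} {K l c h τ : ℝ}

theorem GridParam.exists_slope (P : GridParam α A K l c h τ) {p q : ℝ} (hp : |p| ≤ K)
    (hq : |q| ≤ K) : ∃ m ∈ Icc l c, A q - A p = m * (q - p) := by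
  obtain ⟨z, hz, e⟩ := PsiPlus.exists_slope P.derivA p q
  exact ⟨α z, P.bdα z (abs_le.2 (uIcc_subset_Icc (abs_le.1 hp) (abs_le.1 hq) hz)), e⟩

theorem GridParam.coef_mem (P : GridParam α A K l c h τ) {m : ℝ} (hm : m ∈ Icc l c) :
    τ * m / h ^ 2 ∈ Icc 0 (1 / 2 : ℝ) := by
  have h1 := P.lpos
  have h2 := P.hpos
  have h3 := P.τpos
  have h4 := P.stable
  have h5 : 0 < m := h1.trans_le hm.1
  refine ⟨by positivity, ?_⟩
  rw [div_le_iff₀ (by positivity)]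
  nlinarith [hm.2]

theorem GridParam.flux_coef (P : GridParam α A K l c h τ) {N : ℕ} {B : ℝ} {u : ℕ → ℝ}
    (hu : GridBound A h N K B u) {i : ℕ} (hi : i + 1 < N) : ∃ θ ∈ Icc 0 (1 / 2 : ℝ),
      τ * gridVel A h N u (i + 1) / h = θ * (gridSlope h u (i + 1) - gridSlope h u i) := by
  obtain ⟨m, hm, e⟩ := P.exists_slope (hu.slope i (by omega)) (hu.slope (i + 1) hi)
  refine ⟨_, P.coef_mem hm, ?_⟩
  have := P.hpos.ne'
  rw [gridVel_succ hi, e]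
  field_simp

theorem gridSlope_add {u w : ℕ → ℝ} (hh : h ≠ 0) (i : ℕ) :
    gridSlope h (fun i => u i + τ * w i) i =
      gridSlope h u i + (τ * w (i + 1) / h - τ * w i / h) := by
  unfold gridSlope
  field_simp
  ring

theorem GridBound.step {N : ℕ} {B : ℝ} {u : ℕ → ℝ} (hu : GridBound A h N K B u)
    (P : GridParam α A K l c h τ) :
    GridBound A h N K B (fun i => u i + τ * gridVel A h N u i) := by
  have hh := P.hpos.ne'
  have hslope : ∀ i < N, |gridSlope h (fun i => u i + τ * gridVel A h N u i) i| ≤ K := by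
    intro i hi
    rw [gridSlope_add hh]
    have hai := abs_le.1 (hu.slope i hi)
    have h1 : τ * gridVel A h N u (i + 1) / h ∈
        Icc (-((K + gridSlope h u i) / 2)) ((K - gridSlope h u i) / 2) := by
      by_cases hi1 : i + 1 < N
      · obtain ⟨θ, hθ, e⟩ := P.flux_coef hu hi1
        have hb := abs_le.1 (hu.slope _ hi1)
        rw [e]
        constructor <;> nlinarith [hθ.1, hθ.2, hai.1, hai.2, hb.1, hb.2]
      · rw [gridVel_of_le (by omega), mul_zero, zero_div]
        constructor <;> linarith
    have h2 : -(τ * gridVel A h N u i / h) ∈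
        Icc (-((K + gridSlope h u i) / 2)) ((K - gridSlope h u i) / 2) := by
      cases i with
      | zero =>
        rw [gridVel, mul_zero, zero_div]
        constructor <;> linarith
      | succ i =>
        obtain ⟨θ, hθ, e⟩ := P.flux_coef hu hi
        have hb := abs_le.1 (hu.slope i (by omega))
        rw [e]
        constructor <;> nlinarith [hθ.1, hθ.2, hai.1, hai.2, hb.1, hb.2]
    exact abs_le.2 ⟨by linarith [h1.1, h2.1], by linarith [h1.2, h2.2]⟩
  refine ⟨hslope, fun i => ?_⟩
  have hB : 0 ≤ B := by linarith [(hu.vel 0).1, (hu.vel 0).2]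
  by_cases hi : N ≤ i
  · rw [gridVel_of_le hi]
    exact ⟨by linarith, le_rfl⟩
  cases i with
  | zero => exact ⟨by rw [gridVel]; linarith, le_rfl⟩
  | succ i =>
    have hi1 : i + 1 < N := by omega
    have hi0 : i < N := by omega
    obtain ⟨m, hm, e⟩ := P.exists_slope (hu.slope _ hi1) (hslope _ hi1)
    obtain ⟨m', hm', e'⟩ := P.exists_slope (hu.slope _ hi0) (hslope _ hi0)
    have key : gridVel A h N (fun i => u i + τ * gridVel A h N u i) (i + 1) =
        gridVel A h N u (i + 1) +
        τ * m / h ^ 2 * (gridVel A h N u (i + 1 + 1) - gridVel A h N u (i + 1)) -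
        τ * m' / h ^ 2 * (gridVel A h N u (i + 1) - gridVel A h N u i) := by
      rw [gridVel_succ hi1]
      have e2 := gridVel_succ (A := A) (h := h) (u := u) hi1
      rw [gridSlope_add hh] at e e'
      rw [gridSlope_add hh, gridSlope_add hh]
      have e3 : A (gridSlope h u (i + 1)) - A (gridSlope h u i) =
          h * gridVel A h N u (i + 1) := by rw [e2]; field_simp
      have e4 := sub_eq_iff_eq_add.1 e
      have e5 := sub_eq_iff_eq_add.1 e'
      rw [e4, e5]
      have e6 : A (gridSlope h u (i + 1)) =
          h * gridVel A h N u (i + 1) + A (gridSlope h u i) := by linarith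
      rw [e6]
      field_simp
      ring
    rw [key]
    have hθ := P.coef_mem hm
    have hθ' := P.coef_mem hm'
    have v1 := hu.vel i
    have v2 := hu.vel (i + 1)
    have v3 := hu.vel (i + 1 + 1)
    constructor <;> nlinarith [hθ.1, hθ.2, hθ'.1, hθ'.2, v1.1, v1.2, v2.1, v2.2, v3.1, v3.2]

theorem GridBound.scheme {N : ℕ} {B : ℝ} {f : ℕ → ℝ} (hf : GridBound A h N K B f)
    (P : GridParam α A K l c h τ) (n : ℕ) : GridBound A h N K B (scheme A h τ N f n) := by
  induction n with
  | zero => exact hf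
  | succ n ih => exact ih.step P

theorem GridBound.slope_step {N : ℕ} {B : ℝ} {u : ℕ → ℝ} (hu : GridBound A h N K B u)
    (P : GridParam α A K l c h τ) {i : ℕ} (hi : i + 1 < N) :
    gridSlope h u i - gridSlope h u (i + 1) ∈ Icc 0 (B / l * h) := by
  obtain ⟨m, hm, e⟩ := P.exists_slope (hu.slope i (by omega)) (hu.slope (i + 1) hi)
  have hh := P.hpos
  have hl := P.lpos
  have hv := hu.vel (i + 1)
  rw [gridVel_succ hi, e] at hv
  have h1 := (le_div_iff₀ hh).1 hv.1
  have h2 := (div_le_iff₀ hh).1 hv.2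
  have hm0 : 0 < m := hl.trans_le hm.1
  have h3 : 0 ≤ gridSlope h u i - gridSlope h u (i + 1) := by nlinarith
  refine ⟨h3, ?_⟩
  rw [div_mul_eq_mul_div, le_div_iff₀ hl]
  nlinarith [hm.1]

theorem GridBound.slope_sub {N : ℕ} {B : ℝ} {u : ℕ → ℝ} (hu : GridBound A h N K B u)
    (P : GridParam α A K l c h τ) {i k : ℕ} (hi : i + k < N) :
    gridSlope h u i - gridSlope h u (i + k) ∈ Icc 0 (B / l * (k * h)) := by
  induction k with
  | zero => simp
  | succ k ih =>
    have h1 := ih (by omega)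
    have h2 := hu.slope_step P (i := i + k) (by omega)
    rw [← add_assoc]
    push_cast
    constructor
    · linarith [h1.1, h2.1]
    · linarith [h1.2, h2.2]

theorem grid_succ (hh : h ≠ 0) (u : ℕ → ℝ) (i : ℕ) : u (i + 1) = u i + h * gridSlope h u i := by
  unfold gridSlope
  field_simp
  ring

theorem GridBound.sub_le {N : ℕ} {B : ℝ} {u : ℕ → ℝ} (hu : GridBound A h N K B u)
    (P : GridParam α A K l c h τ) {i k : ℕ} (hi : i + k ≤ N) : |u (i + k) - u i| ≤ K * (k * h) := by
  have hh := P.hpos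
  induction k with
  | zero => simp
  | succ k ih =>
    have h1 := abs_le.1 (ih (by omega))
    have h2 := abs_le.1 (hu.slope (i + k) (by omega))
    rw [← add_assoc, grid_succ hh.ne' u]
    push_cast
    exact abs_le.2 ⟨by nlinarith, by nlinarith⟩

theorem GridBound.taylor {N : ℕ} {B : ℝ} {u : ℕ → ℝ} (hu : GridBound A h N K B u)
    (P : GridParam α A K l c h τ) {i k : ℕ} (hi : i + k ≤ N) :
    u (i + k) - u i - gridSlope h u i * (k * h) ∈ Icc (-(B / l * (k * h) ^ 2)) 0 := by
  have hh := P.hpos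
  have hB : 0 ≤ B := by linarith [(hu.vel 0).1, (hu.vel 0).2]
  have hBl : 0 ≤ B / l := div_nonneg hB P.lpos.le
  induction k with
  | zero => simp
  | succ k ih =>
    have h1 := ih (by omega)
    have h2 := hu.slope_sub P (i := i) (k := k) (by omega)
    rw [← add_assoc, grid_succ hh.ne' u]
    push_cast
    have h3 := mul_le_mul_of_nonneg_left h2.1 hh.le
    have h4 := mul_le_mul_of_nonneg_left h2.2 hh.le
    have h5 : 0 ≤ B / l * h ^ 2 * (k + 1) := by positivity
    constructor
    · nlinarith [h1.1]
    · nlinarith [h1.2]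

theorem GridBound.slope_le {N : ℕ} {B : ℝ} {u : ℕ → ℝ} (hu : GridBound A h N K B u)
    (P : GridParam α A K l c h τ) {i k : ℕ} (hi : i + k < N) :
    gridSlope h u (i + k) * (k * h) ≤ u (i + k) - u i := by
  have hh := P.hpos
  induction k with
  | zero => simp
  | succ k ih =>
    have h1 := ih (by omega)
    have h2 := (hu.slope_step P (i := i + k) (by omega)).1
    rw [← add_assoc, grid_succ hh.ne' u]
    rw [add_assoc] at h2 ⊢
    push_cast
    have h3 : (k + 1) * h * (gridSlope h u (i + k) - gridSlope h u (i + (k + 1))) ≥ 0 := by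
      positivity
    nlinarith

theorem scheme_time {N : ℕ} {B : ℝ} {f : ℕ → ℝ} (hf : GridBound A h N K B f)
    (P : GridParam α A K l c h τ) (n k i : ℕ) :
    scheme A h τ N f (n + k) i - scheme A h τ N f n i ∈ Icc (-(B * (k * τ))) 0 := by
  have hτ := P.τpos
  induction k with
  | zero => simp
  | succ k ih =>
    have h1 := (hf.scheme P (n + k)).vel i
    rw [← add_assoc, PsiPlus.scheme]
    push_cast
    constructor
    · nlinarith [h1.1, ih.1]
    · nlinarith [h1.2, ih.2]

theorem scheme_boundary {N : ℕ} {f : ℕ → ℝ} (n : ℕ) :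
    scheme A h τ N f n 0 = f 0 ∧ scheme A h τ N f n N = f N := by
  induction n with
  | zero => exact ⟨rfl, rfl⟩
  | succ n ih =>
    rw [scheme]
    exact ⟨by simp [ih.1, gridVel], by simp [ih.2, gridVel_of_le le_rfl]⟩

/-- Discrete stream function of the scheme. -/
noncomputable def stream (A : ℝ → ℝ) (h τ : ℝ) (N : ℕ) (f : ℕ → ℝ) (n i : ℕ) : ℝ :=
  h * ∑ j ∈ Finset.range i, scheme A h τ N f n j +
    τ * ∑ k ∈ Finset.range n, A (gridSlope h (scheme A h τ N f k) 0)

theorem stream_space {N : ℕ} {B : ℝ} {f : ℕ → ℝ} (hf : GridBound A h N K B f)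
    (P : GridParam α A K l c h τ) (n : ℕ) {i k : ℕ} (hi : i + k ≤ N) :
    |stream A h τ N f n (i + k) - stream A h τ N f n i - scheme A h τ N f n i * (k * h)| ≤
      K * (k * h) ^ 2 := by
  have hh := P.hpos
  induction k with
  | zero => simp
  | succ k ih =>
    have h1 := abs_le.1 (ih (by omega))
    have h2 := abs_le.1 ((hf.scheme P n).sub_le P (i := i) (k := k) (by omega))
    have hK : 0 ≤ K := (abs_nonneg _).trans (hf.slope 0 (by omega))
    have e : stream A h τ N f n (i + (k + 1)) = stream A h τ N f n (i + k) +
        h * scheme A h τ N f n (i + k) := by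
      unfold stream
      rw [← add_assoc, Finset.sum_range_succ]
      ring
    rw [e]
    push_cast
    have h5 : 0 ≤ K * h ^ 2 * (k + 1) := by positivity
    have h3 := mul_le_mul_of_nonneg_left h2.1 hh.le
    have h4 := mul_le_mul_of_nonneg_left h2.2 hh.le
    exact abs_le.2 ⟨by nlinarith, by nlinarith⟩

theorem stream_succ_time (hh : h ≠ 0) {N : ℕ} {f : ℕ → ℝ} (n : ℕ) {i : ℕ} (hi : i < N) :
    stream A h τ N f (n + 1) (i + 1) - stream A h τ N f n (i + 1) =
      τ * A (gridSlope h (scheme A h τ N f n) i) := by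
  have e : ∀ i < N, h * ∑ j ∈ Finset.range (i + 1), gridVel A h N (scheme A h τ N f n) j =
      A (gridSlope h (scheme A h τ N f n) i) - A (gridSlope h (scheme A h τ N f n) 0) := by
    intro i hi
    induction i with
    | zero => simp [gridVel]
    | succ i ih =>
      rw [Finset.sum_range_succ, mul_add, ih (by omega), gridVel_succ hi]
      field_simp
      ring
  have e1 := e i hi
  unfold stream
  rw [Finset.sum_range_succ (n := n)]
  simp only [scheme, Finset.sum_add_distrib, ← Finset.mul_sum]
  linear_combination τ * e1

theorem stream_time {N : ℕ} {B : ℝ} {f : ℕ → ℝ} (hf : GridBound A h N K B f)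
    (P : GridParam α A K l c h τ) (n : ℕ) {i j k : ℕ} (hij : i + 1 + j < N) :
    |stream A h τ N f (n + k) (i + 1) - stream A h τ N f n (i + 1) -
        A (gridSlope h (scheme A h τ N f n) (i + 1)) * (k * τ)| * (j * h) ≤
      c * (k * τ) * (B / l * (j * h) ^ 2 + B * (k * τ) + B / l * h * (j * h)) := by
  have hh := P.hpos
  have hτ := P.τpos
  have hl := P.lpos
  have hB : 0 ≤ B := by linarith [(hf.vel 0).1, (hf.vel 0).2]
  have hc : 0 ≤ c := by
    have := P.bdα _ (hf.slope 0 (by omega))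
    linarith [this.1, this.2]
  set E := B / l * (j * h) ^ 2 + B * (k * τ) + B / l * h * (j * h) with hE
  have hE0 : 0 ≤ E := by positivity
  have key : ∀ q ≤ k, |A (gridSlope h (scheme A h τ N f (n + q)) i) -
      A (gridSlope h (scheme A h τ N f n) (i + 1))| * (j * h) ≤ c * E := by
    intro q hq
    have g := hf.scheme P n
    have g' := hf.scheme P (n + q)
    obtain ⟨m, hm, e⟩ := P.exists_slope (g.slope (i + 1) (by omega)) (g'.slope i (by omega))
    have hm0 : 0 ≤ m := hl.le.trans hm.1
    rw [e, abs_mul, abs_of_nonneg hm0, mul_assoc]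
    refine mul_le_mul hm.2 ?_ (by positivity) hc
    have t1 := g.taylor P (i := i + 1) (k := j) hij.le
    have t2 := g'.taylor P (i := i + 1) (k := j) hij.le
    have t3 := scheme_time hf P n q (i + 1)
    have t4 := scheme_time hf P n q (i + 1 + j)
    have t5 := g'.slope_step P (i := i) (by omega)
    have hqk : B * (q * τ) ≤ B * (k * τ) := by gcongr
    have hjh : 0 ≤ (j : ℝ) * h := by positivity
    rw [← abs_of_nonneg hjh, ← abs_mul, hE]
    have t6 := mul_le_mul_of_nonneg_right t5.1 hjh
    have t7 := mul_le_mul_of_nonneg_right t5.2 hjh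
    exact abs_le.2 ⟨by linarith [t1.1, t1.2, t2.1, t2.2, t3.1, t3.2, t4.1, t4.2],
      by linarith [t1.1, t1.2, t2.1, t2.2, t3.1, t3.2, t4.1, t4.2]⟩
  have ind : ∀ q ≤ k, |stream A h τ N f (n + q) (i + 1) - stream A h τ N f n (i + 1) -
      A (gridSlope h (scheme A h τ N f n) (i + 1)) * (q * τ)| * (j * h) ≤ c * (q * τ) * E := by
    intro q
    induction q with
    | zero => simp
    | succ q ih =>
      intro hq
      have h1 := ih (by omega)
      have h2 := key q (by omega)
      have h3 := stream_succ_time (A := A) (τ := τ) hh.ne' (f := f) (n + q) (i := i) (N := N)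
        (by omega)
      rw [← add_assoc, show stream A h τ N f (n + q + 1) (i + 1) - stream A h τ N f n (i + 1) -
          A (gridSlope h (scheme A h τ N f n) (i + 1)) * ((q + 1 : ℕ) * τ) =
          (stream A h τ N f (n + q) (i + 1) - stream A h τ N f n (i + 1) -
          A (gridSlope h (scheme A h τ N f n) (i + 1)) * (q * τ)) +
          τ * (A (gridSlope h (scheme A h τ N f (n + q)) i) -
            A (gridSlope h (scheme A h τ N f n) (i + 1))) by
        push_cast
        linear_combination h3]
      refine (mul_le_mul_of_nonneg_right (abs_add_le _ _) (by positivity)).trans ?_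
      rw [abs_mul, abs_of_pos hτ, add_mul, mul_assoc τ]
      push_cast
      nlinarith [mul_le_mul_of_nonneg_left h2 hτ.le]
  exact ind k le_rfl

end

/-- Estimates satisfied by interpolated grid functions, `g` and `θ` being the roundings in space
and time; their limits satisfy the same estimates with `h = 0` and `g`, `θ` the identity. -/
structure Interp (A f : ℝ → ℝ) (ℓ K B l c h : ℝ) (g θ : ℝ → ℝ) (U u v : ℝ → ℝ → ℝ) : Prop where
  bound_v : ∀ x ∈ Ico 0 ℓ, ∀ t, 0 ≤ t → |v x t| ≤ K
  lip : ∀ x y t, 0 ≤ x → x ≤ y → y ≤ ℓ → 0 ≤ t → |u y t - u x t| ≤ K * (g y - g x)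
  time : ∀ x ∈ Icc 0 ℓ, ∀ s t, 0 ≤ s → s ≤ t → u x t - u x s ∈ Icc (-(B * (θ t - θ s))) 0
  v_sub : ∀ x y t, 0 ≤ x → x ≤ y → y < ℓ → 0 ≤ t → v x t - v y t ∈ Icc 0 (B / l * (g y - g x))
  taylor : ∀ x y t, 0 ≤ x → x < ℓ → x ≤ y → y ≤ ℓ → 0 ≤ t →
    u y t - u x t - v x t * (g y - g x) ∈ Icc (-(B / l * (g y - g x) ^ 2)) 0
  slope_le : ∀ x y t, 0 ≤ x → x ≤ y → y < ℓ → 0 ≤ t → v y t * (g y - g x) ≤ u y t - u x t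
  stream_space : ∀ x y t, 0 ≤ x → x ≤ y → y ≤ ℓ → 0 ≤ t →
    |U y t - U x t - u x t * (g y - g x)| ≤ K * (g y - g x) ^ 2
  stream_time : ∀ x y s t, 0 < x → h ≤ x → x ≤ y → y < ℓ → 0 ≤ s → s ≤ t →
    |U x t - U x s - A (v x s) * (θ t - θ s)| * (g y - g x) ≤
      c * (θ t - θ s) * (B / l * (g y - g x) ^ 2 + B * (θ t - θ s) + B / l * h * (g y - g x))
  stream_bound : ∀ t, 0 ≤ t → |U 0 t| ≤ c * K * θ t
  left : ∀ t, 0 ≤ t → u 0 t = f 0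
  right : ∀ t, 0 ≤ t → u ℓ t = f (g ℓ)
  datum_eq : ∀ x ∈ Icc 0 ℓ, u x 0 = f (g x)

theorem exists_floor_add {h x y : ℝ} (hh : 0 < h) (hxy : x ≤ y) :
    ∃ k : ℕ, ⌊y / h⌋₊ = ⌊x / h⌋₊ + k ∧ (k : ℝ) * h = ⌊y / h⌋₊ * h - ⌊x / h⌋₊ * h := by
  have h1 : ⌊x / h⌋₊ ≤ ⌊y / h⌋₊ := Nat.floor_le_floor (by gcongr)
  obtain ⟨k, hk⟩ := Nat.exists_eq_add_of_le h1
  refine ⟨k, hk, ?_⟩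
  rw [hk]
  push_cast
  ring

theorem floor_cell_le {ℓ x : ℝ} {N : ℕ} (hN : 0 < N) (hℓ : 0 < ℓ) (hx : x ≤ ℓ) :
    ⌊x / (ℓ / N)⌋₊ ≤ N := by
  have hN' : (0 : ℝ) < N := by exact_mod_cast hN
  refine Nat.floor_le_of_le ?_
  rw [div_le_iff₀ (by positivity)]
  field_simp
  exact hx

theorem floor_cell_lt {ℓ x : ℝ} {N : ℕ} (hN : 0 < N) (hℓ : 0 < ℓ) (hx0 : 0 ≤ x) (hx : x < ℓ) :
    ⌊x / (ℓ / N)⌋₊ < N := by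
  have hN' : (0 : ℝ) < N := by exact_mod_cast hN
  rw [Nat.floor_lt (by positivity), div_lt_iff₀ (by positivity)]
  field_simp
  exact hx

theorem floor_cell_self {ℓ : ℝ} {N : ℕ} (hN : 0 < N) (hℓ : 0 < ℓ) : ⌊ℓ / (ℓ / N)⌋₊ = N := by
  have hN' : (0 : ℝ) < N := by exact_mod_cast hN
  rw [div_div_cancel₀ hℓ.ne', Nat.floor_natCast]

theorem exists_interp {α A : ℝ → ℝ} {f : ℝ → ℝ} {ℓ K B l c τ : ℝ} {N : ℕ} (hN : 0 < N)
    (hℓ : 0 < ℓ) (hA0 : A 0 = 0) (P : GridParam α A K l c (ℓ / N) τ)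
    (hf : GridBound A (ℓ / N) N K B fun i => f (i * (ℓ / N))) :
    ∃ U u v : ℝ → ℝ → ℝ, Interp A f ℓ K B l c (ℓ / N) (fun x => ⌊x / (ℓ / N)⌋₊ * (ℓ / N))
      (fun t => ⌊t / τ⌋₊ * τ) U u v := by
  have hh := P.hpos
  set h := ℓ / (N : ℝ) with hhd
  have hτ := P.τpos
  set f' : ℕ → ℝ := fun i => f (i * h) with hf'
  refine ⟨fun x t => stream A h τ N f' ⌊t / τ⌋₊ ⌊x / h⌋₊,
    fun x t => scheme A h τ N f' ⌊t / τ⌋₊ ⌊x / h⌋₊,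
    fun x t => gridSlope h (scheme A h τ N f' ⌊t / τ⌋₊) ⌊x / h⌋₊, ?_, ?_, ?_, ?_, ?_, ?_, ?_, ?_, ?_,
    ?_, ?_, ?_⟩
  · intro x hx t _
    exact (hf.scheme P _).slope _ (floor_cell_lt hN hℓ hx.1 hx.2)
  · intro x y t _ hxy hy _
    obtain ⟨k, hk, hk'⟩ := exists_floor_add hh hxy
    have hy' := floor_cell_le hN hℓ hy
    rw [← hhd, hk] at hy'
    simp only [← hk']
    rw [hk]
    exact (hf.scheme P _).sub_le P hy'
  · intro x hx s t _ hst
    obtain ⟨k, hk, hk'⟩ := exists_floor_add hτ hst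
    simp only [← hk']
    rw [hk]
    exact scheme_time hf P _ _ _
  · intro x y t hx hxy hy _
    obtain ⟨k, hk, hk'⟩ := exists_floor_add hh hxy
    have hy' := floor_cell_lt hN hℓ (hx.trans hxy) hy
    rw [← hhd, hk] at hy'
    simp only [← hk']
    rw [hk]
    exact (hf.scheme P _).slope_sub P hy'
  · intro x y t _ _ hxy hy _
    obtain ⟨k, hk, hk'⟩ := exists_floor_add hh hxy
    have hy' := floor_cell_le hN hℓ hy
    rw [← hhd, hk] at hy'
    simp only [← hk']
    rw [hk]
    exact (hf.scheme P _).taylor P hy'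
  · intro x y t hx hxy hy _
    obtain ⟨k, hk, hk'⟩ := exists_floor_add hh hxy
    have hy' := floor_cell_lt hN hℓ (hx.trans hxy) hy
    rw [← hhd, hk] at hy'
    simp only [← hk']
    rw [hk]
    exact (hf.scheme P _).slope_le P hy'
  · intro x y t _ hxy hy _
    obtain ⟨k, hk, hk'⟩ := exists_floor_add hh hxy
    have hy' := floor_cell_le hN hℓ hy
    rw [← hhd, hk] at hy'
    simp only [← hk']
    rw [hk]
    exact stream_space hf P _ hy'
  · intro x y s t _ hhx hxy hy _ hst
    obtain ⟨k, hk, hk'⟩ := exists_floor_add hh hxy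
    obtain ⟨m, hm, hm'⟩ := exists_floor_add hτ hst
    have hy' := floor_cell_lt hN hℓ (hh.le.trans (hhx.trans hxy)) hy
    rw [← hhd, hk] at hy'
    have hx1 : 1 ≤ ⌊x / h⌋₊ := by
      rw [Nat.one_le_floor_iff, le_div_iff₀ hh]
      linarith
    obtain ⟨i, hi⟩ := Nat.exists_eq_add_of_le' hx1
    simp only [← hk', ← hm']
    rw [hm]
    rw [hi] at hy' ⊢
    exact stream_time hf P _ hy'
  · intro t _
    have hK : 0 ≤ K := (abs_nonneg _).trans (hf.slope 0 hN)
    have hb : ∀ k, |A (gridSlope h (scheme A h τ N f' k) 0)| ≤ c * K := fun k => by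
      have hs := (hf.scheme P k).slope 0 hN
      obtain ⟨m, hm, e⟩ := P.exists_slope (p := 0) (by simpa using hK) hs
      rw [hA0, sub_zero, sub_zero] at e
      rw [e, abs_mul, abs_of_nonneg (P.lpos.le.trans hm.1)]
      exact mul_le_mul hm.2 hs (abs_nonneg _) (P.lpos.le.trans (hm.1.trans hm.2))
    simp only [stream, zero_div, Nat.floor_zero, Finset.range_zero, Finset.sum_empty, mul_zero,
      zero_add]
    rw [abs_mul, abs_of_pos hτ]
    have := (Finset.abs_sum_le_sum_abs (fun k => A (gridSlope h (scheme A h τ N f' k) 0))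
      (Finset.range ⌊t / τ⌋₊)).trans (Finset.sum_le_card_nsmul _ _ (c * K) fun k _ => hb k)
    rw [Finset.card_range, nsmul_eq_mul] at this
    calc _ ≤ τ * (⌊t / τ⌋₊ * (c * K)) := by gcongr
      _ = _ := by ring
  · intro t _
    simp only [zero_div, Nat.floor_zero]
    rw [(scheme_boundary _).1, hf']
    simp
  · intro t _
    have := floor_cell_self hN hℓ
    rw [← hhd] at this
    simp only [this]
    rw [(scheme_boundary _).2]
  · intro x _
    simp only [zero_div, Nat.floor_zero, scheme, hf']

theorem tendsto_floor_mul {ι : Type*} {F : Filter ι} {h : ι → ℝ} (hh : ∀ i, 0 < h i)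
    (hlim : Tendsto h F (𝓝 0)) {x : ℝ} (hx : 0 ≤ x) :
    Tendsto (fun i => (⌊x / h i⌋₊ : ℝ) * h i) F (𝓝 x) := by
  rw [tendsto_iff_norm_sub_tendsto_zero]
  refine squeeze_zero (fun _ => norm_nonneg _) (fun i => ?_) hlim
  have hi := hh i
  have h1 := (le_div_iff₀ hi).1 (Nat.floor_le (a := x / h i) (by positivity))
  have h2 := (div_lt_iff₀ hi).1 (Nat.lt_floor_add_one (x / h i))
  rw [Real.norm_eq_abs, abs_le]
  constructor <;> linarith

theorem Interp.limit {A f : ℝ → ℝ} {ℓ K B l c : ℝ} (F : Ultrafilter ℕ) {h : ℕ → ℝ}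
    {g θ : ℕ → ℝ → ℝ} {U u v : ℕ → ℝ → ℝ → ℝ} (hℓ : 0 < ℓ) (hA : Continuous A)
    (hf : ContinuousOn f (Icc 0 ℓ))
    (H : ∀ i, Interp A f ℓ K B l c (h i) (g i) (θ i) (U i) (u i) (v i))
    (hh : Tendsto h F (𝓝 0))
    (hg : ∀ x ∈ Icc 0 ℓ, Tendsto (fun i => g i x) F (𝓝 x))
    (hgm : ∀ i, ∀ x ∈ Icc 0 ℓ, g i x ∈ Icc 0 ℓ)
    (hθ : ∀ t, 0 ≤ t → Tendsto (fun i => θ i t) F (𝓝 t)) :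
    ∃ U u v : ℝ → ℝ → ℝ, Interp A f ℓ K B l c 0 id id U u v := by
  have hu : ∀ x t, ∃ a, x ∈ Icc 0 ℓ → 0 ≤ t → Tendsto (fun i => u i x t) F (𝓝 a) := by
    intro x t
    by_cases hx : x ∈ Icc 0 ℓ ∧ 0 ≤ t
    · have hb : ∀ i, |u i x t| ≤ |f 0| + |K| * ℓ := fun i => by
        have h1 := (H i).lip 0 x t le_rfl hx.1.1 hx.1.2 hx.2
        rw [(H i).left t hx.2] at h1
        have h2 := abs_add_le (u i x t - f 0) (f 0)
        rw [sub_add_cancel] at h2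
        have h3 : K * (g i x - g i 0) ≤ |K| * ℓ := by
          have e1 := hgm i x hx.1
          have e2 := hgm i 0 ⟨le_rfl, hℓ.le⟩
          refine (le_abs_self _).trans ?_
          rw [abs_mul]
          refine mul_le_mul_of_nonneg_left (abs_le.2 ⟨?_, ?_⟩) (abs_nonneg _) <;>
            linarith [e1.1, e1.2, e2.1, e2.2]
        linarith
      obtain ⟨a, -, ha⟩ := exists_ultrafilter_lim F (Eventually.of_forall hb)
      exact ⟨a, fun _ _ => ha⟩
    · exact ⟨0, fun h1 h2 => (hx ⟨h1, h2⟩).elim⟩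
  have hv : ∀ x t, ∃ a, x ∈ Ico 0 ℓ → 0 ≤ t → Tendsto (fun i => v i x t) F (𝓝 a) := by
    intro x t
    by_cases hx : x ∈ Ico 0 ℓ ∧ 0 ≤ t
    · obtain ⟨a, -, ha⟩ := exists_ultrafilter_lim F
        (Eventually.of_forall fun i => (H i).bound_v x hx.1 t hx.2)
      exact ⟨a, fun _ _ => ha⟩
    · exact ⟨0, fun h1 h2 => (hx ⟨h1, h2⟩).elim⟩
  have hU : ∀ x t, ∃ a, x ∈ Icc 0 ℓ → 0 ≤ t → Tendsto (fun i => U i x t) F (𝓝 a) := by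
    intro x t
    by_cases hx : x ∈ Icc 0 ℓ ∧ 0 ≤ t
    · have hb : ∀ᶠ i in (F : Filter ℕ), |U i x t| ≤ |c * K| * (t + 1) + |f 0| * ℓ + |K| * ℓ ^ 2 := by
        have e3 : ∀ᶠ i in (F : Filter ℕ), |θ i t| ≤ t + 1 :=
          (hθ t hx.2).abs.eventually_le_const (by rw [abs_of_nonneg hx.2]; linarith)
        filter_upwards [e3] with i e3
        have e1 := hgm i x hx.1
        have e2 := hgm i 0 ⟨le_rfl, hℓ.le⟩
        have h1 := (H i).stream_space 0 x t le_rfl hx.1.1 hx.1.2 hx.2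
        rw [(H i).left t hx.2] at h1
        have h2 := (H i).stream_bound t hx.2
        have h4 : c * K * θ i t ≤ |c * K| * (t + 1) := by
          refine (le_abs_self _).trans ?_
          rw [abs_mul (c * K)]
          gcongr
        have h5 : |g i x - g i 0| ≤ ℓ := abs_le.2 ⟨by linarith [e1.1, e1.2, e2.1, e2.2],
          by linarith [e1.1, e1.2, e2.1, e2.2]⟩
        have h6 : |f 0 * (g i x - g i 0)| ≤ |f 0| * ℓ := by
          rw [abs_mul]; gcongr
        have h7 : K * (g i x - g i 0) ^ 2 ≤ |K| * ℓ ^ 2 := by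
          refine (le_abs_self _).trans ?_
          rw [abs_mul, abs_pow]; gcongr
        have h8 := abs_add_three (U i x t - U i 0 t - f 0 * (g i x - g i 0))
          (f 0 * (g i x - g i 0)) (U i 0 t)
        rw [sub_add_cancel, sub_add_cancel] at h8
        linarith
      obtain ⟨a, -, ha⟩ := exists_ultrafilter_lim F hb
      exact ⟨a, fun _ _ => ha⟩
    · exact ⟨0, fun h1 h2 => (hx ⟨h1, h2⟩).elim⟩
  choose u' hu using hu
  choose v' hv using hv
  choose U' hU using hU
  have hc := fun p => hA.tendsto p
  refine ⟨U', u', v', ?_, ?_, ?_, ?_, ?_, ?_, ?_, ?_, ?_, ?_, ?_, ?_⟩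
  · intro x hx t ht
    exact le_of_tendsto (hv x t hx ht).abs (Eventually.of_forall fun i => (H i).bound_v x hx t ht)
  · intro x y t h0 hxy hy ht
    have mx : x ∈ Icc 0 ℓ := ⟨h0, hxy.trans hy⟩
    have my : y ∈ Icc 0 ℓ := ⟨h0.trans hxy, hy⟩
    exact le_of_tendsto_of_tendsto ((hu y t my ht).sub (hu x t mx ht)).abs
      (((hg y my).sub (hg x mx)).const_mul K)
      (Eventually.of_forall fun i => (H i).lip x y t h0 hxy hy ht)
  · intro x hx s t hs hst
    have l1 := (hu x t hx (hs.trans hst)).sub (hu x s hx hs)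
    exact ⟨le_of_tendsto_of_tendsto ((((hθ t (hs.trans hst)).sub (hθ s hs)).const_mul B).neg) l1
      (Eventually.of_forall fun i => ((H i).time x hx s t hs hst).1),
      le_of_tendsto l1 (Eventually.of_forall fun i => ((H i).time x hx s t hs hst).2)⟩
  · intro x y t h0 hxy hy ht
    have mx : x ∈ Ico 0 ℓ := ⟨h0, hxy.trans_lt hy⟩
    have my : y ∈ Ico 0 ℓ := ⟨h0.trans hxy, hy⟩
    have l1 := (hv x t mx ht).sub (hv y t my ht)
    exact ⟨ge_of_tendsto l1 (Eventually.of_forall fun i => ((H i).v_sub x y t h0 hxy hy ht).1),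
      le_of_tendsto_of_tendsto l1
        (((hg y (Ico_subset_Icc_self my)).sub (hg x (Ico_subset_Icc_self mx))).const_mul _)
        (Eventually.of_forall fun i => ((H i).v_sub x y t h0 hxy hy ht).2)⟩
  · intro x y t h0 hx hxy hy ht
    have mx : x ∈ Icc 0 ℓ := ⟨h0, hxy.trans hy⟩
    have my : y ∈ Icc 0 ℓ := ⟨h0.trans hxy, hy⟩
    have l0 := (hg y my).sub (hg x mx)
    have l1 := ((hu y t my ht).sub (hu x t mx ht)).sub ((hv x t ⟨h0, hx⟩ ht).mul l0)
    exact ⟨le_of_tendsto_of_tendsto ((l0.pow 2).const_mul (B / l)).neg l1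
      (Eventually.of_forall fun i => ((H i).taylor x y t h0 hx hxy hy ht).1),
      le_of_tendsto l1 (Eventually.of_forall fun i => ((H i).taylor x y t h0 hx hxy hy ht).2)⟩
  · intro x y t h0 hxy hy ht
    have mx : x ∈ Icc 0 ℓ := ⟨h0, hxy.trans hy.le⟩
    have my : y ∈ Icc 0 ℓ := ⟨h0.trans hxy, hy.le⟩
    exact le_of_tendsto_of_tendsto ((hv y t ⟨my.1, hy⟩ ht).mul ((hg y my).sub (hg x mx)))
      ((hu y t my ht).sub (hu x t mx ht))
      (Eventually.of_forall fun i => (H i).slope_le x y t h0 hxy hy ht)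
  · intro x y t h0 hxy hy ht
    have mx : x ∈ Icc 0 ℓ := ⟨h0, hxy.trans hy⟩
    have my : y ∈ Icc 0 ℓ := ⟨h0.trans hxy, hy⟩
    have l0 := (hg y my).sub (hg x mx)
    exact le_of_tendsto_of_tendsto
      (((hU y t my ht).sub (hU x t mx ht)).sub ((hu x t mx ht).mul l0)).abs
      ((l0.pow 2).const_mul K)
      (Eventually.of_forall fun i => (H i).stream_space x y t h0 hxy hy ht)
  · intro x y s t h0 _ hxy hy hs hst
    have mx : x ∈ Icc 0 ℓ := ⟨h0.le, hxy.trans hy.le⟩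
    have my : y ∈ Icc 0 ℓ := ⟨h0.le.trans hxy, hy.le⟩
    have l0 := (hg y my).sub (hg x mx)
    have l1 := (hθ t (hs.trans hst)).sub (hθ s hs)
    have l2 := (((hU x t mx (hs.trans hst)).sub (hU x s mx hs)).sub
      (((hc _).comp (hv x s ⟨h0.le, hxy.trans_lt hy⟩ hs)).mul l1)).abs.mul l0
    have l3 := (l1.const_mul c).mul ((((l0.pow 2).const_mul (B / l)).add (l1.const_mul B)).add
      ((hh.const_mul (B / l)).mul l0))
    refine le_of_tendsto_of_tendsto l2 l3 ?_
    filter_upwards [hh.eventually_le_const h0] with i hi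
    exact (H i).stream_time x y s t h0 hi hxy hy hs hst
  · intro t ht
    exact le_of_tendsto_of_tendsto (hU 0 t ⟨le_rfl, hℓ.le⟩ ht).abs ((hθ t ht).const_mul _)
      (Eventually.of_forall fun i => (H i).stream_bound t ht)
  · intro t ht
    refine tendsto_nhds_unique (hu 0 t ⟨le_rfl, hℓ.le⟩ ht) ?_
    simp only [fun i => (H i).left t ht]
    exact tendsto_const_nhds
  · intro t ht
    have m : ℓ ∈ Icc 0 ℓ := ⟨hℓ.le, le_rfl⟩
    refine tendsto_nhds_unique (hu ℓ t m ht) ?_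
    simp only [fun i => (H i).right t ht]
    exact (hf ℓ m).tendsto.comp (tendsto_nhdsWithin_iff.2
      ⟨hg ℓ m, Eventually.of_forall fun i => hgm i ℓ m⟩)
  · intro x m
    refine tendsto_nhds_unique (hu x 0 m le_rfl) ?_
    simp only [fun i => (H i).datum_eq x m]
    exact (hf x m).tendsto.comp (tendsto_nhdsWithin_iff.2
      ⟨hg x m, Eventually.of_forall fun i => hgm i x m⟩)

theorem exists_limit {α A f : ℝ → ℝ} {ℓ K B l c : ℝ} (hℓ : 0 < ℓ) (hl : 0 < l)
    (hA : ∀ p, HasDerivAt A (α p) p) (hA0 : A 0 = 0) (hK : 0 ≤ K)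
    (hα : ∀ p, |p| ≤ K → α p ∈ Icc l c)
    (hlip : ∀ x ∈ Icc 0 ℓ, ∀ y ∈ Icc 0 ℓ, |f y - f x| ≤ K * |y - x|)
    (hconc : ∀ x s, 0 ≤ s → 0 ≤ x - s → x + s ≤ ℓ →
      f (x + s) + f (x - s) - 2 * f x ∈ Icc (-(B * s ^ 2)) 0) :
    ∃ U u v : ℝ → ℝ → ℝ, Interp A f ℓ K (c * B) l c 0 id id U u v := by
  have hc : 0 < c := hl.trans_le ((hα 0 (by simpa using hK)).1.trans (hα 0 (by simpa using hK)).2)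
  have hB : 0 ≤ B := by
    have := hconc (ℓ / 2) (ℓ / 2) (by linarith) (by linarith) (by linarith)
    have h1 := this.1.trans this.2
    have h2 : 0 < (ℓ / 2) ^ 2 := by positivity
    by_contra hneg
    nlinarith
  have hf : ContinuousOn f (Icc 0 ℓ) := by
    refine (LipschitzOnWith.of_dist_le_mul (K := ⟨K, hK⟩) fun x hx y hy => ?_).continuousOn
    rw [Real.dist_eq, Real.dist_eq]
    exact hlip y hy x hx
  have hN : ∀ i : ℕ, (0 : ℝ) < (i + 1 : ℕ) := fun i => by positivity
  have hP : ∀ i : ℕ, GridParam α A K l c (ℓ / (i + 1 : ℕ)) ((ℓ / (i + 1 : ℕ)) ^ 2 / (2 * c)) := by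
    intro i
    have := hN i
    refine ⟨hA, hl, hα, by positivity, by positivity, le_of_eq ?_⟩
    field_simp
  have hG : ∀ i : ℕ, GridBound A (ℓ / (i + 1 : ℕ)) (i + 1) K (c * B)
      fun k => f (k * (ℓ / (i + 1 : ℕ))) := by
    intro i
    have hP' := hP i
    have hh := hP'.hpos
    have hhN : ((i + 1 : ℕ) : ℝ) * (ℓ / (i + 1 : ℕ)) = ℓ := by
      have := (hN i).ne'
      field_simp
    set h := ℓ / ((i + 1 : ℕ) : ℝ) with hhd
    have hm : ∀ k ≤ i + 1, (k : ℝ) * h ∈ Icc 0 ℓ := fun k hk => by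
      refine ⟨by positivity, ?_⟩
      rw [← hhN]
      gcongr
    have hs : ∀ k < i + 1, |gridSlope h (fun k => f (k * h)) k| ≤ K := fun k hk => by
      have := hlip _ (hm k hk.le) _ (hm (k + 1) hk)
      rw [gridSlope, abs_div, abs_of_pos hh, div_le_iff₀ hh]
      refine this.trans (le_of_eq ?_)
      rw [← sub_mul]
      push_cast
      rw [add_sub_cancel_left, one_mul, abs_of_pos hh]
    refine ⟨hs, fun k => ?_⟩
    have hcB : 0 ≤ c * B := by positivity
    rcases le_or_gt (i + 1) k with hk | hk
    · rw [gridVel_of_le hk]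
      exact ⟨by linarith, le_rfl⟩
    cases k with
    | zero => exact ⟨by rw [gridVel]; linarith, le_rfl⟩
    | succ k =>
      obtain ⟨m, hmem, e⟩ := hP'.exists_slope (hs k (by omega)) (hs (k + 1) hk)
      have hm0 : 0 ≤ m := hl.le.trans hmem.1
      have h1 := (hm k (by omega)).1
      have h2 := (hm (k + 2) (by omega)).2
      push_cast at h1 h2
      have h3 := hconc ((k + 1) * h) h hh.le (by linarith) (by linarith)
      rw [gridVel_succ hk, e]
      have e2 : m * (gridSlope h (fun k => f (k * h)) (k + 1) - gridSlope h (fun k => f (k * h)) k) / h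
          = m * ((f ((k + 1) * h + h) + f ((k + 1) * h - h) - 2 * f ((k + 1) * h)) / h ^ 2) := by
        unfold gridSlope
        push_cast
        rw [show ((k : ℝ) + 1 + 1) * h = (k + 1) * h + h by ring,
          show (k : ℝ) * h = (k + 1) * h - h by ring]
        field_simp
        ring
      rw [e2]
      have h4 : (f ((k + 1) * h + h) + f ((k + 1) * h - h) - 2 * f ((k + 1) * h)) / h ^ 2 ≤ 0 :=
        div_nonpos_of_nonpos_of_nonneg h3.2 (by positivity)
      have h5 : -B ≤ (f ((k + 1) * h + h) + f ((k + 1) * h - h) - 2 * f ((k + 1) * h)) / h ^ 2 := by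
        rw [le_div_iff₀ (by positivity)]
        linarith [h3.1]
      constructor
      · nlinarith [hmem.2]
      · exact mul_nonpos_of_nonneg_of_nonpos hm0 h4
  choose U u v H using fun i : ℕ => exists_interp (Nat.succ_pos i) hℓ hA0 (hP i) (hG i)
  have hh : Tendsto (fun i : ℕ => ℓ / ((i + 1 : ℕ) : ℝ)) (hyperfilter ℕ) (𝓝 0) := by
    have : Tendsto (fun i : ℕ => ℓ / ((i + 1 : ℕ) : ℝ)) atTop (𝓝 0) :=
      (tendsto_const_nhds.div_atTop tendsto_natCast_atTop_atTop).comp (tendsto_add_atTop_nat 1)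
    exact this.mono_left Nat.hyperfilter_le_atTop
  have hτ : Tendsto (fun i : ℕ => (ℓ / ((i + 1 : ℕ) : ℝ)) ^ 2 / (2 * c)) (hyperfilter ℕ) (𝓝 0) := by
    simpa using (hh.pow 2).div_const (2 * c)
  refine Interp.limit (hyperfilter ℕ) hℓ (continuous_iff_continuousAt.2 fun p => (hA p).continuousAt)
    hf H hh (fun x hx => tendsto_floor_mul (fun i => (hP i).hpos) hh hx.1) (fun i x hx => ?_)
    (fun t ht => tendsto_floor_mul (fun i => (hP i).τpos) hτ ht)
  have h1 := (hP i).hpos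
  refine ⟨mul_nonneg (Nat.cast_nonneg _) h1.le, ?_⟩
  have h2 := (le_div_iff₀ h1).1
    (Nat.floor_le (a := x / (ℓ / ((i + 1 : ℕ) : ℝ))) (div_nonneg hx.1 h1.le))
  exact h2.trans hx.2

section
variable {α A f : ℝ → ℝ} {ℓ K B l c : ℝ} {U u v : ℝ → ℝ → ℝ}

theorem Interp.lipschitz (H : Interp A f ℓ K B l c 0 id id U u v) {x y t : ℝ} (hx : x ∈ Icc 0 ℓ)
    (hy : y ∈ Icc 0 ℓ) (ht : 0 ≤ t) : |u y t - u x t| ≤ K * |y - x| := by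
  rcases le_total x y with h | h
  · rw [abs_of_nonneg (sub_nonneg.2 h)]
    exact H.lip x y t hx.1 h hy.2 ht
  · rw [abs_sub_comm, abs_sub_comm y, abs_of_nonneg (sub_nonneg.2 h)]
    exact H.lip y x t hy.1 h hx.2 ht

theorem Interp.hasDerivAt_U (H : Interp A f ℓ K B l c 0 id id U u v) {x t : ℝ} (hx : x ∈ Ioo 0 ℓ)
    (ht : 0 ≤ t) : HasDerivAt (fun y => U y t) (u x t) x := by
  refine hasDerivAt_of_abs_sub_le (g := fun z => 2 * K * |z|) (r := min x (ℓ - x))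
    (lt_min hx.1 (by linarith [hx.2])) (fun y hy => ?_) ?_
  · have h1 := abs_le.1 (hy.trans (min_le_left _ _))
    have h2 := abs_le.1 (hy.trans (min_le_right _ _))
    have hy' : y ∈ Icc 0 ℓ := ⟨by linarith, by linarith⟩
    rw [mul_assoc, abs_mul_abs_self]
    rcases le_total x y with h | h
    · have := H.stream_space x y t hx.1.le h hy'.2 ht
      simp only [id] at this
      nlinarith [(abs_nonneg _).trans this]
    · have h3 := abs_le.1 (H.stream_space y x t hy'.1 h hx.2.le ht)
      have h4 := H.lip y x t hy'.1 h hx.2.le ht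
      simp only [id] at h3 h4
      have h5 := abs_le.1 (show |(u x t - u y t) * (x - y)| ≤ K * (x - y) * (x - y) by
        rw [abs_mul, abs_of_nonneg (sub_nonneg.2 h)]
        exact mul_le_mul_of_nonneg_right h4 (by linarith))
      exact abs_le.2 ⟨by nlinarith, by nlinarith⟩
  · have : Continuous fun z : ℝ => 2 * K * |z| := by fun_prop
    simpa using this.tendsto 0

theorem Interp.hasDerivAt_u (H : Interp A f ℓ K B l c 0 id id U u v) {x t : ℝ} (hx : x ∈ Ioo 0 ℓ)
    (ht : 0 ≤ t) : HasDerivAt (fun y => u y t) (v x t) x := by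
  refine hasDerivAt_of_abs_sub_le (g := fun z => 2 * (B / l) * |z|) (r := min x (ℓ - x))
    (lt_min hx.1 (by linarith [hx.2])) (fun y hy => ?_) ?_
  · have h1 := abs_le.1 (hy.trans (min_le_left _ _))
    have h2 := abs_le.1 (hy.trans (min_le_right _ _))
    have hy' : y ∈ Icc 0 ℓ := ⟨by linarith, by linarith⟩
    rw [mul_assoc, abs_mul_abs_self]
    rcases le_total x y with h | h
    · have := H.taylor x y t hx.1.le hx.2 h hy'.2 ht
      simp only [id] at this
      exact abs_le.2 ⟨by nlinarith [this.1, this.2], by nlinarith [this.1, this.2]⟩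
    · have h3 := H.taylor y x t hy'.1 (h.trans_lt hx.2) h hx.2.le ht
      have h4 := H.v_sub y x t hy'.1 h hx.2 ht
      simp only [id] at h3 h4
      have h5 := mul_le_mul_of_nonneg_right h4.1 (sub_nonneg.2 h)
      have h6 := mul_le_mul_of_nonneg_right h4.2 (sub_nonneg.2 h)
      exact abs_le.2 ⟨by nlinarith [h3.1, h3.2], by nlinarith [h3.1, h3.2]⟩
  · have : Continuous fun z : ℝ => 2 * (B / l) * |z| := by fun_prop
    simpa using this.tendsto 0

theorem Interp.v_time (H : Interp A f ℓ K B l c 0 id id U u v) {x s t δ : ℝ} (hx : 0 < x)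
    (hδ : 0 < δ) (hxδ : x + δ < ℓ) (hs : 0 ≤ s) (hst : s ≤ t) :
    |v x t - v x s| * δ ≤ B / l * δ ^ 2 + B * (t - s) := by
  have h1 := H.taylor x (x + δ) t hx.le (by linarith) (by linarith) hxδ.le (hs.trans hst)
  have h2 := H.taylor x (x + δ) s hx.le (by linarith) (by linarith) hxδ.le hs
  have h3 := H.time x ⟨hx.le, by linarith⟩ s t hs hst
  have h4 := H.time (x + δ) ⟨by linarith, by linarith⟩ s t hs hst
  simp only [id, add_sub_cancel_left] at h1 h2 h3 h4
  rw [← abs_of_pos hδ, ← abs_mul, abs_of_pos hδ]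
  exact abs_le.2 ⟨by linarith [h1.1, h1.2, h2.1, h2.2, h3.1, h3.2, h4.1, h4.2],
    by linarith [h1.1, h1.2, h2.1, h2.2, h3.1, h3.2, h4.1, h4.2]⟩

theorem Interp.hasDerivAt_time (H : Interp A f ℓ K B l c 0 id id U u v) (hc : 0 ≤ c)
    (hAc : ∀ p q, |p| ≤ K → |q| ≤ K → |A q - A p| ≤ c * |q - p|) {x t : ℝ} (hx : x ∈ Ioo 0 ℓ)
    (ht : 0 < t) : HasDerivAt (fun s => U x s) (A (v x t)) t := by
  have hx' := Ioo_subset_Ico_self hx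
  have key : ∀ s t, 0 ≤ s → s < t → x + √(t - s) < ℓ →
      |U x t - U x s - A (v x s) * (t - s)| ≤ c * (B / l + B) * √(t - s) * (t - s) ∧
      |v x t - v x s| ≤ (B / l + B) * √(t - s) := by
    intro s t hs hst hxℓ
    have hδ : 0 < √(t - s) := Real.sqrt_pos.2 (by linarith)
    have e := Real.sq_sqrt (sub_nonneg.2 hst.le)
    have h1 := H.v_time hx.1 hδ hxℓ hs hst.le
    have h2 := H.stream_time x (x + √(t - s)) s t hx.1 hx.1.le (by linarith) hxℓ hs hst.le
    simp only [id, add_sub_cancel_left, mul_zero, zero_mul, add_zero] at h2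
    constructor
    · refine le_of_mul_le_mul_right (h2.trans (le_of_eq ?_)) hδ
      rw [e]
      linear_combination -(c * (B / l + B) * (t - s)) * e
    · refine le_of_mul_le_mul_right (h1.trans (le_of_eq ?_)) hδ
      rw [e]
      linear_combination -(B / l + B) * e
  refine hasDerivAt_of_abs_sub_le (g := fun z => 2 * (c * (B / l + B)) * √|z|)
    (r := min t ((ℓ - x) / 2) ⊓ ((ℓ - x) / 2) ^ 2)
    (lt_min (lt_min ht (by linarith [hx.2])) (by have := hx.2; have : 0 < ℓ - x := by linarith
                                                 positivity)) (fun s hs => ?_) ?_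
  · have h1 := abs_le.1 (hs.trans ((min_le_left _ _).trans (min_le_left _ _)))
    have h2 : x + √|s - t| < ℓ := by
      have := Real.sqrt_le_sqrt (hs.trans (min_le_right _ _))
      rw [Real.sqrt_sq (by linarith [hx.2])] at this
      linarith [hx.2]
    rcases lt_trichotomy s t with h | h | h
    · rw [abs_of_nonpos (a := s - t) (by linarith), neg_sub] at h2 ⊢
      obtain ⟨k1, k2⟩ := key s t (by linarith) h h2
      have k3 := (hAc (v x s) (v x t) (H.bound_v x hx' s (by linarith))
        (H.bound_v x hx' t ht.le)).trans (mul_le_mul_of_nonneg_left k2 hc)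
      have k4 : |(A (v x t) - A (v x s)) * (t - s)| ≤ c * ((B / l + B) * √(t - s)) * (t - s) := by
        rw [abs_mul, abs_of_pos (sub_pos.2 h)]
        exact mul_le_mul_of_nonneg_right k3 (by linarith)
      have k1 := abs_le.1 k1
      have k4 := abs_le.1 k4
      exact abs_le.2 ⟨by linarith, by linarith⟩
    · simp [h]
    · rw [abs_of_pos (a := s - t) (by linarith)] at h2 ⊢
      obtain ⟨k1, k2⟩ := key t s ht.le h h2
      refine k1.trans ?_
      linarith [(abs_nonneg _).trans k1]
  · have : Continuous fun z : ℝ => 2 * (c * (B / l + B)) * √|z| := by fun_prop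
    simpa using this.tendsto 0

theorem Interp.cylSol (H : Interp A f ℓ K B l c 0 id id U u v) (hA : ∀ p, HasDerivAt A (α p) p)
    (hA0 : A 0 = 0) (hl : 0 < l) (hK : 0 ≤ K) (hα : ∀ p, |p| ≤ K → α p ∈ Icc l c)
    {K' l' c' x₀ t₀ r : ℝ} (hr : 0 < r) (hl' : 0 < l') (hα' : ∀ p, |p| ≤ K' → α p ∈ Icc l' c')
    (hx : 0 < x₀ - r) (hx' : x₀ + r < ℓ) (ht : 0 < t₀ - r ^ 2)
    (hv : ∀ x ∈ Icc (x₀ - r) (x₀ + r), ∀ t, 0 ≤ t → |v x t| ≤ K') :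
    CylSol α A U u v K' l' c' x₀ t₀ r := by
  have m : ∀ x ∈ Icc (x₀ - r) (x₀ + r), x ∈ Ioo 0 ℓ := fun x hx'' =>
    ⟨by linarith [hx''.1], by linarith [hx''.2]⟩
  have hc : 0 ≤ c := by
    have := hα 0 (by simpa using hK)
    linarith [this.1, this.2]
  refine ⟨hr, hl', hA, hA0, hα', fun x hx t ht' => H.hasDerivAt_U (m x hx) (by linarith [ht'.1]),
    fun x hx t ht' => H.hasDerivAt_u (m x hx) (by linarith [ht'.1]),
    fun x hx t ht' => H.hasDerivAt_time hc (fun p q hp hq => ?_) (m x hx) (by linarith [ht'.1]),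
    fun x hx t ht' => hv x hx t (by linarith [ht'.1])⟩
  obtain ⟨z, hz, e⟩ := exists_slope hA p q
  have := hα z (abs_le.2 (uIcc_subset_Icc (abs_le.1 hp) (abs_le.1 hq) hz))
  rw [e, abs_mul, abs_of_nonneg (hl.le.trans this.1)]
  exact mul_le_mul_of_nonneg_right this.2 (abs_nonneg _)

end

theorem concave_combination {g : ℝ → ℝ} {s : Set ℝ} (hg : ConcaveOn ℝ s g) {x y a b : ℝ}
    (hx : x ∈ s) (hy : y ∈ s) (ha : 0 ≤ a) (hb : 0 ≤ b) (hab : a + b = 1) :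
    a * g x + b * g y ≤ g (a * x + b * y) := hg.2 hx hy ha hb hab

theorem concave_ratio {ψ : ℝ → ℝ} {ℓ : ℝ} (hψ : ConcaveOn ℝ (Ioo 0 ℓ) ψ)
    (h0 : ∀ x ∈ Ioo 0 ℓ, 0 ≤ ψ x) {x y : ℝ} (hx : 0 < x) (hxy : x ≤ y) (hy : y < ℓ) :
    x * ψ y ≤ y * ψ x := by
  rcases hxy.eq_or_lt with rfl | hxy
  · exact le_rfl
  have key : ∀ z ∈ Ioo 0 x, (x - z) * ψ y ≤ (y - z) * ψ x := fun z hz => by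
    have h1 : 0 < y - z := by linarith [hz.2]
    have h2 : 0 ≤ x - z := by linarith [hz.2]
    have e := concave_combination hψ (x := z) (y := y) ⟨hz.1, by linarith [hz.2]⟩ ⟨by linarith, hy⟩
      (a := (y - x) / (y - z)) (b := (x - z) / (y - z)) (by have : 0 ≤ y - x := by linarith
                                                            positivity) (by positivity)
      (by field_simp; ring)
    rw [show (y - x) / (y - z) * z + (x - z) / (y - z) * y = x by field_simp; ring] at e
    have e1 : 0 ≤ (y - x) / (y - z) * ψ z := by
      have : 0 ≤ y - x := by linarith
      have := h0 z ⟨hz.1, by linarith [hz.2]⟩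
      positivity
    have e2 : (x - z) / (y - z) * ψ y ≤ ψ x := by linarith
    rw [div_mul_eq_mul_div, div_le_iff₀ h1] at e2
    linarith
  have h1 : Tendsto (fun z : ℝ => (x - z) * ψ y) (𝓝[>] 0) (𝓝 (x * ψ y)) := by
    have : Continuous fun z : ℝ => (x - z) * ψ y := by fun_prop
    simpa using (this.tendsto 0).mono_left nhdsWithin_le_nhds
  have h2 : Tendsto (fun z : ℝ => (y - z) * ψ x) (𝓝[>] 0) (𝓝 (y * ψ x)) := by
    have : Continuous fun z : ℝ => (y - z) * ψ x := by fun_prop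
    simpa using (this.tendsto 0).mono_left nhdsWithin_le_nhds
  refine le_of_tendsto_of_tendsto h1 h2 ?_
  filter_upwards [Ioo_mem_nhdsGT hx] with z hz using key z hz

theorem concave_reflect {ψ : ℝ → ℝ} {ℓ : ℝ} (hψ : ConcaveOn ℝ (Ioo 0 ℓ) ψ) :
    ConcaveOn ℝ (Ioo 0 ℓ) fun x => ψ (ℓ - x) := by
  refine ⟨hψ.1, fun x hx y hy a b ha hb hab => ?_⟩
  have := concave_combination hψ (x := ℓ - x) (y := ℓ - y) ⟨by linarith [hx.2], by linarith [hx.1]⟩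
    ⟨by linarith [hy.2], by linarith [hy.1]⟩ ha hb hab
  simp only [smul_eq_mul]
  rwa [show a * (ℓ - x) + b * (ℓ - y) = ℓ - (a * x + b * y) by linear_combination ℓ * hab] at this

theorem concave_ratio' {ψ : ℝ → ℝ} {ℓ : ℝ} (hψ : ConcaveOn ℝ (Ioo 0 ℓ) ψ)
    (h0 : ∀ x ∈ Ioo 0 ℓ, 0 ≤ ψ x) {x y : ℝ} (hx : 0 < x) (hxy : x ≤ y) (hy : y < ℓ) :
    (ℓ - y) * ψ x ≤ (ℓ - x) * ψ y := by
  have := concave_ratio (concave_reflect hψ)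
    (fun x hx => h0 _ ⟨by linarith [hx.2], by linarith [hx.1]⟩)
    (x := ℓ - y) (y := ℓ - x) (by linarith) (by linarith) (by linarith)
  simpa using this

theorem concave_le {ψ : ℝ → ℝ} {ℓ : ℝ} (hψ : ConcaveOn ℝ (Ioo 0 ℓ) ψ)
    (h0 : ∀ x ∈ Ioo 0 ℓ, 0 ≤ ψ x) {x : ℝ} (hx : x ∈ Ioo 0 ℓ) : ψ x ≤ 2 * ψ (ℓ / 2) := by
  have hℓ : 0 < ℓ := hx.1.trans hx.2
  have hm := h0 (ℓ / 2) ⟨by linarith, by linarith⟩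
  rcases le_total x (ℓ / 2) with h | h
  · have := concave_ratio' hψ h0 hx.1 h (by linarith)
    nlinarith [mul_nonneg hx.1.le hm]
  · have := concave_ratio hψ h0 (by linarith) h hx.2
    nlinarith [mul_nonneg (sub_pos.2 hx.2).le hm]

/-- Truncation of `ψ` by the two lines of slopes `K` and `-K` through the end points. -/
noncomputable def truncation (ψ : ℝ → ℝ) (ℓ K x : ℝ) : ℝ := min (ψ x) (min (K * x) (K * (ℓ - x)))

theorem truncation_concave {ψ : ℝ → ℝ} {ℓ : ℝ} (hψ : ConcaveOn ℝ (Ioo 0 ℓ) ψ) (K : ℝ) :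
    ConcaveOn ℝ (Ioo 0 ℓ) (truncation ψ ℓ K) := by
  refine hψ.inf (ConcaveOn.inf ?_ ?_) <;>
    refine ⟨hψ.1, fun x hx y hy a b ha hb hab => le_of_eq ?_⟩ <;> simp only [smul_eq_mul]
  · ring
  · linear_combination (K * ℓ) * hab

theorem truncation_pos {ψ : ℝ → ℝ} {ℓ K x : ℝ} (hK : 0 < K) (h0 : ∀ x ∈ Ioo 0 ℓ, 0 < ψ x)
    (hx : x ∈ Ioo 0 ℓ) : 0 < truncation ψ ℓ K x :=
  lt_min (h0 x hx) (lt_min (mul_pos hK hx.1) (mul_pos hK (by linarith [hx.2])))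

theorem truncation_sub_le {ψ : ℝ → ℝ} {ℓ K x y : ℝ} (hψ : ConcaveOn ℝ (Ioo 0 ℓ) ψ) (hK : 0 < K)
    (h0 : ∀ x ∈ Ioo 0 ℓ, 0 < ψ x) (hx : x ∈ Ioo 0 ℓ) (hy : y ∈ Ioo 0 ℓ) :
    truncation ψ ℓ K y - truncation ψ ℓ K x ≤ K * |y - x| := by
  have hc := truncation_concave hψ K
  have hp : ∀ x ∈ Ioo 0 ℓ, 0 ≤ truncation ψ ℓ K x := fun x hx => (truncation_pos hK h0 hx).le
  have e1 : truncation ψ ℓ K x ≤ K * x := (min_le_right _ _).trans (min_le_left _ _)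
  have e2 : truncation ψ ℓ K x ≤ K * (ℓ - x) := (min_le_right _ _).trans (min_le_right _ _)
  rcases le_total x y with h | h
  · have := concave_ratio hc hp hx.1 h hy.2
    rw [abs_of_nonneg (by linarith)]
    refine le_of_mul_le_mul_left (a := x) ?_ hx.1
    nlinarith [mul_le_mul_of_nonneg_left e1 (sub_nonneg.2 h)]
  · have := concave_ratio' hc hp hy.1 h hx.2
    rw [abs_of_nonpos (by linarith)]
    refine le_of_mul_le_mul_left (a := ℓ - x) ?_ (by linarith [hx.2])
    nlinarith [mul_le_mul_of_nonneg_left e2 (sub_nonneg.2 h)]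

/-- Sup-convolution of `g` on `(0, ℓ)` with a parabola of opening `1 / ε`. -/
noncomputable def supConv (g : ℝ → ℝ) (ℓ ε x : ℝ) : ℝ :=
  sSup ((fun y => g y - (x - y) ^ 2 / (2 * ε)) '' Ioo 0 ℓ)

section supConv
variable {g : ℝ → ℝ} {ℓ ε G x : ℝ}

theorem supConv_le (hℓ : 0 < ℓ) {z : ℝ} (h : ∀ y ∈ Ioo 0 ℓ, g y - (x - y) ^ 2 / (2 * ε) ≤ z) :
    supConv g ℓ ε x ≤ z := by
  refine csSup_le ((nonempty_Ioo.2 hℓ).image _) ?_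
  rintro _ ⟨y, hy, rfl⟩
  exact h y hy

theorem le_supConv (hε : 0 < ε) (hg : ∀ y ∈ Ioo 0 ℓ, g y ≤ G) {y : ℝ} (hy : y ∈ Ioo 0 ℓ) :
    g y - (x - y) ^ 2 / (2 * ε) ≤ supConv g ℓ ε x := by
  refine le_csSup ⟨G, ?_⟩ ⟨y, hy, rfl⟩
  rintro _ ⟨z, hz, rfl⟩
  have : 0 ≤ (x - z) ^ 2 / (2 * ε) := by positivity
  have := hg z hz
  simp only
  linarith

theorem supConv_second_diff (hℓ : 0 < ℓ) (hε : 0 < ε) (hg : ∀ y ∈ Ioo 0 ℓ, g y ≤ G)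
    (hc : ConcaveOn ℝ (Ioo 0 ℓ) g) (s : ℝ) :
    supConv g ℓ ε (x + s) + supConv g ℓ ε (x - s) - 2 * supConv g ℓ ε x ∈
      Icc (-(1 / ε * s ^ 2)) 0 := by
  constructor
  · have : supConv g ℓ ε x ≤ (supConv g ℓ ε (x + s) + supConv g ℓ ε (x - s) + 1 / ε * s ^ 2) / 2 :=
      supConv_le hℓ fun y hy => by
        have e1 := le_supConv (x := x + s) hε hg hy
        have e2 := le_supConv (x := x - s) hε hg hy
        have e3 : (x + s - y) ^ 2 / (2 * ε) + (x - s - y) ^ 2 / (2 * ε) =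
            2 * ((x - y) ^ 2 / (2 * ε)) + 1 / ε * s ^ 2 := by field_simp; ring
        linarith
    linarith
  · have : supConv g ℓ ε (x + s) ≤ 2 * supConv g ℓ ε x - supConv g ℓ ε (x - s) :=
      supConv_le hℓ fun y hy => by
        have : supConv g ℓ ε (x - s) ≤
            2 * supConv g ℓ ε x - (g y - (x + s - y) ^ 2 / (2 * ε)) :=
          supConv_le hℓ fun z hz => by
            have hm : (y + z) / 2 ∈ Ioo 0 ℓ :=
              ⟨by linarith [hy.1, hz.1], by linarith [hy.2, hz.2]⟩
            have e1 := le_supConv (x := x) hε hg hm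
            have e2 := concave_combination hc hy hz (a := 1 / 2) (b := 1 / 2) (by norm_num) (by norm_num)
              (by norm_num)
            rw [show 1 / 2 * y + 1 / 2 * z = (y + z) / 2 by ring] at e2
            have e3 : 2 * ((x - (y + z) / 2) ^ 2 / (2 * ε)) ≤
                (x + s - y) ^ 2 / (2 * ε) + (x - s - z) ^ 2 / (2 * ε) := by
              rw [← mul_div_assoc, ← add_div]
              gcongr
              nlinarith [sq_nonneg ((x + s - y) - (x - s - z))]
            linarith
        linarith
    linarith

theorem supConv_lipschitz (hℓ : 0 < ℓ) (hε : 0 < ε) (hg : ∀ y ∈ Ioo 0 ℓ, g y ≤ G) {x y : ℝ}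
    (hx : x ∈ Icc 0 ℓ) (hy : y ∈ Icc 0 ℓ) :
    |supConv g ℓ ε y - supConv g ℓ ε x| ≤ ℓ / ε * |y - x| := by
  have aux : ∀ x ∈ Icc 0 ℓ, ∀ y ∈ Icc 0 ℓ,
      supConv g ℓ ε y ≤ supConv g ℓ ε x + ℓ / ε * |y - x| := fun x hx y hy =>
    supConv_le hℓ fun z hz => by
      have e1 := le_supConv (x := x) hε hg hz
      have e2 : (x - z) ^ 2 / (2 * ε) ≤ (y - z) ^ 2 / (2 * ε) + ℓ / ε * |y - x| := by
        rw [show (y - z) ^ 2 / (2 * ε) + ℓ / ε * |y - x| =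
          ((y - z) ^ 2 + 2 * ℓ * |y - x|) / (2 * ε) by field_simp]
        gcongr
        have h1 : |(x - y) * (x + y - 2 * z)| ≤ |y - x| * (2 * ℓ) := by
          rw [abs_mul, abs_sub_comm x y]
          refine mul_le_mul_of_nonneg_left (abs_le.2 ⟨?_, ?_⟩) (abs_nonneg _) <;>
            linarith [hx.1, hx.2, hy.1, hy.2, hz.1, hz.2]
        nlinarith [(abs_le.1 h1).2]
      linarith
  have e1 := aux x hx y hy
  have e2 := aux y hy x hx
  rw [abs_sub_comm] at e2
  exact abs_le.2 ⟨by linarith, by linarith⟩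

theorem supConv_le_add (hℓ : 0 < ℓ) (hε : 0 < ε) {K z : ℝ}
    (h : ∀ y ∈ Ioo 0 ℓ, g y ≤ z + K * |y - x|) : supConv g ℓ ε x ≤ z + K ^ 2 * ε / 2 :=
  supConv_le hℓ fun y hy => by
    have e1 := h y hy
    have e2 : K * |y - x| ≤ (x - y) ^ 2 / (2 * ε) + K ^ 2 * ε / 2 := by
      rw [show (x - y) ^ 2 / (2 * ε) + K ^ 2 * ε / 2 =
        (|y - x| ^ 2 + (K * ε) ^ 2) / (2 * ε) by rw [sq_abs]; field_simp; ring,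
        le_div_iff₀ (by positivity)]
      nlinarith [sq_nonneg (|y - x| - K * ε)]
    linarith

end supConv

/-- Concave Lipschitz data with bounded second differences, approximating `ψ` from below. -/
theorem exists_data {ψ : ℝ → ℝ} {ℓ ρ : ℝ} (hℓ : 0 < ℓ) (hρ : 0 < ρ)
    (hψ : ConcaveOn ℝ (Ioo 0 ℓ) ψ) (h0 : ∀ x ∈ Ioo 0 ℓ, 0 < ψ x) :
    ∃ (f : ℝ → ℝ) (K K' B : ℝ), 0 < K ∧ 0 ≤ K' ∧
      (∀ x ∈ Icc 0 ℓ, ∀ y ∈ Icc 0 ℓ, |f y - f x| ≤ K' * |y - x|) ∧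
      (∀ x s, f (x + s) + f (x - s) - 2 * f x ∈ Icc (-(B * s ^ 2)) 0) ∧
      (∀ x ∈ Ioo 0 ℓ, f x ≤ ψ x) ∧ (∀ x ∈ Icc 0 ℓ, f x ≤ K * x ∧ f x ≤ K * (ℓ - x)) ∧
      -ρ ≤ f 0 ∧ -ρ ≤ f ℓ ∧ ∀ x, ρ ≤ x → x ≤ ℓ - ρ → ψ x - ρ ≤ f x := by
  have hm : ℓ / 2 ∈ Ioo 0 ℓ := ⟨by linarith, by linarith⟩
  have hM := h0 _ hm
  set M := 2 * ψ (ℓ / 2)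
  have hM : 0 < M := by positivity
  set K := M / ρ
  have hK : 0 < K := by positivity
  set ε := ρ / K ^ 2
  have hε : 0 < ε := by positivity
  have hKε : K ^ 2 * ε / 2 = ρ / 2 := by simp only [ε]; field_simp
  set g := truncation ψ ℓ K
  have hgψ : ∀ x, g x ≤ ψ x := fun x => min_le_left _ _
  have h0' : ∀ x ∈ Ioo 0 ℓ, 0 ≤ ψ x := fun x hx => (h0 x hx).le
  have hg : ∀ y ∈ Ioo 0 ℓ, g y ≤ M := fun y hy => (hgψ y).trans (concave_le hψ h0' hy)
  have hg0 : ∀ y ∈ Ioo 0 ℓ, 0 < g y := fun y hy => truncation_pos hK h0 hy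
  have hend : ∀ x y, y ∈ Ioo 0 ℓ → (x - y) ^ 2 ≤ ε * ρ → -ρ ≤ supConv g ℓ ε x - ρ / 2 := by
    intro x y hy hxy
    have e1 := le_supConv (x := x) hε hg hy
    have e2 : (x - y) ^ 2 / (2 * ε) ≤ ρ / 2 := by
      rw [div_le_iff₀ (by positivity)]
      linarith
    linarith [hg0 y hy]
  obtain ⟨y, hy, hy1, hyε⟩ : ∃ y ∈ Ioo 0 ℓ, y ≤ 1 ∧ y ≤ ε * ρ :=
    ⟨min (ℓ / 2) (min 1 (ε * ρ)), ⟨by positivity, (min_le_left _ _).trans_lt (by linarith)⟩,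
      (min_le_right _ _).trans (min_le_left _ _), (min_le_right _ _).trans (min_le_right _ _)⟩
  have hy2 : y ^ 2 ≤ ε * ρ := by nlinarith [hy.1]
  refine ⟨fun x => supConv g ℓ ε x - ρ / 2, K, ℓ / ε, 1 / ε, hK, by positivity, fun x hx y hy => ?_,
    fun x s => ?_, fun x hx => ?_, fun x hx => ⟨?_, ?_⟩, hend 0 y hy (by simpa using hy2),
    hend ℓ (ℓ - y) ⟨by linarith [hy.2], by linarith [hy.1]⟩ (by simpa using hy2),
    fun x hx hx' => ?_⟩
  · simpa using supConv_lipschitz hℓ hε hg hx hy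
  · have := supConv_second_diff (x := x) hℓ hε hg (truncation_concave hψ K) s
    rwa [show supConv g ℓ ε (x + s) - ρ / 2 + (supConv g ℓ ε (x - s) - ρ / 2) -
      2 * (supConv g ℓ ε x - ρ / 2) = supConv g ℓ ε (x + s) + supConv g ℓ ε (x - s) -
      2 * supConv g ℓ ε x by ring]
  · have := supConv_le_add (x := x) (K := K) (g := g) (z := g x) hℓ hε fun y hy => by
      linarith [truncation_sub_le hψ hK h0 hx hy]
    linarith [hgψ x]
  · have := supConv_le_add (g := g) (x := x) (K := K) (z := K * x) hℓ hε fun y hy => by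
      have e1 : g y ≤ K * y := (min_le_right _ _).trans (min_le_left _ _)
      nlinarith [le_abs_self (y - x)]
    linarith
  · have := supConv_le_add (g := g) (x := x) (K := K) (z := K * (ℓ - x)) hℓ hε fun y hy => by
      have e1 : g y ≤ K * (ℓ - y) := (min_le_right _ _).trans (min_le_right _ _)
      nlinarith [neg_abs_le (y - x)]
    linarith
  · have hx0 : x ∈ Ioo 0 ℓ := ⟨by linarith, by linarith⟩
    have e1 := le_supConv (x := x) hε hg hx0
    have e2 := concave_le hψ h0' hx0
    have e3 : K * ρ = M := by simp only [K]; field_simp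
    have e4 : g x = ψ x := min_eq_left (le_min (by nlinarith) (by nlinarith))
    simp only [sub_self, e4] at e1
    norm_num at e1
    linarith

/-- Classical solutions below `ψ`, with errors at most `ρ` at the boundary and initially. -/
structure Approx (α A ψ : ℝ → ℝ) (ℓ M ρ : ℝ) (U u v : ℝ → ℝ → ℝ) : Prop where
  continuousOn : ContinuousOn (fun p : ℝ × ℝ => u p.1 p.2) (Icc 0 ℓ ×ˢ Ici 0)
  upper : ∃ K, 0 < K ∧ ∀ x ∈ Icc 0 ℓ, ∀ t, 0 ≤ t → u x t ≤ K * x ∧ u x t ≤ K * (ℓ - x)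
  le_data : ∀ x ∈ Ioo 0 ℓ, ∀ t, 0 ≤ t → u x t ≤ ψ x
  lower : ∀ x ∈ Ioo 0 ℓ, ∀ t, 0 ≤ t → -ρ ≤ u x t
  datum_eq : ∀ x, ρ ≤ x → x ≤ ℓ - ρ → ψ x - ρ ≤ u x 0
  slope : ∀ x ∈ Ioo 0 ℓ, ∀ t, 0 ≤ t → v x t * x ≤ M + ρ ∧ -(M + ρ) ≤ v x t * (ℓ - x)
  cyl : ∀ K l c x₀ t₀ r, 0 < r → 0 < l → (∀ p, |p| ≤ K → α p ∈ Icc l c) → 0 < x₀ - r →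
    x₀ + r < ℓ → 0 < t₀ - r ^ 2 → (∀ x ∈ Icc (x₀ - r) (x₀ + r), ∀ t, 0 ≤ t → |v x t| ≤ K) →
    CylSol α A U u v K l c x₀ t₀ r

theorem exists_bounds {α : ℝ → ℝ} (hα : Continuous α) (hpos : ∀ p, 0 < α p) {K : ℝ}
    (hK : 0 ≤ K) : ∃ l c, 0 < l ∧ 0 < c ∧ ∀ p, |p| ≤ K → α p ∈ Icc l c := by
  have hne : (Icc (-K) K).Nonempty := nonempty_Icc.2 (by linarith)
  obtain ⟨a, -, h1⟩ := isCompact_Icc.exists_isMinOn hne hα.continuousOn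
  obtain ⟨b, -, h2⟩ := isCompact_Icc.exists_isMaxOn hne hα.continuousOn
  exact ⟨α a, α b, hpos a, hpos b, fun p hp => ⟨h1 (abs_le.1 hp), h2 (abs_le.1 hp)⟩⟩

theorem Interp.continuousOn {A f : ℝ → ℝ} {ℓ K B l c : ℝ} {U u v : ℝ → ℝ → ℝ}
    (H : Interp A f ℓ K B l c 0 id id U u v) :
    ContinuousOn (fun p : ℝ × ℝ => u p.1 p.2) (Icc 0 ℓ ×ˢ Ici 0) := by
  rintro ⟨x, t⟩ ⟨hx, ht⟩
  have ht : 0 ≤ t := ht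
  rw [ContinuousWithinAt, tendsto_iff_norm_sub_tendsto_zero]
  have hc : Continuous fun p : ℝ × ℝ => K * |p.1 - x| + |B| * |p.2 - t| := by fun_prop
  refine squeeze_zero' (.of_forall fun _ => norm_nonneg _) ?_
    (by simpa using (hc.tendsto (x, t)).mono_left nhdsWithin_le_nhds)
  filter_upwards [self_mem_nhdsWithin] with q hq
  have hq2 : 0 ≤ q.2 := hq.2
  have e1 := H.lipschitz hx hq.1 hq2
  have e2 : |u x q.2 - u x t| ≤ |B| * |q.2 - t| := by
    rcases le_total q.2 t with h | h
    · have := H.time x hx q.2 t hq2 h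
      simp only [id, mem_Icc] at this
      rw [abs_of_nonpos (a := q.2 - t) (by linarith)]
      have hB := mul_le_mul_of_nonneg_right (le_abs_self B) (sub_nonneg.2 h)
      exact abs_le.2 ⟨by nlinarith [abs_nonneg B], by linarith⟩
    · have := H.time x hx t q.2 ht h
      simp only [id, mem_Icc] at this
      rw [abs_of_nonneg (a := q.2 - t) (by linarith)]
      have hB := mul_le_mul_of_nonneg_right (le_abs_self B) (sub_nonneg.2 h)
      exact abs_le.2 ⟨by linarith, by nlinarith [abs_nonneg B]⟩
  have := abs_add_le (u q.1 q.2 - u x q.2) (u x q.2 - u x t)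
  rw [sub_add_sub_cancel] at this
  exact this.trans (add_le_add e1 e2)

theorem exists_approx {α A ψ : ℝ → ℝ} {ℓ ρ : ℝ} (hα : Continuous α) (hpos : ∀ p, 0 < α p)
    (hA : ∀ p, HasDerivAt A (α p) p) (hA0 : A 0 = 0) (hℓ : 0 < ℓ) (hρ : 0 < ρ)
    (hψ : ConcaveOn ℝ (Ioo 0 ℓ) ψ) (h0 : ∀ x ∈ Ioo 0 ℓ, 0 < ψ x) :
    ∃ U u v, Approx α A ψ ℓ (2 * ψ (ℓ / 2)) ρ U u v := by
  obtain ⟨f, K₀, K, B, hK₀, hK, hlip, hsd, hfψ, hfK, hf0, hfℓ, hdatum⟩ := exists_data hℓ hρ hψ h0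
  obtain ⟨l, c, hl, hc, hlc⟩ := exists_bounds hα hpos hK
  obtain ⟨U, u, v, H⟩ := exists_limit hℓ hl hA hA0 hK hlc hlip fun x s _ _ _ => hsd x s
  have hM : ∀ x ∈ Ioo 0 ℓ, ψ x ≤ 2 * ψ (ℓ / 2) := fun x hx =>
    concave_le hψ (fun x hx => (h0 x hx).le) hx
  have huf : ∀ x ∈ Icc 0 ℓ, ∀ t, 0 ≤ t → u x t ≤ f x := fun x hx t ht => by
    have h1 := (H.time x hx 0 t le_rfl ht).2
    have h2 := H.datum_eq x hx
    simp only [id] at h2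
    linarith
  have hr : ∀ x ∈ Ioo 0 ℓ, ∀ t, 0 ≤ t → u ℓ t - u x t ≤ v x t * (ℓ - x) := fun x hx t ht => by
    have h1 := (H.taylor x ℓ t hx.1.le hx.2 hx.2.le le_rfl ht).2
    simp only [id] at h1
    linarith
  have hl' : ∀ x ∈ Ioo 0 ℓ, ∀ t, 0 ≤ t → v x t * x ≤ u x t - u 0 t := fun x hx t ht => by
    have h1 := H.slope_le 0 x t le_rfl hx.1.le hx.2 ht
    simpa only [id, sub_zero] using h1
  have hb0 : ∀ t, 0 ≤ t → -ρ ≤ u 0 t := fun t ht => by rw [H.left t ht]; exact hf0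
  have hbℓ : ∀ t, 0 ≤ t → -ρ ≤ u ℓ t := fun t ht => by rw [H.right t ht]; exact hfℓ
  have hle : ∀ x ∈ Ioo 0 ℓ, ∀ t, 0 ≤ t → u x t ≤ ψ x := fun x hx t ht =>
    (huf x (Ioo_subset_Icc_self hx) t ht).trans (hfψ x hx)
  refine ⟨U, u, v, H.continuousOn, ⟨K₀, hK₀, fun x hx t ht => ?_⟩, hle, fun x hx t ht => ?_,
    fun x hx hx' => ?_, fun x hx t ht => ?_,
    fun K' l' c' x₀ t₀ r hr hl' hα' hx hx' ht hv => H.cylSol hA hA0 hl hK hlc hr hl' hα' hx hx' ht hv⟩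
  · have := huf x hx t ht
    exact ⟨this.trans (hfK x hx).1, this.trans (hfK x hx).2⟩
  · have e1 := hr x hx t ht
    have e2 := hl' x hx t ht
    have e3 := hb0 t ht
    have e4 := hbℓ t ht
    have hx2 := sub_pos.2 hx.2
    refine le_of_mul_le_mul_left (a := ℓ) ?_ hℓ
    nlinarith [mul_le_mul_of_nonneg_left e1 hx.1.le, mul_le_mul_of_nonneg_left e2 hx2.le,
      mul_le_mul_of_nonneg_left e3 hx2.le, mul_le_mul_of_nonneg_left e4 hx.1.le]
  · have h2 := H.datum_eq x ⟨by linarith, by linarith⟩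
    simp only [id] at h2
    rw [h2]
    exact hdatum x hx hx'
  · have e1 := hr x hx t ht
    have e2 := hl' x hx t ht
    have e3 := hb0 t ht
    have e4 := hbℓ t ht
    have e5 := (hle x hx t ht).trans (hM x hx)
    exact ⟨by linarith, by linarith⟩

section
variable {α A ψ : ℝ → ℝ} {ℓ M ρ d : ℝ} {U u v : ℝ → ℝ → ℝ}

theorem Approx.slope_bound (h : Approx α A ψ ℓ M ρ U u v) (hM : 0 ≤ M) (hρ1 : ρ ≤ 1)
    (hd : 0 < d) {x t : ℝ} (hx : d ≤ x) (hx' : x ≤ ℓ - d) (ht : 0 ≤ t) :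
    |v x t| ≤ (M + 1) / d := by
  obtain ⟨e1, e2⟩ := h.slope x ⟨by linarith, by linarith⟩ t ht
  have h1 : 0 < x := by linarith
  have h2 : 0 < ℓ - x := by linarith
  have hb : 0 ≤ (M + 1) / d := by positivity
  have hb' : (M + 1) / d * d = M + 1 := by field_simp
  refine abs_le.2 ⟨?_, ?_⟩
  · refine le_of_mul_le_mul_right (a := ℓ - x) ?_ h2
    nlinarith [mul_le_mul_of_nonneg_left (show d ≤ ℓ - x by linarith) hb]
  · refine le_of_mul_le_mul_right (a := x) ?_ h1
    nlinarith [mul_le_mul_of_nonneg_left hx hb]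

theorem Expansion.mono {n n' : ℝ → ℝ → ℝ} {C r r' a b : ℝ} (h : Expansion A u v n C r a b d)
    (hr' : 0 < r') (hr : r' ≤ r) (hn : ∀ x ∈ Ioo a b, ∀ t, d < t → n' x t = n x t) :
    Expansion A u v n' C r' a b d where
  rpos := hr'
  bound_v := h.bound_v
  bound_n x hx t ht := by rw [hn x hx t ht]; exact h.bound_n x hx t ht
  space x hx t ht y hy := h.space x hx t ht y (hy.trans hr)
  flux x hx t ht ρ y s h1 h2 := by
    rw [hn x hx t ht]
    exact h.flux x hx t ht ρ y s h1 (h2.trans hr)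
  time x hx t ρ h1 h2 h3 := by
    rw [hn x hx t (by nlinarith)]
    exact h.time x hx t ρ h1 (h2.trans hr) h3

theorem exists_uniform_expansion (hα : Continuous α) (hpos : ∀ p, 0 < α p) (hM : 0 ≤ M)
    (hd : 0 < d) : ∃ C r, 0 < C ∧ 0 < r ∧ r < d ∧ r ^ 2 < d ∧
      ∀ ρ U u v, 0 < ρ → ρ ≤ 1 → Approx α A ψ ℓ M ρ U u v →
        Expansion A u v (fun x t => deriv (fun s => u x s) t) C r d (ℓ - d) d := by
  have hK : 0 ≤ (M + 1) / (d / 2) := by positivity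
  obtain ⟨l, c, hl, hc, hlc⟩ := exists_bounds hα hpos hK
  obtain ⟨r, hr, hr1, hr2⟩ : ∃ r : ℝ, 0 < r ∧ r ≤ d / 2 ∧ r ≤ 1 :=
    ⟨min (d / 2) 1, by positivity, min_le_left _ _, min_le_right _ _⟩
  obtain ⟨C, r₁, hC, hr₁, H⟩ := exists_pkg hα hK hl hc hr
  refine ⟨C, min r₁ r, hC, lt_min hr₁ hr, by linarith [min_le_right r₁ r], ?_,
    fun ρ U u v hρ hρ1 hu => ?_⟩
  · have := min_le_right r₁ r
    have := lt_min hr₁ hr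
    nlinarith
  · obtain ⟨n, hn⟩ := H A U u v d (ℓ - d) d fun x hx t ht =>
      hu.cyl _ l c x t r hr hl hlc (by linarith [hx.1]) (by linarith [hx.2]) (by nlinarith)
        fun y hy s hs => hu.slope_bound hM hρ1 (by positivity) (by linarith [hy.1, hx.1])
          (by linarith [hy.2, hx.2]) hs
    exact hn.mono (lt_min hr₁ hr) (min_le_left _ _) fun x hx t ht => (hn.hasDerivAt_time hx ht).deriv

end

/-- `u` solves `∂ₜu = α(∂ₓu) ∂²ₓu` on `(0, ℓ) × (0, ∞)`, with `v = ∂ₓu` and `n = ∂ₜu`. -/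
structure Classical (α : ℝ → ℝ) (ℓ : ℝ) (u v n : ℝ → ℝ → ℝ) : Prop where
  space : ∀ x ∈ Ioo 0 ℓ, ∀ t, 0 < t → HasDerivAt (fun y => u y t) (v x t) x
  slope : ∀ x ∈ Ioo 0 ℓ, ∀ t, 0 < t → HasDerivAt (fun y => v y t) (n x t / α (v x t)) x
  time : ∀ x ∈ Ioo 0 ℓ, ∀ t, 0 < t → HasDerivAt (fun s => u x s) (n x t) t
  cont_u : ∀ x ∈ Ioo 0 ℓ, ∀ t, 0 < t → ContinuousAt (fun p : ℝ × ℝ => u p.1 p.2) (x, t)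
  cont_v : ∀ x ∈ Ioo 0 ℓ, ∀ t, 0 < t → ContinuousAt (fun p : ℝ × ℝ => v p.1 p.2) (x, t)
  cont_n : ∀ x ∈ Ioo 0 ℓ, ∀ t, 0 < t → ContinuousAt (fun p : ℝ × ℝ => n p.1 p.2) (x, t)

theorem exists_margin {ℓ x t : ℝ} (hx : x ∈ Ioo 0 ℓ) (ht : 0 < t) :
    ∃ d, 0 < d ∧ x ∈ Ioo d (ℓ - d) ∧ d < t := by
  have hx2 := sub_pos.2 hx.2
  have hx1 := hx.1
  have h1 := (min_le_left (min x (ℓ - x)) t).trans (min_le_left _ _)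
  have h2 := (min_le_left (min x (ℓ - x)) t).trans (min_le_right _ _)
  have h3 := min_le_right (min x (ℓ - x)) t
  have h4 : 0 < min (min x (ℓ - x)) t := by positivity
  exact ⟨min (min x (ℓ - x)) t / 2, by positivity, ⟨by linarith, by linarith⟩, by linarith⟩

theorem Classical.of_expansions {α A : ℝ → ℝ} {ℓ : ℝ} {u v n : ℝ → ℝ → ℝ} (hα : Continuous α)
    (hpos : ∀ p, 0 < α p) (hA : ∀ p, HasDerivAt A (α p) p)
    (h : ∀ d, 0 < d → ∃ C r, Expansion A u v n C r d (ℓ - d) d) : Classical α ℓ u v n := by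
  have key : ∀ x ∈ Ioo 0 ℓ, ∀ t, 0 < t → ∃ C r d, Expansion A u v n C r d (ℓ - d) d ∧
      x ∈ Ioo d (ℓ - d) ∧ d < t := fun x hx t ht => by
    obtain ⟨d, hd, hxd, htd⟩ := exists_margin hx ht
    obtain ⟨C, r, hE⟩ := h d hd
    exact ⟨C, r, d, hE, hxd, htd⟩
  refine ⟨fun x hx t ht => ?_, fun x hx t ht => ?_, fun x hx t ht => ?_, fun x hx t ht => ?_,
    fun x hx t ht => ?_, fun x hx t ht => ?_⟩ <;> obtain ⟨C, r, d, hE, hx', ht'⟩ := key x hx t ht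
  · exact hE.hasDerivAt_u hx' ht'
  · exact hasDerivAt_of_comp hα hA hpos (hE.hasDerivAt_flux hx' ht')
  · exact hE.hasDerivAt_time hx' ht'
  · exact hE.continuousAt_u hx' ht'
  · exact hE.continuousAt_v hA hpos hx' ht'
  · exact hE.continuousAt_n hx' ht'

theorem Approx.classical {α A ψ : ℝ → ℝ} {ℓ M ρ : ℝ} {U u v : ℝ → ℝ → ℝ} (hα : Continuous α)
    (hpos : ∀ p, 0 < α p) (hA : ∀ p, HasDerivAt A (α p) p) (hM : 0 ≤ M) (hρ : 0 < ρ) (hρ1 : ρ ≤ 1)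
    (h : Approx α A ψ ℓ M ρ U u v) :
    Classical α ℓ u v fun x t => deriv (fun s => u x s) t :=
  .of_expansions hα hpos hA fun d hd => by
    obtain ⟨C, r, -, -, -, -, H⟩ := exists_uniform_expansion (ℓ := ℓ) (A := A) (ψ := ψ) hα hpos hM hd
    exact ⟨C, r, H ρ U u v hρ hρ1 h⟩

/-- Comparison principle: at a positive maximum of `p - q` the strict inequality fails. -/
theorem comparison {p q p1 q1 p2 q2 pt qt : ℝ → ℝ → ℝ} {a b T : ℝ}
    (hc : ContinuousOn (fun z : ℝ × ℝ => p z.1 z.2 - q z.1 z.2) (Icc a b ×ˢ Icc 0 T))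
    (hp1 : ∀ x ∈ Ioo a b, ∀ t ∈ Ioc 0 T, HasDerivAt (fun y => p y t) (p1 x t) x)
    (hq1 : ∀ x ∈ Ioo a b, ∀ t ∈ Ioc 0 T, HasDerivAt (fun y => q y t) (q1 x t) x)
    (hp2 : ∀ x ∈ Ioo a b, ∀ t ∈ Ioc 0 T, HasDerivAt (fun y => p1 y t) (p2 x t) x)
    (hq2 : ∀ x ∈ Ioo a b, ∀ t ∈ Ioc 0 T, HasDerivAt (fun y => q1 y t) (q2 x t) x)
    (hpt : ∀ x ∈ Ioo a b, ∀ t ∈ Ioc 0 T, HasDerivAt (fun s => p x s) (pt x t) t)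
    (hqt : ∀ x ∈ Ioo a b, ∀ t ∈ Ioc 0 T, HasDerivAt (fun s => q x s) (qt x t) t)
    (h0 : ∀ x ∈ Icc a b, p x 0 ≤ q x 0) (ha : ∀ t ∈ Icc 0 T, p a t ≤ q a t)
    (hb : ∀ t ∈ Icc 0 T, p b t ≤ q b t)
    (hlt : ∀ x ∈ Ioo a b, ∀ t ∈ Ioc 0 T, p1 x t = q1 x t → p2 x t ≤ q2 x t → pt x t < qt x t)
    {x t : ℝ} (hx : x ∈ Icc a b) (ht : t ∈ Icc 0 T) : p x t ≤ q x t := by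
  refine sub_nonpos.1 (nonpos_of_no_positive_max (isCompact_Icc.prod isCompact_Icc) hc ?_ (x, t)
    ⟨hx, ht⟩)
  rintro ⟨x, t⟩ ⟨hx, ht⟩ hpos hmax
  simp only at hx ht hpos hmax
  have hxa : a ≠ x := by
    rintro rfl
    linarith [ha t ht]
  have hxb : x ≠ b := by
    rintro rfl
    linarith [hb t ht]
  have ht0 : 0 ≠ t := by
    rintro rfl
    linarith [h0 x hx]
  have hx' : x ∈ Ioo a b := ⟨hx.1.lt_of_ne hxa, hx.2.lt_of_ne hxb⟩
  have ht' : t ∈ Ioc 0 T := ⟨ht.1.lt_of_ne ht0, ht.2⟩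
  have hnear : ∀ᶠ y in 𝓝 x, y ∈ Ioo a b := Ioo_mem_nhds hx'.1 hx'.2
  obtain ⟨e1, e2⟩ := isLocalMax_second_deriv (g := fun y => p y t - q y t)
    (g1 := fun y => p1 y t - q1 y t)
    (hnear.mono fun y hy => hmax (y, t) ⟨Ioo_subset_Icc_self hy, ht⟩)
    (hnear.mono fun y hy => (hp1 y hy t ht').sub (hq1 y hy t ht'))
    ((hp2 x hx' t ht').sub (hq2 x hx' t ht'))
  have e3 := deriv_nonneg_of_left_max ht'.1
    (fun s hs => hmax (x, s) ⟨hx, hs.1, hs.2.trans ht.2⟩) ((hpt x hx' t ht').sub (hqt x hx' t ht'))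
  linarith [hlt x hx' t ht' (by linarith) (by linarith)]

section
variable {α A ψ : ℝ → ℝ} {ℓ M ρ : ℝ} {U u v n : ℝ → ℝ → ℝ}

theorem Approx.le_supersolution (h : Approx α A ψ ℓ M ρ U u v) (hu : Classical α ℓ u v n)
    (hpos : ∀ p, 0 < α p) {φ φ1 φ2 φt : ℝ → ℝ → ℝ}
    (h0 : ∀ x ∈ Icc 0 ℓ, ∀ t, 0 ≤ t → 0 ≤ φ x t)
    (hc : ContinuousOn (fun p : ℝ × ℝ => φ p.1 p.2) (Ioo 0 ℓ ×ˢ Ici 0))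
    (h1 : ∀ x ∈ Ioo 0 ℓ, ∀ t, 0 < t → HasDerivAt (fun y => φ y t) (φ1 x t) x)
    (h2 : ∀ x ∈ Ioo 0 ℓ, ∀ t, 0 < t → HasDerivAt (fun y => φ1 y t) (φ2 x t) x)
    (ht : ∀ x ∈ Ioo 0 ℓ, ∀ t, 0 < t → HasDerivAt (fun s => φ x s) (φt x t) t)
    (hsup : ∀ x ∈ Ioo 0 ℓ, ∀ t, 0 < t → α (φ1 x t) * φ2 x t ≤ φt x t)
    (hψ : ∀ x ∈ Ioo 0 ℓ, ψ x ≤ φ x 0) {x t : ℝ} (hx : x ∈ Ioo 0 ℓ) (ht0 : 0 ≤ t) :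
    u x t ≤ φ x t := by
  obtain ⟨K, hK, hup⟩ := h.upper
  have key : ∀ κ, 0 < κ → u x t ≤ φ x t + (κ + κ * t) := by
    intro κ hκ
    have hφ := h0 x (Ioo_subset_Icc_self hx) t ht0
    have hκt : 0 ≤ κ * t := by positivity
    obtain ⟨u1, u2⟩ := hup x (Ioo_subset_Icc_self hx) t ht0
    have hKd : K * (κ / K) = κ := by field_simp
    have hd : 0 < κ / K := by positivity
    set d := κ / K
    by_cases hxd : x ∈ Icc d (ℓ - d)
    swap
    · rw [mem_Icc, not_and_or, not_le, not_le] at hxd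
      rcases hxd with hxd | hxd
      · nlinarith
      · nlinarith
    have hm : ∀ y ∈ Icc d (ℓ - d), y ∈ Ioo 0 ℓ := fun y hy =>
      ⟨hd.trans_le hy.1, by linarith [hy.2]⟩
    have hm' : ∀ y ∈ Ioo d (ℓ - d), y ∈ Ioo 0 ℓ := fun y hy => hm y (Ioo_subset_Icc_self hy)
    have hlat : ∀ y ∈ Ioo 0 ℓ, ∀ s, 0 ≤ s → u y s ≤ κ → u y s ≤ φ y s + (κ + κ * s) :=
      fun y hy s hs hus => by
        have := h0 y (Ioo_subset_Icc_self hy) s hs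
        have : 0 ≤ κ * s := by positivity
        linarith
    refine comparison (T := t) (p := u) (q := fun x t => φ x t + (κ + κ * t)) (p1 := v) (q1 := φ1)
      (p2 := fun x t => n x t / α (v x t)) (q2 := φ2) (pt := n) (qt := fun x t => φt x t + κ)
      (a := d) (b := ℓ - d) ?_
      (fun y hy s hs => hu.space y (hm' y hy) s hs.1)
      (fun y hy s hs => (h1 y (hm' y hy) s hs.1).add_const _)
      (fun y hy s hs => hu.slope y (hm' y hy) s hs.1)
      (fun y hy s hs => h2 y (hm' y hy) s hs.1)
      (fun y hy s hs => hu.time y (hm' y hy) s hs.1)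
      (fun y hy s hs => ((ht y (hm' y hy) s hs.1).add
        (((hasDerivAt_id s).const_mul κ).const_add κ)).congr_deriv (by simp))
      (fun y hy => ?_) (fun s hs => ?_) (fun s hs => ?_) (fun y hy s hs e1 e2 => ?_)
      hxd ⟨ht0, le_rfl⟩
    · refine (h.continuousOn.mono ?_).sub ((hc.mono ?_).add (by fun_prop))
      · exact fun z hz => ⟨Ioo_subset_Icc_self (hm _ hz.1), hz.2.1⟩
      · exact fun z hz => ⟨hm _ hz.1, hz.2.1⟩
    · have := h.le_data y (hm y hy) 0 le_rfl
      have := hψ y (hm y hy)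
      linarith
    · refine hlat d (hm d ⟨le_rfl, hxd.1.trans hxd.2⟩) s hs.1 ?_
      have := (hup d (Ioo_subset_Icc_self (hm d ⟨le_rfl, hxd.1.trans hxd.2⟩)) s hs.1).1
      linarith
    · have hb : ℓ - d ∈ Ioo 0 ℓ := hm _ ⟨hxd.1.trans hxd.2, le_rfl⟩
      refine hlat (ℓ - d) hb s hs.1 ?_
      have := (hup _ (Ioo_subset_Icc_self hb) s hs.1).2
      rw [sub_sub_cancel] at this
      linarith
    · have e3 := hsup y (hm' y hy) s hs.1
      rw [← e1] at e3
      rw [div_le_iff₀ (hpos _)] at e2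
      linarith
  have h1 : Tendsto (fun κ : ℝ => φ x t + (κ + κ * t)) (𝓝[>] 0) (𝓝 (φ x t)) := by
    have : Continuous fun κ : ℝ => φ x t + (κ + κ * t) := by fun_prop
    simpa using (this.tendsto 0).mono_left nhdsWithin_le_nhds
  refine ge_of_tendsto h1 ?_
  filter_upwards [self_mem_nhdsWithin] with κ hκ using key κ hκ

/-- Uniform lower barrier for the approximations at an interior point. -/
theorem exists_barrier (hα : Continuous α) (hpos : ∀ p, 0 < α p)
    (hψ : ConcaveOn ℝ (Ioo 0 ℓ) ψ) (h0 : ∀ x ∈ Ioo 0 ℓ, 0 < ψ x) {x₀ ε : ℝ} (hx₀ : x₀ ∈ Ioo 0 ℓ)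
    (hε : 0 < ε) : ∃ C ρ₀, 0 < ρ₀ ∧ ∀ A M ρ U u v n, ρ ≤ ρ₀ → Approx α A ψ ℓ M ρ U u v →
      Classical α ℓ u v n → ∀ t, 0 ≤ t → ψ x₀ - ε - C * t ≤ u x₀ t := by
  have h0' : ∀ x ∈ Ioo 0 ℓ, 0 ≤ ψ x := fun x hx => (h0 x hx).le
  have hx1 := hx₀.1
  have hx2 := sub_pos.2 hx₀.2
  obtain ⟨d, hd, hd1, hd2⟩ : ∃ d : ℝ, 0 < d ∧ 2 * d ≤ x₀ ∧ 2 * d ≤ ℓ - x₀ :=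
    ⟨min x₀ (ℓ - x₀) / 2, by positivity, by linarith [min_le_left x₀ (ℓ - x₀)],
      by linarith [min_le_right x₀ (ℓ - x₀)]⟩
  have hp := h0 x₀ hx₀
  set m := ψ x₀ / d
  have hm : 0 < m := by positivity
  have hmd : m * d = ψ x₀ := by simp only [m]; field_simp
  have hlow : ∀ x ∈ Icc (x₀ - d) (x₀ + d), ψ x₀ - m * |x - x₀| ≤ ψ x := fun x hx => by
    rcases le_total x x₀ with h | h
    · rw [abs_of_nonpos (by linarith)]
      have := concave_ratio hψ h0' (by linarith [hx.1]) h hx₀.2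
      refine le_of_mul_le_mul_left (a := x₀) ?_ hx1
      nlinarith [mul_le_mul_of_nonneg_left hd1 (mul_nonneg hm.le (sub_nonneg.2 h)),
        mul_nonneg hm.le (sub_nonneg.2 h)]
    · rw [abs_of_nonneg (by linarith)]
      have := concave_ratio' hψ h0' hx1 h (by linarith [hx.2])
      refine le_of_mul_le_mul_left (a := ℓ - x₀) ?_ hx2
      nlinarith [mul_le_mul_of_nonneg_left hd2 (mul_nonneg hm.le (sub_nonneg.2 h)),
        mul_nonneg hm.le (sub_nonneg.2 h)]
  set N := m ^ 2 / (2 * ε) + (ψ x₀ + 1) / d ^ 2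
  have hN : 0 < N := by positivity
  have hN1 : ∀ s, m * s ≤ ε / 2 + N * s ^ 2 := fun s => by
    have e : m * s ≤ ε / 2 + m ^ 2 / (2 * ε) * s ^ 2 := by
      rw [show ε / 2 + m ^ 2 / (2 * ε) * s ^ 2 = (ε ^ 2 + (m * s) ^ 2) / (2 * ε) by
        field_simp, le_div_iff₀ (by positivity)]
      nlinarith [sq_nonneg (ε - m * s)]
    have : 0 ≤ (ψ x₀ + 1) / d ^ 2 * s ^ 2 := by positivity
    have : N * s ^ 2 = m ^ 2 / (2 * ε) * s ^ 2 + (ψ x₀ + 1) / d ^ 2 * s ^ 2 := add_mul _ _ _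
    linarith
  have hN2 : ψ x₀ + 1 ≤ N * d ^ 2 := by
    have : 0 ≤ m ^ 2 / (2 * ε) * d ^ 2 := by positivity
    have : N * d ^ 2 = m ^ 2 / (2 * ε) * d ^ 2 + (ψ x₀ + 1) := by simp only [N]; field_simp
    linarith
  obtain ⟨l, c, hl, hc, hlc⟩ := exists_bounds hα hpos (K := 2 * N * d) (by positivity)
  refine ⟨2 * N * c + 1, min (ε / 2) (min 1 d), by positivity,
    fun A M ρ U u v n hρ h hu t ht => ?_⟩
  have hρ1 : ρ ≤ ε / 2 := hρ.trans (min_le_left _ _)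
  have hρ2 : ρ ≤ 1 := hρ.trans ((min_le_right _ _).trans (min_le_left _ _))
  have hρ3 : ρ ≤ d := hρ.trans ((min_le_right _ _).trans (min_le_right _ _))
  have hmem : ∀ x ∈ Icc (x₀ - d) (x₀ + d), x ∈ Ioo 0 ℓ := fun x hx =>
    ⟨by linarith [hx.1], by linarith [hx.2]⟩
  have hmem' : ∀ x ∈ Ioo (x₀ - d) (x₀ + d), x ∈ Ioo 0 ℓ := fun x hx =>
    hmem x (Ioo_subset_Icc_self hx)
  have hlat : ∀ x ∈ Icc (x₀ - d) (x₀ + d), (x - x₀) ^ 2 = d ^ 2 → ∀ s ∈ Icc 0 t,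
      ψ x₀ - ε - N * (x - x₀) ^ 2 - (2 * N * c + 1) * s ≤ u x s := fun x hx hxd s hs => by
    have := h.lower x (hmem x hx) s hs.1
    have : 0 ≤ (2 * N * c + 1) * s := mul_nonneg (by positivity) hs.1
    rw [hxd]
    linarith
  have key := comparison (T := t) (a := x₀ - d) (b := x₀ + d) (x := x₀) (t := t)
    (p := fun x t => ψ x₀ - ε - N * (x - x₀) ^ 2 - (2 * N * c + 1) * t) (q := u)
    (p1 := fun x _ => -(2 * N * (x - x₀))) (q1 := v) (p2 := fun _ _ => -(2 * N))
    (q2 := fun x t => n x t / α (v x t)) (pt := fun _ _ => -(2 * N * c + 1)) (qt := n)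
    (ContinuousOn.sub (by fun_prop) (h.continuousOn.mono fun z hz =>
      ⟨Ioo_subset_Icc_self (hmem _ hz.1), hz.2.1⟩))
    (fun y _ s _ => by
      have := (((((hasDerivAt_id y).sub_const x₀).pow 2).const_mul N).const_sub (ψ x₀ - ε)).sub_const
        ((2 * N * c + 1) * s)
      refine this.congr_deriv ?_
      simp only [id, Nat.cast_ofNat, Nat.add_one_sub_one, pow_one, mul_one]
      ring)
    (fun y hy s hs => hu.space y (hmem' y hy) s hs.1)
    (fun y _ s _ => by
      have := (((hasDerivAt_id y).sub_const x₀).const_mul (2 * N)).neg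
      refine this.congr_deriv ?_
      simp)
    (fun y hy s hs => hu.slope y (hmem' y hy) s hs.1)
    (fun y _ s _ => by
      have := ((hasDerivAt_id s).const_mul (2 * N * c + 1)).const_sub (ψ x₀ - ε - N * (y - x₀) ^ 2)
      refine this.congr_deriv ?_
      simp)
    (fun y hy s hs => hu.time y (hmem' y hy) s hs.1)
    (fun x hx => by
      have e1 := h.datum_eq x (by linarith [hx.1]) (by linarith [hx.2])
      have e2 := hlow x hx
      have e3 := hN1 |x - x₀|
      rw [sq_abs] at e3
      linarith)
    (hlat _ ⟨le_rfl, by linarith⟩ (by ring)) (hlat _ ⟨by linarith, le_rfl⟩ (by ring))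
    (fun x hx s hs e1 e2 => by
      have e3 : |v x s| ≤ 2 * N * d := by
        rw [← e1, abs_neg, abs_mul, abs_of_pos (show 0 < 2 * N by positivity)]
        exact mul_le_mul_of_nonneg_left (abs_le.2 ⟨by linarith [hx.1], by linarith [hx.2]⟩)
          (by positivity)
      have e4 := (hlc _ e3).2
      rw [le_div_iff₀ (hpos _)] at e2
      nlinarith)
    ⟨by linarith, by linarith⟩ ⟨ht, le_rfl⟩
  simpa using key

end

theorem continuousOn_of_barrier {ψ : ℝ → ℝ} {ℓ : ℝ} {u v : ℝ → ℝ → ℝ}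
    (hψ : ContinuousOn ψ (Ioo 0 ℓ))
    (hcont : ∀ x ∈ Ioo 0 ℓ, ∀ t, 0 < t → ContinuousAt (fun p : ℝ × ℝ => u p.1 p.2) (x, t))
    (hle : ∀ x ∈ Ioo 0 ℓ, ∀ t, 0 ≤ t → u x t ≤ ψ x)
    (hbar : ∀ x ∈ Ioo 0 ℓ, ∀ ε, 0 < ε → ∃ C, ∀ t, 0 ≤ t → ψ x - ε - C * t ≤ u x t)
    (hder : ∀ x ∈ Ioo 0 ℓ, ∀ t, 0 < t → HasDerivAt (fun y => u y t) (v x t) x)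
    (hv : ∀ d, 0 < d → ∃ B, ∀ x ∈ Icc d (ℓ - d), ∀ t, 0 < t → |v x t| ≤ B) :
    ContinuousOn (fun p : ℝ × ℝ => u p.1 p.2) (Ioo 0 ℓ ×ˢ Ici 0) := by
  rintro ⟨x, t⟩ ⟨hx, ht⟩
  rcases (show 0 ≤ t from ht).eq_or_lt with rfl | ht
  swap
  · exact (hcont x hx t ht).continuousWithinAt
  have hdatum : ∀ y ∈ Ioo 0 ℓ, u y 0 = ψ y := fun y hy =>
    le_antisymm (hle y hy 0 le_rfl) (le_of_forall_pos_le_add fun ε hε => by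
      obtain ⟨C, hC⟩ := hbar y hy ε hε
      linarith [hC 0 le_rfl])
  obtain ⟨d, hd, hxd, -⟩ := exists_margin hx one_pos
  obtain ⟨B, hB⟩ := hv d hd
  have hψx : ContinuousAt ψ x := hψ.continuousAt (Ioo_mem_nhds hx.1 hx.2)
  have hfst : Tendsto (fun p : ℝ × ℝ => ψ p.1) (𝓝[Ioo 0 ℓ ×ˢ Ici 0] (x, 0)) (𝓝 (ψ x)) :=
    (hψx.tendsto.comp (continuous_fst.tendsto (x, (0 : ℝ)))).mono_left nhdsWithin_le_nhds
  rw [ContinuousWithinAt]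
  simp only [hdatum x hx]
  refine tendsto_order.2 ⟨fun a ha => ?_, fun a ha => ?_⟩
  · obtain ⟨C, hC⟩ := hbar x hx ((ψ x - a) / 2) (by linarith)
    have hc : Continuous fun p : ℝ × ℝ =>
      ψ x - (ψ x - a) / 2 - C * p.2 - B * |p.1 - x| := by fun_prop
    have h1 := ((hc.tendsto (x, 0)).mono_left
      (nhdsWithin_le_nhds (s := Ioo 0 ℓ ×ˢ Ici 0))).eventually_const_lt (u := a) (by
        simp only [mul_zero, sub_self, abs_zero, sub_zero]; linarith)
    have h2 : ∀ᶠ p : ℝ × ℝ in 𝓝[Ioo 0 ℓ ×ˢ Ici 0] (x, 0), p.1 ∈ Ioo d (ℓ - d) :=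
      (continuous_fst.continuousAt.eventually_mem (Ioo_mem_nhds hxd.1 hxd.2)).filter_mono
        nhdsWithin_le_nhds
    filter_upwards [h1, h2, hfst.eventually_const_lt ha, self_mem_nhdsWithin] with p h1 h2 h3 h4
    rcases (show 0 ≤ p.2 from h4.2).eq_or_lt with h5 | h5
    · rw [← h5, hdatum _ h4.1]
      exact h3
    · have hsub : ∀ y ∈ uIcc x p.1, y ∈ Icc d (ℓ - d) := fun y hy =>
        (uIcc_subset_Icc (Ioo_subset_Icc_self hxd) (Ioo_subset_Icc_self h2)) hy
      have e := abs_sub_le_of_hasDerivAt (g := fun y => u y p.2) (g' := fun y => v y p.2)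
        (a := x) (b := p.1) (B := B)
        (fun y hy => hder y ⟨hd.trans_le (hsub y hy).1, by linarith [(hsub y hy).2]⟩ p.2 h5)
        (fun y hy => hB y (hsub y hy) p.2 h5)
      have := hC p.2 h5.le
      linarith [(abs_le.1 e).1]
  · filter_upwards [hfst.eventually_lt_const ha, self_mem_nhdsWithin] with p h1 h2
    exact (hle _ h2.1 _ h2.2).trans_lt h1

theorem exists_solution {α ψ : ℝ → ℝ} {L : ℝ} (hα : Continuous α) (hpos : ∀ p, 0 < α p)
    (hL : 0 < L) (hψc : ContinuousOn ψ (Ioo 0 (L / 2))) (hψ : ConcaveOn ℝ (Ioo 0 (L / 2)) ψ)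
    (h0 : ∀ x ∈ Ioo 0 (L / 2), 0 < ψ x) :
    ∃ u v n : ℝ → ℝ → ℝ, Classical α (L / 2) u v n ∧
      ContinuousOn (fun p : ℝ × ℝ => u p.1 p.2) (Ioo 0 (L / 2) ×ˢ Ici 0) ∧
      (∀ x ∈ Ioo 0 (L / 2), ∀ t, 0 ≤ t → 0 ≤ u x t) ∧ (∀ x ∈ Ioo 0 (L / 2), ψ x ≤ u x 0) ∧
      ∀ φ, MemS α L ψ φ → ∀ x ∈ Ioo 0 (L / 2), ∀ t, 0 ≤ t → u x t ≤ φ x t := by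
  have hℓ : 0 < L / 2 := by positivity
  set ℓ := L / 2
  have hA : ∀ p, HasDerivAt (fun p => ∫ s in (0 : ℝ)..p, α s) (α p) p := fun p =>
    intervalIntegral.integral_hasDerivAt_right (hα.intervalIntegrable _ _)
      (hα.stronglyMeasurableAtFilter _ _) hα.continuousAt
  have hA0 : (fun p => ∫ s in (0 : ℝ)..p, α s) 0 = 0 := by simp
  set A := fun p => ∫ s in (0 : ℝ)..p, α s
  have hAc : Continuous A := continuous_iff_continuousAt.2 fun p => (hA p).continuousAt
  have hM : 0 ≤ 2 * ψ (ℓ / 2) := by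
    have := h0 (ℓ / 2) ⟨by linarith, by linarith⟩
    positivity
  set M := 2 * ψ (ℓ / 2)
  set ρ : ℕ → ℝ := fun i => 1 / ((i : ℝ) + 1)
  have hρ : ∀ i, 0 < ρ i := fun i => by positivity
  have hρ1 : ∀ i, ρ i ≤ 1 := fun i => by
    rw [div_le_one (by positivity)]
    linarith [i.cast_nonneg (α := ℝ)]
  have hρ0 : Tendsto ρ (hyperfilter ℕ : Filter ℕ) (𝓝 0) :=
    tendsto_one_div_add_atTop_nhds_zero_nat.mono_left Nat.hyperfilter_le_atTop
  choose Ui ui vi H using fun i => exists_approx (ρ := ρ i) hα hpos hA hA0 hℓ (hρ i) hψ h0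
  have hcl := fun i => (H i).classical hα hpos hA hM (hρ i) (hρ1 i)
  set ni := fun i x t => deriv (fun s => ui i x s) t
  have hψM : ∀ x ∈ Ioo 0 ℓ, ψ x ≤ M := fun x hx => concave_le hψ (fun x hx => (h0 x hx).le) hx
  have hulim : ∀ x t, ∃ a, x ∈ Ioo 0 ℓ → 0 ≤ t →
      Tendsto (fun i => ui i x t) (hyperfilter ℕ) (𝓝 a) := fun x t => by
    by_cases h : x ∈ Ioo 0 ℓ ∧ 0 ≤ t
    · obtain ⟨a, -, ha⟩ := exists_ultrafilter_lim (F := hyperfilter ℕ) (f := fun i => ui i x t)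
        (C := M + 1) (.of_forall fun i => abs_le.2
          ⟨by linarith [(H i).lower x h.1 t h.2, hρ1 i],
            by linarith [(H i).le_data x h.1 t h.2, hψM x h.1]⟩)
      exact ⟨a, fun _ _ => ha⟩
    · exact ⟨0, fun h1 h2 => absurd ⟨h1, h2⟩ h⟩
  have hvlim : ∀ x t, ∃ a, x ∈ Ioo 0 ℓ → 0 < t →
      Tendsto (fun i => vi i x t) (hyperfilter ℕ) (𝓝 a) := fun x t => by
    by_cases h : x ∈ Ioo 0 ℓ ∧ 0 < t
    · obtain ⟨d, hd, hxd, -⟩ := exists_margin h.1 h.2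
      obtain ⟨a, -, ha⟩ := exists_ultrafilter_lim (F := hyperfilter ℕ) (f := fun i => vi i x t)
        (.of_forall fun i => (H i).slope_bound hM (hρ1 i) hd hxd.1.le hxd.2.le h.2.le)
      exact ⟨a, fun _ _ => ha⟩
    · exact ⟨0, fun h1 h2 => absurd ⟨h1, h2⟩ h⟩
  have hexp := fun d (hd : 0 < d) =>
    exists_uniform_expansion (A := A) (ψ := ψ) (ℓ := ℓ) hα hpos hM hd
  have hnlim : ∀ x t, ∃ a, x ∈ Ioo 0 ℓ → 0 < t →
      Tendsto (fun i => ni i x t) (hyperfilter ℕ) (𝓝 a) := fun x t => by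
    by_cases h : x ∈ Ioo 0 ℓ ∧ 0 < t
    · obtain ⟨d, hd, hxd, htd⟩ := exists_margin h.1 h.2
      obtain ⟨C, r, -, -, -, -, hE⟩ := hexp d hd
      obtain ⟨a, -, ha⟩ := exists_ultrafilter_lim (F := hyperfilter ℕ) (f := fun i => ni i x t)
        (.of_forall fun i => (hE _ _ _ _ (hρ i) (hρ1 i) (H i)).bound_n x hxd t htd)
      exact ⟨a, fun _ _ => ha⟩
    · exact ⟨0, fun h1 h2 => absurd ⟨h1, h2⟩ h⟩
  choose u hu using hulim
  choose v hv using hvlim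
  choose n hn using hnlim
  have hsol : Classical α ℓ u v n := .of_expansions hα hpos hA fun d hd => by
    obtain ⟨C, r, -, -, hrd, hrd', hE⟩ := hexp d hd
    refine ⟨C, r, Expansion.of_tendsto (F := (hyperfilter ℕ : Filter ℕ)) (S := Ioo 0 ℓ) hAc
      (.of_forall fun i => hE _ _ _ _ (hρ i) (hρ1 i) (H i)) (fun x hx y hy => ?_) hd.le hrd'.le
      (fun x hx t ht => hu x t hx ht.le) (fun x hx t ht => hv x t hx ht)
      fun x hx t ht => hn x t ⟨hd.trans hx.1, by linarith [hx.2]⟩ (hd.trans ht)⟩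
    have := abs_le.1 hy
    exact ⟨by linarith [hx.1], by linarith [hx.2]⟩
  have hbar : ∀ x ∈ Ioo 0 ℓ, ∀ ε, 0 < ε → ∃ C, ∀ t, 0 ≤ t → ψ x - ε - C * t ≤ u x t :=
    fun x hx ε hε => by
      obtain ⟨C, ρ₀, hρ₀, hC⟩ := exists_barrier hα hpos hψ h0 hx hε
      exact ⟨C, fun t ht => ge_of_tendsto (hu x t hx ht)
        ((hρ0.eventually_le_const hρ₀).mono fun i hi => hC A M _ _ _ _ _ hi (H i) (hcl i) t ht)⟩
  refine ⟨u, v, n, hsol, continuousOn_of_barrier hψc hsol.cont_u (fun x hx t ht =>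
      le_of_tendsto (hu x t hx ht) (.of_forall fun i => (H i).le_data x hx t ht)) hbar hsol.space
      fun d hd => ⟨(M + 1) / d, fun x hx t ht => ?_⟩, fun x hx t ht => ?_, fun x hx => ?_,
      fun φ hφ x hx t ht => ?_⟩
  · exact le_of_tendsto (hv x t ⟨by linarith [hx.1], by linarith [hx.2]⟩ ht).abs
      (.of_forall fun i => (H i).slope_bound hM (hρ1 i) hd hx.1 hx.2 ht.le)
  · exact le_of_tendsto_of_tendsto (by simpa using hρ0.neg) (hu x t hx ht)
      (.of_forall fun i => (H i).lower x hx t ht)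
  · refine le_of_forall_pos_le_add fun ε hε => ?_
    obtain ⟨C, hC⟩ := hbar x hx ε hε
    linarith [hC 0 le_rfl]
  · obtain ⟨f1, f2, f3, f4, f5⟩ := hφ
    refine le_of_tendsto (hu x t hx ht) (.of_forall fun i =>
      (H i).le_supersolution (hcl i) hpos (φ := φ) (φ1 := pderivX φ) (φ2 := pderivXX φ)
        (φt := pderivT φ) (fun x hx t ht => f1 x t hx ht) (f2.mono ?_)
        (fun x hx t ht => (f3.2.1 (x, t) ⟨hx, ht⟩).hasDerivAt)
        (fun x hx t ht => (f3.2.2.1 (x, t) ⟨hx, ht⟩).hasDerivAt)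
        (fun x hx t ht => (f3.2.2.2.1 (x, t) ⟨hx, ht⟩).hasDerivAt)
        (fun x hx t ht => f4 x t hx ht) f5 hx ht)
    rintro ⟨y, s⟩ ⟨hy, hs⟩
    refine ⟨⟨Ioo_subset_Icc_self hy, hs⟩, ?_⟩
    simp only [mem_insert_iff, mem_singleton_iff, Prod.mk.injEq, not_or, not_and]
    exact ⟨fun h => absurd h hy.1.ne', fun h => absurd h hy.2.ne⟩

theorem regularOn_of_hasDerivAt {ℓ : ℝ} {u v w n : ℝ → ℝ → ℝ}
    (hv : ∀ x ∈ Ioo 0 ℓ, ∀ t, 0 < t → HasDerivAt (fun y => u y t) (v x t) x)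
    (hw : ∀ x ∈ Ioo 0 ℓ, ∀ t, 0 < t → HasDerivAt (fun y => v y t) (w x t) x)
    (hn : ∀ x ∈ Ioo 0 ℓ, ∀ t, 0 < t → HasDerivAt (fun s => u x s) (n x t) t)
    (hu' : ContinuousOn (fun p : ℝ × ℝ => u p.1 p.2) (Ioo 0 ℓ ×ˢ Ioi 0))
    (hv' : ContinuousOn (fun p : ℝ × ℝ => v p.1 p.2) (Ioo 0 ℓ ×ˢ Ioi 0))
    (hw' : ContinuousOn (fun p : ℝ × ℝ => w p.1 p.2) (Ioo 0 ℓ ×ˢ Ioi 0))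
    (hn' : ContinuousOn (fun p : ℝ × ℝ => n p.1 p.2) (Ioo 0 ℓ ×ˢ Ioi 0)) :
    RegularOn u (Ioo 0 ℓ ×ˢ Ioi 0) ∧ ∀ x ∈ Ioo 0 ℓ, ∀ t, 0 < t →
      pderivX u x t = v x t ∧ pderivXX u x t = w x t ∧ pderivT u x t = n x t := by
  have e1 : ∀ x ∈ Ioo 0 ℓ, ∀ t, 0 < t → pderivX u x t = v x t := fun x hx t ht =>
    (hv x hx t ht).deriv
  have h2 : ∀ x ∈ Ioo 0 ℓ, ∀ t, 0 < t → HasDerivAt (fun y => pderivX u y t) (w x t) x :=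
    fun x hx t ht => (hw x hx t ht).congr_of_eventuallyEq (by
      filter_upwards [Ioo_mem_nhds hx.1 hx.2] with y hy using e1 y hy t ht)
  have e2 : ∀ x ∈ Ioo 0 ℓ, ∀ t, 0 < t → pderivXX u x t = w x t := fun x hx t ht =>
    (h2 x hx t ht).deriv
  have e3 : ∀ x ∈ Ioo 0 ℓ, ∀ t, 0 < t → pderivT u x t = n x t := fun x hx t ht =>
    (hn x hx t ht).deriv
  exact ⟨⟨hu', fun p hp => (hv _ hp.1 _ hp.2).differentiableAt,
    fun p hp => (h2 _ hp.1 _ hp.2).differentiableAt,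
    fun p hp => (hn _ hp.1 _ hp.2).differentiableAt, hv'.congr fun p hp => e1 _ hp.1 _ hp.2,
    hw'.congr fun p hp => e2 _ hp.1 _ hp.2, hn'.congr fun p hp => e3 _ hp.1 _ hp.2⟩,
    fun x hx t ht => ⟨e1 x hx t ht, e2 x hx t ht, e3 x hx t ht⟩⟩

theorem Classical.continuousOn {α : ℝ → ℝ} {ℓ : ℝ} {u v n : ℝ → ℝ → ℝ} (hα : Continuous α)
    (hpos : ∀ p, 0 < α p) (H : Classical α ℓ u v n) :
    ContinuousOn (fun p : ℝ × ℝ => u p.1 p.2) (Ioo 0 ℓ ×ˢ Ioi 0) ∧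
    ContinuousOn (fun p : ℝ × ℝ => v p.1 p.2) (Ioo 0 ℓ ×ˢ Ioi 0) ∧
    ContinuousOn (fun p : ℝ × ℝ => n p.1 p.2 / α (v p.1 p.2)) (Ioo 0 ℓ ×ˢ Ioi 0) ∧
    ContinuousOn (fun p : ℝ × ℝ => n p.1 p.2) (Ioo 0 ℓ ×ˢ Ioi 0) := by
  have hv : ContinuousOn (fun p : ℝ × ℝ => v p.1 p.2) (Ioo 0 ℓ ×ˢ Ioi 0) :=
    fun p hp => (H.cont_v _ hp.1 _ hp.2).continuousWithinAt
  have hn : ContinuousOn (fun p : ℝ × ℝ => n p.1 p.2) (Ioo 0 ℓ ×ˢ Ioi 0) :=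
    fun p hp => (H.cont_n _ hp.1 _ hp.2).continuousWithinAt
  exact ⟨fun p hp => (H.cont_u _ hp.1 _ hp.2).continuousWithinAt, hv,
    hn.div (hα.comp_continuousOn hv) fun p _ => (hpos _).ne', hn⟩

/-- Parabolic dilation about the midpoint; it maps `[0, ℓ]` into `(0, ℓ)` when `μ < 1`. -/
noncomputable def dilate (u : ℝ → ℝ → ℝ) (ℓ μ x t : ℝ) : ℝ :=
  u (ℓ / 2 + μ * (x - ℓ / 2)) (μ ^ 2 * t)

theorem memS_dilate {α ψ : ℝ → ℝ} {L μ : ℝ} {u v n : ℝ → ℝ → ℝ} (hα : Continuous α)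
    (hpos : ∀ p, 0 < α p) (hL : 0 < L) (hψ : ConcaveOn ℝ (Ioo 0 (L / 2)) ψ)
    (h0 : ∀ x ∈ Ioo 0 (L / 2), 0 < ψ x) (H : Classical α (L / 2) u v n)
    (hc : ContinuousOn (fun p : ℝ × ℝ => u p.1 p.2) (Ioo 0 (L / 2) ×ˢ Ici 0))
    (hu0 : ∀ x ∈ Ioo 0 (L / 2), ∀ t, 0 ≤ t → 0 ≤ u x t) (hψu : ∀ x ∈ Ioo 0 (L / 2), ψ x ≤ u x 0)
    (hμ : 0 < μ) (hμ1 : μ < 1) : MemS α L ψ fun x t => dilate u (L / 2) μ x t / μ := by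
  have hℓ : 0 < L / 2 := by positivity
  set ℓ := L / 2
  have hm : ∀ x ∈ Icc 0 ℓ, ℓ / 2 + μ * (x - ℓ / 2) ∈ Ioo 0 ℓ := fun x hx =>
    ⟨by nlinarith [hx.1], by nlinarith [hx.2]⟩
  have hm' : ∀ x ∈ Ioo 0 ℓ, ℓ / 2 + μ * (x - ℓ / 2) ∈ Ioo 0 ℓ := fun x hx =>
    hm x (Ioo_subset_Icc_self hx)
  have ht' : ∀ t, 0 < t → 0 < μ ^ 2 * t := fun t ht => by positivity
  have hd : ∀ x : ℝ, HasDerivAt (fun y => ℓ / 2 + μ * (y - ℓ / 2)) μ x := fun x =>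
    ((((hasDerivAt_id x).sub_const (ℓ / 2)).const_mul μ).const_add (ℓ / 2)).congr_deriv (by simp)
  have hd' : ∀ t : ℝ, HasDerivAt (fun s => μ ^ 2 * s) (μ ^ 2) t := fun t =>
    ((hasDerivAt_id t).const_mul (μ ^ 2)).congr_deriv (by simp)
  have hD : Continuous fun p : ℝ × ℝ => (ℓ / 2 + μ * (p.1 - ℓ / 2), μ ^ 2 * p.2) := by fun_prop
  have hcomp : ∀ f : ℝ → ℝ → ℝ, ContinuousOn (fun p : ℝ × ℝ => f p.1 p.2) (Ioo 0 ℓ ×ˢ Ioi 0) →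
      ContinuousOn (fun p : ℝ × ℝ => dilate f ℓ μ p.1 p.2) (Ioo 0 ℓ ×ˢ Ioi 0) := fun f hf =>
    hf.comp hD.continuousOn fun p hp => ⟨hm' _ hp.1, ht' _ hp.2⟩
  obtain ⟨c1, c2, c3, c4⟩ := H.continuousOn hα hpos
  obtain ⟨hreg, hder⟩ := regularOn_of_hasDerivAt (ℓ := ℓ) (u := fun x t => dilate u ℓ μ x t / μ)
    (v := dilate v ℓ μ) (w := fun x t => dilate (fun x t => n x t / α (v x t)) ℓ μ x t * μ)
    (n := fun x t => dilate n ℓ μ x t * μ ^ 2 / μ)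
    (fun x hx t ht => ((HasDerivAt.comp (h₂ := fun z => u z (μ ^ 2 * t)) x
      (H.space _ (hm' x hx) _ (ht' t ht)) (hd x)).div_const μ).congr_deriv
      (mul_div_cancel_right₀ _ hμ.ne'))
    (fun x hx t ht => HasDerivAt.comp (h₂ := fun z => v z (μ ^ 2 * t)) x
      (H.slope _ (hm' x hx) _ (ht' t ht)) (hd x))
    (fun x hx t ht => ((H.time _ (hm' x hx) _ (ht' t ht)).comp t (hd' t)).div_const μ)
    ((hcomp u c1).div_const μ) (hcomp v c2) ((hcomp _ c3).mul continuousOn_const)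
    (((hcomp n c4).mul continuousOn_const).div_const μ)
  refine ⟨fun x t hx ht => div_nonneg (hu0 _ (hm x hx) _ (by positivity)) hμ.le, ?_, hreg,
    fun x t hx ht => ?_, fun x hx => ?_⟩
  · exact (hc.comp hD.continuousOn fun p hp =>
      ⟨hm _ hp.1.1, mul_nonneg (sq_nonneg μ) hp.1.2⟩).div_const μ
  · obtain ⟨d1, d2, d3⟩ := hder x hx t ht
    rw [d1, d2, d3]
    refine le_of_eq ?_
    have := (hpos (dilate v ℓ μ x t)).ne'
    change α (dilate v ℓ μ x t) * (dilate n ℓ μ x t / α (dilate v ℓ μ x t) * μ) =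
      dilate n ℓ μ x t * μ ^ 2 / μ
    field_simp
  · have e1 := hψu _ (hm' x hx)
    have hmid : ℓ / 2 ∈ Ioo 0 ℓ := ⟨by linarith, by linarith⟩
    have e2 := concave_combination hψ hmid hx (a := 1 - μ) (b := μ) (by linarith) hμ.le (by ring)
    rw [show (1 - μ) * (ℓ / 2) + μ * x = ℓ / 2 + μ * (x - ℓ / 2) by ring] at e2
    have e3 : 0 ≤ (1 - μ) * ψ (ℓ / 2) := mul_nonneg (by linarith) (h0 _ hmid).le
    change ψ x ≤ u (ℓ / 2 + μ * (x - ℓ / 2)) (μ ^ 2 * 0) / μ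
    rw [mul_zero, le_div_iff₀ hμ]
    linarith

theorem psiPlus_eq {α ψ : ℝ → ℝ} {L : ℝ} {u v n : ℝ → ℝ → ℝ} (hα : Continuous α)
    (hpos : ∀ p, 0 < α p) (hL : 0 < L) (hψ : ConcaveOn ℝ (Ioo 0 (L / 2)) ψ)
    (h0 : ∀ x ∈ Ioo 0 (L / 2), 0 < ψ x) (H : Classical α (L / 2) u v n)
    (hc : ContinuousOn (fun p : ℝ × ℝ => u p.1 p.2) (Ioo 0 (L / 2) ×ˢ Ici 0))
    (hu0 : ∀ x ∈ Ioo 0 (L / 2), ∀ t, 0 ≤ t → 0 ≤ u x t) (hψu : ∀ x ∈ Ioo 0 (L / 2), ψ x ≤ u x 0)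
    (hmin : ∀ φ, MemS α L ψ φ → ∀ x ∈ Ioo 0 (L / 2), ∀ t, 0 ≤ t → u x t ≤ φ x t)
    {x t : ℝ} (hx : x ∈ Ioo 0 (L / 2)) (ht : 0 < t) : psiPlus α L ψ x t = u x t := by
  have hS := fun μ hμ hμ1 => memS_dilate (μ := μ) hα hpos hL hψ h0 H hc hu0 hψu hμ hμ1
  have hlow : ∀ y ∈ {y : ℝ | ∃ φ : ℝ → ℝ → ℝ, MemS α L ψ φ ∧ φ x t = y}, u x t ≤ y := by
    rintro _ ⟨φ, hφ, rfl⟩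
    exact hmin φ hφ x hx t ht.le
  refine le_antisymm ?_ (le_csInf ⟨_, _, hS (1 / 2) (by norm_num) (by norm_num), rfl⟩ hlow)
  have hD : Continuous fun μ : ℝ => (L / 2 / 2 + μ * (x - L / 2 / 2), μ ^ 2 * t) := by fun_prop
  have hcu : ContinuousAt (fun p : ℝ × ℝ => u p.1 p.2)
      (L / 2 / 2 + 1 * (x - L / 2 / 2), (1 : ℝ) ^ 2 * t) := by
    simpa using H.cont_u x hx t ht
  have hlim : Tendsto (fun μ => dilate u (L / 2) μ x t / μ) (𝓝 1) (𝓝 (u x t)) := by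
    have h1 := hcu.tendsto.comp (hD.tendsto 1)
    simp only [one_mul, one_pow, add_sub_cancel] at h1
    have h2 := h1.div (tendsto_id (x := 𝓝 (1 : ℝ))) one_ne_zero
    rwa [div_one] at h2
  refine ge_of_tendsto (hlim.mono_left (nhdsWithin_le_nhds (s := Iio 1))) ?_
  filter_upwards [Ioo_mem_nhdsLT (one_pos (α := ℝ))] with μ hμ
  exact csInf_le ⟨_, hlow⟩ ⟨_, hS μ hμ.1 hμ.2, rfl⟩

end PsiPlus

theorem psiPlus_regular_solution
    (α : ℝ → ℝ) (hα : Continuous α) (hαpos : ∀ p, 0 < α p)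
    (L : ℝ) (hL : 0 < L) (ψ : ℝ → ℝ)
    (hψc : ContinuousOn ψ (Ioo 0 (L/2)))
    (hψconc : ConcaveOn ℝ (Ioo 0 (L/2)) ψ)
    (hψpos : ∀ z ∈ Ioo (0:ℝ) (L/2), 0 < ψ z) :
    RegularOn (psiPlus α L ψ) (Ioo 0 (L/2) ×ˢ Ioi 0) ∧
    ∀ z t : ℝ, z ∈ Ioo (0:ℝ) (L/2) → 0 < t →
      pderivT (psiPlus α L ψ) z t =
        α (pderivX (psiPlus α L ψ) z t) * pderivXX (psiPlus α L ψ) z t := by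
  obtain ⟨u, v, n, H, hc, hu0, hψu, hmin⟩ :=
    PsiPlus.exists_solution hα hαpos hL hψc hψconc hψpos
  have heq : ∀ x ∈ Ioo 0 (L / 2), ∀ t, 0 < t → psiPlus α L ψ x t = u x t := fun x hx t ht =>
    PsiPlus.psiPlus_eq hα hαpos hL hψconc hψpos H hc hu0 hψu hmin hx ht
  obtain ⟨c1, c2, c3, c4⟩ := H.continuousOn hα hαpos
  obtain ⟨hreg, hder⟩ := PsiPlus.regularOn_of_hasDerivAt (u := psiPlus α L ψ)
    (fun x hx t ht => (H.space x hx t ht).congr_of_eventuallyEq (by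
      filter_upwards [Ioo_mem_nhds hx.1 hx.2] with y hy using heq y hy t ht)) H.slope
    (fun x hx t ht => (H.time x hx t ht).congr_of_eventuallyEq (by
      filter_upwards [Ioi_mem_nhds ht] with s hs using heq x hx s hs))
    (c1.congr fun p hp => heq _ hp.1 _ hp.2) c2 c3 c4
  refine ⟨hreg, fun z t hz ht => ?_⟩
  obtain ⟨d1, d2, d3⟩ := hder z hz t ht
  rw [d1, d2, d3, mul_div_cancel₀ _ (hαpos _).ne']
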